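/- Let V ⊆ ℂ^n be an irreducible variety of dimension d, let T be a finite set of hypersurfaces of ℂ^n, and let S ⊆ V(ℝ) be a finite set of points that is (k,b)-free with respect to T. Then the number of incidences satisfies ℐ(S,T) ≤ c_1·|S|^{α_k(d)}·deg(T)^{β_k(d)}·deg(V)^{1−α_k(d)} + k·deg(T)·deg(V) + (b−1)·|S|, where c_1 ≤ C(n)·τ_d(b,k) for some constant C(n) depending only on n. -/

import Mathlib

open MvPolynomial Set

noncomputable section

namespace Paper

variable (n : ℕ)

/-- The zero locus in `ℂⁿ` of a set of polynomials. -/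
def zeroLocus (I : Set (MvPolynomial (Fin n) ℂ)) : Set (Fin n → ℂ) :=
  {x | ∀ f ∈ I, eval x f = 0}

/-- A subset of `ℂⁿ` is algebraic if it is the zero locus of a set of polynomials. -/
def IsAlgebraicSet (V : Set (Fin n → ℂ)) : Prop :=
  ∃ I : Set (MvPolynomial (Fin n) ℂ), V = zeroLocus n I

/-- An irreducible (affine) variety in `ℂⁿ`: a nonempty algebraic set that is not covered
by two algebraic sets unless it is contained in one of them. -/
def IsIrredVariety (V : Set (Fin n → ℂ)) : Prop :=
  IsAlgebraicSet n V ∧ V.Nonempty ∧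
    ∀ V₁ V₂ : Set (Fin n → ℂ), IsAlgebraicSet n V₁ → IsAlgebraicSet n V₂ →
      V ⊆ V₁ ∪ V₂ → V ⊆ V₁ ∨ V ⊆ V₂

/-- There is a strictly increasing chain of `d + 1` irreducible varieties inside `V`. -/
def HasChain (V : Set (Fin n → ℂ)) (d : ℕ) : Prop :=
  ∃ W : Fin (d + 1) → Set (Fin n → ℂ),
    (∀ i, IsIrredVariety n (W i)) ∧ (∀ i j : Fin (d + 1), i < j → W i ⊂ W j) ∧
      W (Fin.last d) ⊆ V

/-- The (Krull) dimension of a subset of `ℂⁿ`, as the length of the longest chain of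
irreducible subvarieties. -/
def dim (V : Set (Fin n → ℂ)) : ℕ := sSup {d | HasChain n V d}

/-- `W` is an irreducible component of `X`: an irreducible subvariety that is maximal among
irreducible subvarieties of `X`. -/
def IsIrredComponent (W X : Set (Fin n → ℂ)) : Prop :=
  IsIrredVariety n W ∧ W ⊆ X ∧
    ∀ W', IsIrredVariety n W' → W ⊆ W' → W' ⊆ X → W' = W

/-- The degree of an irreducible variety `V ⊆ ℂⁿ` of dimension `d` (i.e. the degree of its
projective closure): the largest finite number of points in which an affine-linear subspace of
dimension `n - d` meets `V`. -/
def degree (V : Set (Fin n → ℂ)) : ℕ :=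
  sSup { m | ∃ L : AffineSubspace ℂ (Fin n → ℂ),
    Module.finrank ℂ L.direction = n - dim n V ∧ (V ∩ ↑L).Finite ∧ (V ∩ ↑L).ncard = m }

/-- The degree of an algebraic set: the sum of the degrees of its irreducible components. -/
def degreeSum (X : Set (Fin n → ℂ)) : ℕ :=
  ∑ᶠ W ∈ {W | IsIrredComponent n W X}, degree n W

/-- The maximal dimension of an irreducible component of `X` containing `V` equals `e`. -/
def MaxCompDimEq (X V : Set (Fin n → ℂ)) (e : ℕ) : Prop :=
  (∃ W, IsIrredComponent n W X ∧ V ⊆ W ∧ dim n W = e) ∧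
    ∀ W, IsIrredComponent n W X → V ⊆ W → dim n W ≤ e

/-- The partial degrees `δ_i(V)` of an irreducible variety `V`:  the minimal `δ` such that there
are polynomials of degree at most `δ` cutting out an algebraic set containing `V` whose
irreducible components containing `V` have maximal dimension `n - i`.  By convention
`δ_0(V) = 0`. -/
def partialDeg (V : Set (Fin n → ℂ)) (i : ℕ) : ℕ :=
  if i = 0 then 0
  else sInf { δ | ∃ I : Finset (MvPolynomial (Fin n) ℂ),
    (∀ f ∈ I, f.totalDegree ≤ δ) ∧ V ⊆ zeroLocus n ↑I ∧
      MaxCompDimEq n (zeroLocus n ↑I) V (n - i) }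

/-- The partial degrees as extended naturals, with the convention `δ_i(V) = ∞` for
`i > n - dim V`. -/
def partialDegE (V : Set (Fin n → ℂ)) (i : ℕ) : ℕ∞ :=
  if i ≤ n - dim n V then (partialDeg n V i : ℕ∞) else ⊤

/-- `δ(V)` for an irreducible variety `V`: the minimal `δ` such that `V` is an irreducible
component of the zero set of a finite family of polynomials of degree at most `δ`. -/
def deltaIrr (V : Set (Fin n → ℂ)) : ℕ :=
  sInf { δ | ∃ I : Finset (MvPolynomial (Fin n) ℂ),
    (∀ f ∈ I, f.totalDegree ≤ δ) ∧ IsIrredComponent n V (zeroLocus n ↑I) }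

/-- `δ(V)` for a general algebraic set `V`: the minimal `δ` such that every irreducible
component of `V` is an irreducible component of the zero set of a finite family of polynomials
of degree at most `δ`. -/
def deltaSet (V : Set (Fin n → ℂ)) : ℕ :=
  sInf { δ | ∃ I : Finset (MvPolynomial (Fin n) ℂ),
    (∀ f ∈ I, f.totalDegree ≤ δ) ∧
      ∀ W, IsIrredComponent n W V → IsIrredComponent n W (zeroLocus n ↑I) }

/-- An algebraic set all of whose irreducible components have dimension `d`. -/
def IsAlgSetOfDim (V : Set (Fin n → ℂ)) (d : ℕ) : Prop :=
  IsAlgebraicSet n V ∧ V.Nonempty ∧ ∀ W, IsIrredComponent n W V → dim n W = d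

/-- `Δ_i(V) = max (deg V / (δ_{i+1}(V) ⋯ δ_{n-d}(V))) 1`. -/
def Delta (V : Set (Fin n → ℂ)) (i : ℕ) : ℝ :=
  max ((degree n V : ℝ) / ∏ j ∈ Finset.Icc (i + 1) (n - dim n V), (partialDeg n V j : ℝ)) 1

/-- `i` is admissible with respect to `V` if `δ_{i+1}(V) > 2 i δ_i(V)` (with the convention
`δ_i(V) = ∞` for `i > n - dim V`). -/
def Admissible (V : Set (Fin n → ℂ)) (i : ℕ) : Prop :=
  ((2 * i : ℕ) : ℕ∞) * partialDegE n V i < partialDegE n V (i + 1)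

/-- The interval `ℛ_i(V) = [c₁ δ_i(V)^{n-i} Δ_i(V), (c₀/2) δ_{i+1}(V)^{n-i} Δ_i(V)]`,
where `δ_{n-d+1}(V) = ∞` makes the last interval a half-line. -/
def RSet (c0 c1 : ℝ) (V : Set (Fin n → ℂ)) (i : ℕ) : Set ℝ :=
  if i = n - dim n V then
    Set.Ici (c1 * (partialDeg n V i : ℝ) ^ (n - i) * Delta n V i)
  else
    Set.Icc (c1 * (partialDeg n V i : ℝ) ^ (n - i) * Delta n V i)
      ((c0 / 2) * (partialDeg n V (i + 1) : ℝ) ^ (n - i) * Delta n V i)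

/-- The interval `ℛ^l_{s,τ}(V) = [τ δ_s(V)^{n-(s+l)} Δ_s(V), τ δ_{s+1}(V)^{n-(s+l)} Δ_s(V)]`,
where `δ_{n-d+1}(V) = ∞` makes the last interval a half-line. -/
def RlSet (τ : ℝ) (l : ℕ) (V : Set (Fin n → ℂ)) (s : ℕ) : Set ℝ :=
  if s = n - dim n V then
    Set.Ici (τ * (partialDeg n V s : ℝ) ^ (n - (s + l)) * Delta n V s)
  else
    Set.Icc (τ * (partialDeg n V s : ℝ) ^ (n - (s + l)) * Delta n V s)
      (τ * (partialDeg n V (s + 1) : ℝ) ^ (n - (s + l)) * Delta n V s)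

/-- The ideal `I(V)` of polynomials vanishing on `V ⊆ ℂⁿ`. -/
def vanishingIdeal (V : Set (Fin n → ℂ)) : Ideal (MvPolynomial (Fin n) ℂ) where
  carrier := {f | ∀ x ∈ V, eval x f = 0}
  add_mem' := by
    intro a b ha hb x hx
    simp [ha x hx, hb x hx]
  zero_mem' := by
    intro x hx
    simp
  smul_mem' := by
    intro c f hf x hx
    simp [smul_eq_mul, hf x hx]

/-- The ideal `I_ℝ(V)` of real polynomials vanishing on `V ⊆ ℂⁿ`. -/
def vanishingIdealR (V : Set (Fin n → ℂ)) : Ideal (MvPolynomial (Fin n) ℝ) :=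
  (vanishingIdeal n V).comap (MvPolynomial.map (algebraMap ℝ ℂ))

/-- The affine Hilbert function `H_{I(V)}(m) = dim_ℂ ℂ[x]_{≤ m} / I(V)_{≤ m}`, realised as the
dimension of the image of the space of polynomials of total degree at most `m` in the quotient
ring `ℂ[x]/I(V)`. -/
def hilbert (V : Set (Fin n → ℂ)) (m : ℕ) : ℕ :=
  Module.finrank ℂ
    (Submodule.map (Ideal.Quotient.mkₐ ℂ (vanishingIdeal n V)).toLinearMap
      (restrictTotalDegree (Fin n) ℂ m))

/-- The real affine Hilbert function `H_{I(V),ℝ}(m) = dim_ℝ ℝ[x]_{≤ m} / I_ℝ(V)_{≤ m}`. -/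
def hilbertR (V : Set (Fin n → ℂ)) (m : ℕ) : ℕ :=
  Module.finrank ℝ
    (Submodule.map (Ideal.Quotient.mkₐ ℝ (vanishingIdealR n V)).toLinearMap
      (restrictTotalDegree (Fin n) ℝ m))

/-- The inclusion `ℝⁿ → ℂⁿ`. -/
def toC (x : Fin n → ℝ) : Fin n → ℂ := fun i => (x i : ℂ)

/-- The set of real points of `V ⊆ ℂⁿ`. -/
def realPts (V : Set (Fin n → ℂ)) : Set (Fin n → ℝ) := {x | toC n x ∈ V}

/-- The real zero set of a real polynomial. -/
def zeroSetR (g : MvPolynomial (Fin n) ℝ) : Set (Fin n → ℝ) := {x | eval x g = 0}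

/-- The zero locus of the polynomials `P 1, …, P i` (the first `i` members of a tuple of
polynomials indexed from `1`). -/
def zeroLocusUpTo (P : ℕ → MvPolynomial (Fin n) ℂ) (i : ℕ) : Set (Fin n → ℂ) :=
  zeroLocus n {f | ∃ j : ℕ, 1 ≤ j ∧ j ≤ i ∧ f = P j}

/-- `V'` is an `(n-s)`-minimal variety of the irreducible variety `V`. -/
def IsMinimalVariety (V V' : Set (Fin n → ℂ)) (s : ℕ) : Prop :=
  IsIrredVariety n V' ∧ V ⊆ V' ∧ dim n V' = n - s ∧
    ∀ f ∈ vanishingIdeal n V, f ∉ vanishingIdeal n V' →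
      partialDegE n V (s + 1) ≤ (f.totalDegree : ℕ∞)

/-- `S` is `(k,b)`-free with respect to `T`, for the incidence relation `R`. -/
def KBFree {α β : Type*} (R : α → β → Prop) (S : Finset α) (T : Finset β) (k b : ℕ) : Prop :=
  ¬ ∃ (P : Finset α) (B : Finset β), P ⊆ S ∧ B ⊆ T ∧ P.card = k ∧ B.card = b ∧
      ∀ s ∈ P, ∀ t ∈ B, R s t

/-- The number of incidences between a finite set of points and a finite family of sets. -/
def incCountAbs {α : Type*} (S : Finset α) (T : Finset (Set α)) : ℕ :=
  ∑ t ∈ T, (↑S ∩ t).ncard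

/-- The number of incidences between a finite set of real points and a finite family of
subsets of `ℂⁿ`. -/
def incCount (S : Finset (Fin n → ℝ)) (T : Finset (Set (Fin n → ℂ))) : ℕ :=
  ∑ t ∈ T, (↑S ∩ toC n ⁻¹' t).ncard

/-- The total degree `deg T = ∑_{t ∈ T} deg t` of a finite family of algebraic sets. -/
def degFamily (T : Finset (Set (Fin n → ℂ))) : ℕ := ∑ t ∈ T, degreeSum n t

/-- The total degree of a finite family of irreducible varieties. -/
def degFamilyIrred (T : Finset (Set (Fin n → ℂ))) : ℕ := ∑ t ∈ T, degree n t

/-- `α_k(d)`. -/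
def alpha (k d : ℕ) : ℝ :=
  if k = 1 ∧ d = 1 then 0 else (k : ℝ) * ((d : ℝ) - 1) / ((d : ℝ) * (k : ℝ) - 1)

/-- `β_k(d)`. -/
def beta (k d : ℕ) : ℝ :=
  if k = 1 ∧ d = 1 then 1 else (d : ℝ) * ((k : ℝ) - 1) / ((d : ℝ) * (k : ℝ) - 1)

/-- `τ_d(b,k) = b^{1-β_k(d)} k^{1-α_k(d)}`. -/
def tauC (d b k : ℕ) : ℝ := (b : ℝ) ^ (1 - beta k d) * (k : ℝ) ^ (1 - alpha k d)

/-- The Chardin–Philippon property of the constant `c₀`: for every pure-dimensional algebraic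
set `W ⊆ ℂⁿ` and every `m ≥ 2 (n - dim W) δ(W)` one has `H_{I(W)}(m) ≥ c₀ m^{dim W} deg W`. -/
def ChardinPhilippon (c0 : ℝ) : Prop :=
  ∀ (W : Set (Fin n → ℂ)) (e : ℕ), IsAlgSetOfDim n W e →
    ∀ m : ℕ, 2 * (n - e) * deltaSet n W ≤ m →
      c0 * (m : ℝ) ^ e * (degreeSum n W : ℝ) ≤ (hilbert n W m : ℝ)

/-- The defining property of the constant `c₁`: for every irreducible variety `V`, every
positive integer lies in some interval `ℛ_i(V)` with `i` admissible with respect to `V`. -/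
def CoversPositiveIntegers (c0 c1 : ℝ) : Prop :=
  ∀ V : Set (Fin n → ℂ), IsIrredVariety n V →
    ∀ m : ℕ, 0 < m → ∃ i, Admissible n V i ∧ (m : ℝ) ∈ RSet n c0 c1 V i

/-- `i_V(M)`: the smallest admissible `i` such that `M^{n-i} Δ_i(V) ∈ ℛ_i(V)`. -/
def iV (c0 c1 : ℝ) (V : Set (Fin n → ℂ)) (M : ℕ) : ℕ :=
  sInf {i | Admissible n V i ∧ (M : ℝ) ^ (n - i) * Delta n V i ∈ RSet n c0 c1 V i}

/-- A real polynomial bisects a finite set `S ⊆ ℝⁿ` if it is positive on at most half of `S`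
and negative on at most half of `S`. -/
def Bisects (g : MvPolynomial (Fin n) ℝ) (S : Finset (Fin n → ℝ)) : Prop :=
  ((↑S ∩ {x | 0 < eval x g}).ncard : ℝ) ≤ (S.card : ℝ) / 2 ∧
    ((↑S ∩ {x | eval x g < 0}).ncard : ℝ) ≤ (S.card : ℝ) / 2

/-- The set of `r`-rich points of a family `T`: points lying in at least `r` members of `T`. -/
def richPts (T : Finset (Set (Fin n → ℂ))) (r : ℕ) : Set (Fin n → ℂ) :=
  {x | r ≤ ({t | t ∈ T ∧ x ∈ t} : Set (Set (Fin n → ℂ))).ncard}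

/-- A real hypersurface of degree at most `D`: the real zero set of a nonzero real polynomial
of degree at most `D`. -/
def IsRealHypersurfaceDegLE (t : Set (Fin n → ℝ)) (D : ℕ) : Prop :=
  ∃ p : MvPolynomial (Fin n) ℝ, p ≠ 0 ∧ t = zeroSetR n p ∧ p.totalDegree ≤ D

/-- Lexicographic comparison of the tuples `(f 1, …, f m)` and `(g 1, …, g m)`. -/
def LexLE (m : ℕ) (f g : ℕ → ℕ) : Prop :=
  (∀ j ∈ Finset.Icc 1 m, f j = g j) ∨
    ∃ i ∈ Finset.Icc 1 m, (∀ j, 1 ≤ j → j < i → f j = g j) ∧ f i < g i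

end Paper

set_option linter.unusedSectionVars false

namespace Paper

section Red
variable {k A : Type*} [Field k] [CommRing A] [Algebra k A]
def Ysp (k : Type*) {A : Type*} [Field k] [CommRing A] [Algebra k A] {e : ℕ} (y : Fin e → A) :
    Submodule k A := Submodule.span k (insert 1 (Set.range y))
lemma one_mem_Ysp {e : ℕ} (y : Fin e → A) : (1 : A) ∈ Ysp k y :=
  Submodule.subset_span (Set.mem_insert _ _)
lemma mem_Ysp {e : ℕ} (y : Fin e → A) (i : Fin e) : y i ∈ Ysp k y :=
  Submodule.subset_span (Set.mem_insert_of_mem _ ⟨i, rfl⟩)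
lemma pow_mono_of_one {V : Submodule k A} (h1 : (1 : A) ∈ V) {i j : ℕ} (h : i ≤ j) :
    V ^ i ≤ V ^ j := by
  apply pow_le_pow_right₀ _ h
  rw [Submodule.one_eq_span, Submodule.span_le]; simpa using h1
lemma mul_mono_R {M N P : Submodule k A} (h : N ≤ P) : M * N ≤ M * P :=
  mul_le_mul' le_rfl h
lemma mul_mono_L {M N P : Submodule k A} (h : N ≤ P) : N * M ≤ P * M :=
  mul_le_mul' h le_rfl
lemma le_mul_of_one {V W : Submodule k A} (h1 : (1 : A) ∈ V) : W ≤ V * W := by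
  intro w hw; simpa using Submodule.mul_mem_mul h1 hw
lemma monomial_red {e : ℕ} (y : Fin (e+1) → A) (a : Fin (e+1) → k)
    (Y' : Submodule k A) (hy' : ∀ i, y i - a i • y 0 ∈ Y') (s : Multiset (Fin (e+1))) :
    (s.map y).prod - (s.map a).prod • y 0 ^ s.card ∈
      (if s.card = 0 then ⊥ else Y' * (Ysp k y) ^ (s.card - 1)) := by
  induction s using Multiset.induction_on with
  | empty => simp
  | cons i s ih =>
    simp only [Multiset.map_cons, Multiset.prod_cons, Multiset.card_cons, Nat.add_eq_zero_iff,
      one_ne_zero, and_false, if_false, Nat.add_sub_cancel]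
    have e1 : y i * (s.map y).prod - (a i * (s.map a).prod) • y 0 ^ (s.card + 1) =
      ((s.map y).prod - (s.map a).prod • y 0 ^ s.card) * y i +
        (s.map a).prod • ((y i - a i • y 0) * y 0 ^ s.card) := by
      simp only [Algebra.smul_def, map_mul]; ring
    rw [e1]
    refine add_mem ?_ (Submodule.smul_mem _ _ (Submodule.mul_mem_mul (hy' i)
      (Submodule.pow_mem_pow _ (mem_Ysp y 0) _)))
    by_cases h : s.card = 0
    · rw [if_pos h] at ih
      rw [(Submodule.mem_bot k).1 ih, zero_mul]; exact zero_mem _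
    · rw [if_neg h] at ih
      have := Submodule.mul_mem_mul ih (mem_Ysp (k := k) y i)
      rw [mul_assoc, ← pow_succ, Nat.sub_add_cancel (Nat.one_le_iff_ne_zero.2 h)] at this
      exact this
lemma prod_pow_mem {ι : Type*} (Y : Submodule k A) (t : Finset ι) (y : ι → A) (hy : ∀ i, y i ∈ Y)
    (s : ι → ℕ) : ∏ i ∈ t, y i ^ s i ∈ Y ^ (∑ i ∈ t, s i) := by
  classical
  induction t using Finset.induction_on with
  | empty => simpa using ⟨1, map_one _⟩
  | insert i t hi ih =>
    rw [Finset.prod_insert hi, Finset.sum_insert hi, pow_add]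
    exact Submodule.mul_mem_mul (Submodule.pow_mem_pow _ (hy i) _) ih
lemma aeval_mem_Ysp {e : ℕ} (y : Fin e → A) (m : ℕ) (G : MvPolynomial (Fin e) k)
    (hG : G.totalDegree ≤ m) : aeval y G ∈ Ysp k y ^ m := by
  rw [aeval_def, eval₂_eq]
  refine Submodule.sum_mem _ fun s hs => ?_
  rw [← Algebra.smul_def]
  refine Submodule.smul_mem _ _ ?_
  have h2 : s.sum (fun _ t => t) ≤ m := (le_totalDegree hs).trans hG
  refine pow_mono_of_one (one_mem_Ysp y) h2 ?_
  exact prod_pow_mem _ _ y (mem_Ysp y) _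
lemma red_pow {V Y : Submodule k A} {N : ℕ} (hN : V ^ (N + 1) ≤ Y * V ^ N) (j : ℕ) :
    V ^ (N + j) ≤ Y ^ j * V ^ N := by
  induction j with
  | zero => simp
  | succ j ih =>
    rw [← add_assoc, pow_succ' V]
    refine (mul_mono_R ih).trans ?_
    rw [mul_left_comm, ← pow_succ' V, pow_succ Y, mul_assoc]
    exact mul_mono_R hN
theorem exists_noether [Infinite k] [Nontrivial A] (V : Submodule k A) (h1 : (1 : A) ∈ V)
    (hfg : V.FG) : ∃ (e : ℕ) (y : Fin e → A), (∀ i, y i ∈ V) ∧ AlgebraicIndependent k y ∧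
      ∃ N, V ^ (N + 1) ≤ Ysp k y * V ^ N := by
  classical
  have hex : ∃ e : ℕ, ∃ y : Fin e → A, (∀ i, y i ∈ V) ∧ ∃ N, V ^ (N + 1) ≤ Ysp k y * V ^ N := by
    obtain ⟨m, s, hs⟩ := Submodule.fg_iff_exists_fin_generating_family.1 hfg
    refine ⟨m, s, fun i => hs ▸ Submodule.subset_span ⟨i, rfl⟩, 0, ?_⟩
    simp only [zero_add, pow_one, pow_zero, mul_one]
    rw [← hs]; exact Submodule.span_mono (Set.subset_insert _ _)
  obtain ⟨y, hyV, N, hN⟩ := Nat.find_spec hex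
  have hmin := fun m (hm : m < Nat.find hex) => Nat.find_min hex hm
  generalize Nat.find hex = e at *
  refine ⟨e, y, hyV, ?_, N, hN⟩
  rw [algebraicIndependent_iff]
  by_contra! hcon
  obtain ⟨G, hG0, hGne⟩ := hcon
  obtain _ | e := e
  · obtain ⟨c, rfl⟩ := C_surjective (Fin 0) G
    simp only [algHom_C] at hG0
    exact hGne (by rw [(map_eq_zero_iff _ (FaithfulSMul.algebraMap_injective k A)).1 hG0, map_zero])
  set g := G.totalDegree with hg
  have hgpos : g ≠ 0 := by
    intro h0
    rw [totalDegree_eq_zero_iff_eq_C.1 h0] at hG0 hGne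
    simp only [algHom_C] at hG0
    exact hGne (by rw [(map_eq_zero_iff _ (FaithfulSMul.algebraMap_injective k A)).1 hG0, map_zero])
  have htop : homogeneousComponent g G ≠ 0 := by
    obtain ⟨s, hs, hsd⟩ := Finset.exists_mem_eq_sup _ (support_nonempty.2 hGne)
      (fun s : Fin (e+1) →₀ ℕ => s.sum fun _ t => t)
    intro h0
    have := congrArg (coeff s) h0
    rw [coeff_homogeneousComponent, if_pos] at this
    · exact (mem_support_iff.1 hs) (by simpa using this)
    · rw [hg, totalDegree, hsd]; rfl
  obtain ⟨c, hc⟩ : ∃ c, eval c (homogeneousComponent g G * X 0) ≠ 0 := by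
    by_contra! h
    exact mul_ne_zero htop (X_ne_zero 0) (funext fun x => by simpa using h x)
  rw [map_mul, eval_X] at hc
  have hc0 : c 0 ≠ 0 := right_ne_zero_of_mul hc
  have hcG : eval c (homogeneousComponent g G) ≠ 0 := left_ne_zero_of_mul hc
  set a : Fin (e+1) → k := fun i => c i / c 0 with ha
  set y' : Fin e → A := fun i => y i.succ - a i.succ • y 0 with hy'
  have hyV0 : ∀ i, y' i ∈ V := fun i => sub_mem (hyV _) (Submodule.smul_mem _ _ (hyV _))
  have hmem : ∀ i, y i - a i • y 0 ∈ Ysp k y' := by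
    intro i
    refine Fin.cases ?_ (fun j => mem_Ysp y' j) i
    simp [ha, div_self hc0]
  have hYY : Ysp k y ≤ V := by
    rw [Ysp, Submodule.span_le]; rintro x (rfl | ⟨i, rfl⟩); exacts [h1, hyV i]
  have key : ∀ s ∈ G.support, (s.prod fun i t => y i ^ t) -
      (if s.degree = g then (s.prod fun i t => a i ^ t) • y 0 ^ g else 0) ∈
      Ysp k y' * Ysp k y ^ (g - 1) := by
    intro s hs
    have hle : s.degree ≤ g := le_totalDegree hs
    split_ifs with hd
    · have := monomial_red y a (Ysp k y') hmem (Finsupp.toMultiset s)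
      rw [Finsupp.card_toMultiset] at this
      have hd' : (s.sum fun _ => id) = g := hd
      rw [hd', if_neg hgpos, Finsupp.toMultiset_map, Finsupp.toMultiset_map,
        Finsupp.prod_toMultiset, Finsupp.prod_toMultiset,
        Finsupp.prod_mapDomain_index (by simp) (by intros; rw [pow_add]),
        Finsupp.prod_mapDomain_index (by simp) (by intros; rw [pow_add])] at this
      exact this
    · rw [sub_zero]
      refine le_mul_of_one (one_mem_Ysp y') ?_
      have : s.degree ≤ g - 1 := by omega
      refine pow_mono_of_one (one_mem_Ysp y) this ?_
      exact prod_pow_mem _ _ y (mem_Ysp y) _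
  have hy0 : y 0 ^ g ∈ Ysp k y' * Ysp k y ^ (g - 1) := by
    have hsum : ∑ s ∈ G.support, coeff s G • ((s.prod fun i t => y i ^ t) -
      (if s.degree = g then (s.prod fun i t => a i ^ t) • y 0 ^ g else 0)) ∈
      Ysp k y' * Ysp k y ^ (g - 1) := Submodule.sum_mem _ fun s hs => Submodule.smul_mem _ _ (key s hs)
    have e1 : ∑ s ∈ G.support, coeff s G • (s.prod fun i t => y i ^ t) = 0 := by
      rw [← hG0, aeval_def, eval₂_eq]
      exact Finset.sum_congr rfl fun s _ => by rw [Algebra.smul_def]; rfl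
    have e2 : ∑ s ∈ G.support, coeff s G •
        (if s.degree = g then (s.prod fun i t => a i ^ t) • y 0 ^ g else 0) =
        (eval a (homogeneousComponent g G)) • y 0 ^ g := by
      rw [homogeneousComponent_apply, map_sum, Finset.sum_smul, Finset.sum_filter]
      refine Finset.sum_congr rfl fun s _ => ?_
      split_ifs
      · rw [eval_monomial, smul_smul]
      · simp
    simp only [smul_sub, Finset.sum_sub_distrib] at hsum
    rw [e1, e2, zero_sub, Submodule.neg_mem_iff] at hsum
    have hne : eval a (homogeneousComponent g G) ≠ 0 := by
      intro h0
      apply hcG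
      have : eval c (homogeneousComponent g G) = c 0 ^ g * eval a (homogeneousComponent g G) := by
        rw [eval_eq, eval_eq, Finset.mul_sum]
        refine Finset.sum_congr rfl fun s hs => ?_
        have hd : ∑ i ∈ s.support, s i = g := by
          have := homogeneousComponent_isHomogeneous g G (mem_support_iff.1 hs)
          have h2 : s.degree = g := by rw [Finsupp.degree_eq_weight_one]; exact this
          exact h2
        simp only [ha, div_pow, Finset.prod_div_distrib, Finset.prod_pow_eq_pow_sum, hd]
        field_simp
      rw [this, h0, mul_zero]
    exact (Submodule.smul_mem_iff _ hne).1 hsum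
  refine hmin e (Nat.lt_succ_self e) ⟨y', hyV0, N + (g - 1), ?_⟩
  have hsup : Ysp k y ≤ Ysp k y' ⊔ Submodule.span k {y 0} := by
    rw [Ysp, Submodule.span_le]
    rintro x (rfl | ⟨i, rfl⟩)
    · exact Submodule.mem_sup_left (one_mem_Ysp y')
    · rw [← sub_add_cancel (y i) (a i • y 0)]
      exact add_mem (Submodule.mem_sup_left (hmem i)) (Submodule.mem_sup_right
        (Submodule.smul_mem _ _ (Submodule.mem_span_singleton_self _)))
  have hstep : ∀ j, Ysp k y ^ (j + 1) ≤ Ysp k y' * Ysp k y ^ j ⊔ Submodule.span k {y 0 ^ (j + 1)} := by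
    intro j
    induction j with
    | zero => simpa using hsup
    | succ j ih =>
      rw [pow_succ' _ (j + 1)]
      refine (mul_mono_R ih).trans ?_
      rw [Submodule.mul_sup]
      refine sup_le ?_ ?_
      · rw [mul_left_comm, ← pow_succ']; exact le_sup_left
      · refine (mul_mono_L hsup).trans ?_
        rw [Submodule.sup_mul]
        refine sup_le (le_sup_of_le_left (mul_mono_R ?_)) (le_sup_of_le_right ?_)
        · rw [Submodule.span_singleton_le_iff_mem]; exact Submodule.pow_mem_pow _ (mem_Ysp y 0) _
        · rw [Submodule.span_mul_span, Set.singleton_mul_singleton, ← pow_succ']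
  have hYg : Ysp k y ^ g ≤ Ysp k y' * Ysp k y ^ (g - 1) := by
    have := hstep (g - 1)
    rw [Nat.sub_add_cancel (Nat.one_le_iff_ne_zero.2 hgpos)] at this
    refine this.trans (sup_le le_rfl ?_)
    rw [Submodule.span_singleton_le_iff_mem]; exact hy0
  have hVj := red_pow hN
  calc V ^ (N + (g - 1) + 1) = V ^ (N + g) := by congr 1; omega
    _ ≤ _ := hVj g
    _ ≤ (Ysp k y' * Ysp k y ^ (g - 1)) * V ^ N := mul_mono_L hYg
    _ ≤ (Ysp k y' * V ^ (g - 1)) * V ^ N :=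
      mul_mono_L (mul_mono_R (pow_le_pow_left' hYY _))
    _ = _ := by rw [mul_assoc, ← pow_add, add_comm N]
end Red

def monF (e s : ℕ) : Finset (Fin e →₀ ℕ) :=
  (Finset.range (s + 1)).biUnion fun j => (Finset.univ : Finset (Fin e)).finsuppAntidiag j
lemma mem_monF {e s : ℕ} {d : Fin e →₀ ℕ} : d ∈ monF e s ↔ d.degree ≤ s := by
  classical
  simp only [monF, Finset.mem_biUnion, Finset.mem_finsuppAntidiag, Finset.mem_range]
  rw [Finsupp.degree_eq_sum]
  constructor
  · rintro ⟨j, hj, h, -⟩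
    exact (h.le.trans (Nat.lt_succ_iff.1 hj) : _)
  · intro h; exact ⟨_, Nat.lt_succ_of_le h, rfl, Finset.subset_univ _⟩
lemma card_monF (e s : ℕ) : (monF e s).card = (s + e).choose e := by
  classical
  rw [monF, Finset.card_biUnion]
  · simp only [Finset.card_finsuppAntidiag_nat_eq_multichoose, Finset.card_univ, Fintype.card_fin]
    rw [Nat.sum_range_multichoose, add_comm]
    try rw [Nat.choose_symm_add]
  · intro i _ j _ hij
    rw [Function.onFun, Finset.disjoint_left]
    intro d h1 h2
    rw [Finset.mem_finsuppAntidiag] at h1 h2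
    exact hij (h1.1.symm.trans h2.1)
lemma finrank_rtd (k : Type*) [Field k] (e s : ℕ) :
    Module.finrank k (restrictTotalDegree (Fin e) k s) = (s + e).choose e := by
  classical
  have hset : { d : Fin e →₀ ℕ | (d.sum fun _ t => t) ≤ s } = ↑(monF e s) := by
    ext d
    rw [Finset.mem_coe, mem_monF]; rfl
  unfold restrictTotalDegree
  rw [hset, Module.finrank_eq_card_basis (basisRestrictSupport k _)]
  exact (Fintype.card_coe _).trans (card_monF e s)
lemma rtd_pow_le {k : Type*} [Field k] {e : ℕ} (m : ℕ) :
    (restrictTotalDegree (Fin e) k 1) ^ m ≤ restrictTotalDegree (Fin e) k m := by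
  induction m with
  | zero =>
    rw [pow_zero, Submodule.one_le]; simp [mem_restrictTotalDegree]
  | succ m ih =>
    rw [pow_succ, Submodule.mul_le]
    intro a ha b hb
    have ha := ih ha
    rw [mem_restrictTotalDegree] at *
    exact (totalDegree_mul _ _).trans (add_le_add ha hb)
lemma Ysp_le {k : Type*} [Field k] {e n : ℕ} (y : Fin e → MvPolynomial (Fin n) k)
    (hy : ∀ i, (y i).totalDegree ≤ 1) : Ysp k y ≤ restrictTotalDegree (Fin n) k 1 := by
  rw [Ysp, Submodule.span_le]
  rintro x (rfl | ⟨i, rfl⟩)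
  · simp [mem_restrictTotalDegree]
  · simpa [mem_restrictTotalDegree] using hy i
lemma totalDegree_aeval_le {k : Type*} [Field k] {e n : ℕ} (y : Fin e → MvPolynomial (Fin n) k)
    (hy : ∀ i, (y i).totalDegree ≤ 1) (H : MvPolynomial (Fin e) k) :
    (aeval y H).totalDegree ≤ H.totalDegree :=
  (mem_restrictTotalDegree _ _ _).1
    (rtd_pow_le _ (pow_le_pow_left' (Ysp_le y hy) _ (aeval_mem_Ysp y _ H le_rfl)))
lemma rtd_pow {k : Type*} [Field k] {e : ℕ} (m : ℕ) :
    restrictTotalDegree (Fin e) k m = (restrictTotalDegree (Fin e) k 1) ^ m := by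
  refine le_antisymm (fun H hH => ?_) (rtd_pow_le m)
  have := aeval_mem_Ysp (k := k) (X : Fin e → MvPolynomial (Fin e) k) m H
    ((mem_restrictTotalDegree _ _ _).1 hH)
  rw [aeval_X_left_apply] at this
  exact pow_le_pow_left' (Ysp_le _ (fun i => by simp)) _ this
lemma eq_zero_of_mem_pow {k : Type*} [Field k] {e t : ℕ} {H : MvPolynomial (Fin e) k}
    (h : H ∈ idealOfVars (Fin e) k ^ t) (hd : H.totalDegree < t) : H = 0 := by
  rw [mem_pow_idealOfVars_iff] at h
  by_contra h0
  obtain ⟨d, hd'⟩ := Finset.nonempty_iff_ne_empty.2 (mt support_eq_empty.1 h0)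
  have h1 := h d hd'
  have h2 : d.degree ≤ H.totalDegree := le_totalDegree hd'
  omega
lemma cancel_pow {k : Type*} [Field k] {e t : ℕ} {s H : MvPolynomial (Fin e) k}
    (hs : constantCoeff s ≠ 0) (h : s * H ∈ idealOfVars (Fin e) k ^ t) :
    H ∈ idealOfVars (Fin e) k ^ t := by
  have hc : IsCoprime (Ideal.span {s}) (idealOfVars (Fin e) k ^ t) := by
    apply IsCoprime.pow_right
    rw [Ideal.isCoprime_iff_exists]
    refine ⟨C (constantCoeff s)⁻¹ * s, Ideal.mul_mem_left _ _ (Ideal.subset_span rfl),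
      1 - C (constantCoeff s)⁻¹ * s, ?_, by ring⟩
    rw [← pow_one (idealOfVars (Fin e) k), mem_pow_idealOfVars_iff']
    intro x hx
    have : x = 0 := by rw [← Finsupp.degree_eq_zero_iff]; omega
    subst this
    rw [← constantCoeff_eq]
    simp [hs]
  obtain ⟨a, ha, b, hb, hab⟩ := Ideal.isCoprime_iff_exists.1 hc
  obtain ⟨c, rfl⟩ := Ideal.mem_span_singleton'.1 ha
  have : H = c * (s * H) + b * H := by linear_combination (-H) * hab
  rw [this]
  exact add_mem (Ideal.mul_mem_left _ _ h) (Ideal.mul_mem_right _ _ hb)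
abbrev Bp (k : Type*) [Field k] (e : ℕ) := MvPolynomial (Fin e) k
abbrev Kp (k : Type*) [Field k] (e : ℕ) := FractionRing (MvPolynomial (Fin e) k)
section UB0
variable {k : Type*} [Field k] {e : ℕ} {E : Type*} [CommRing E] [Algebra k E] [Algebra (Bp k e) E]
  [IsScalarTower k (Bp k e) E]
def yE (k : Type*) [Field k] (e : ℕ) (E : Type*) [CommRing E] [Algebra (Bp k e) E] : Fin e → E :=
  fun i => algebraMap (Bp k e) E (X i)
lemma algebraMap_mem_Y (s : ℕ) (G : Bp k e) (hG : G.totalDegree ≤ s) :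
    algebraMap (Bp k e) E G ∈ Ysp k (yE k e E) ^ s := by
  have := aeval_mem_Ysp (yE k e E) s G hG
  have h2 : aeval (R := k) (yE k e E) = IsScalarTower.toAlgHom k (Bp k e) E := by
    apply MvPolynomial.algHom_ext; intro i; simp [yE]
  rw [h2] at this; exact this
lemma Y_pow_le (s : ℕ) : Ysp k (yE k e E) ^ s ≤
    (restrictTotalDegree (Fin e) k s).map (IsScalarTower.toAlgHom k (Bp k e) E).toLinearMap := by
  induction s with
  | zero =>
    rw [pow_zero, Submodule.one_eq_span, Submodule.span_le]
    simp only [Set.singleton_subset_iff]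
    exact ⟨1, by simp [mem_restrictTotalDegree], by simp⟩
  | succ s ih =>
    rw [pow_succ, Submodule.mul_le]
    intro a ha b hb
    obtain ⟨G, hG, rfl⟩ := ih ha
    have hb' : Ysp k (yE k e E) ≤
      (restrictTotalDegree (Fin e) k 1).map (IsScalarTower.toAlgHom k (Bp k e) E).toLinearMap := by
      rw [Ysp, Submodule.span_le]
      rintro x (rfl | ⟨i, rfl⟩)
      · exact ⟨1, by simp [mem_restrictTotalDegree], by simp⟩
      · exact ⟨X i, by simp [mem_restrictTotalDegree], by simp [yE]⟩
    obtain ⟨H, hH, rfl⟩ := hb' hb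
    refine ⟨G * H, ?_, by simp⟩
    simp only [SetLike.mem_coe, mem_restrictTotalDegree] at *
    exact (totalDegree_mul _ _).trans (add_le_add hG hH)
end UB0
section UB
variable {k : Type*} [Field k] {e : ℕ} {E : Type*} [CommRing E] [Algebra k E] [Algebra (Bp k e) E]
  [Algebra (Kp k e) E] [IsScalarTower k (Bp k e) E] [IsScalarTower (Bp k e) (Kp k e) E]
def rk (k : Type*) [Field k] (e : ℕ) {E : Type*} [CommRing E] [Algebra k E]
  [Algebra (Kp k e) E] (U : Submodule k E) : ℕ :=
  Module.finrank (Kp k e) (Submodule.span (Kp k e) (U : Set E))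
lemma span_fg (U : Submodule k E) (hfg : U.FG) :
    (Submodule.span (Kp k e) (U : Set E)).FG := by
  obtain ⟨t, ht⟩ := hfg
  refine ⟨t, le_antisymm (Submodule.span_mono (by rw [← ht]; exact Submodule.subset_span)) ?_⟩
  rw [Submodule.span_le]
  intro x hx
  rw [← ht] at hx
  induction hx using Submodule.span_induction with
  | mem x h => exact Submodule.subset_span h
  | zero => exact zero_mem _
  | add x y _ _ h1 h2 => exact add_mem h1 h2
  | smul a x _ h =>
    have : a • x = (algebraMap (Bp k e) (Kp k e) (C a)) • x := by
      rw [algebraMap_smul, ← algebraMap_smul (Bp k e) a x]; rfl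
    rw [this]; exact Submodule.smul_mem _ _ h
theorem rk_lower (V : Submodule k E) (hfg : V.FG) (hy : Ysp k (yE k e E) ≤ V) (m s : ℕ) :
    rk k e (V ^ m) * (s + e).choose e ≤ Module.finrank k ↥(V ^ (m + s)) := by
  classical
  have hfin : ∀ j, Module.Finite k ↥(V ^ j) := fun j => Module.Finite.iff_fg.2 (hfg.pow j)
  have hf2 : Module.Finite (Kp k e) (Submodule.span (Kp k e) ((V ^ m : Submodule k E) : Set E)) :=
    Module.Finite.iff_fg.2 (span_fg _ (hfg.pow m))
  obtain ⟨b, hb, hspan, hli⟩ := exists_linearIndependent (Kp k e) ((V ^ m : Submodule k E) : Set E)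
  rw [← hspan] at hf2
  have hbf : Finite b := by
    have h2 : LinearIndependent (Kp k e) (fun x : b => (⟨x.1, Submodule.subset_span x.2⟩ :
        Submodule.span (Kp k e) b)) := LinearIndependent.of_comp (Submodule.subtype _) hli
    exact h2.finite
  have := Fintype.ofFinite b
  have hcard : rk k e (V ^ m) = Fintype.card b := by
    rw [rk, ← hspan]
    exact finrank_span_set_eq_card hli |>.trans (Set.toFinset_card _)
  let φ : (b → restrictTotalDegree (Fin e) k s) →ₗ[k] E :=
    { toFun := fun c => ∑ i, algebraMap (Bp k e) E (c i).1 * i.1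
      map_add' := by intro x y; simp [add_mul, Finset.sum_add_distrib]
      map_smul' := by
        intro a x
        simp only [Pi.smul_apply, Submodule.coe_smul, RingHom.id_apply, Finset.smul_sum]
        refine Finset.sum_congr rfl fun i _ => ?_
        rw [Algebra.smul_def, map_mul, mul_assoc, ← Algebra.smul_def]
        rw [MvPolynomial.algebraMap_eq, ← MvPolynomial.algebraMap_eq, ← Algebra.smul_def, algebraMap_smul] }
  have hinj : Function.Injective φ := by
    rw [injective_iff_map_eq_zero]
    intro c hc
    have : ∑ i : b, (algebraMap (Bp k e) (Kp k e) (c i).1) • (i : E) = 0 := by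
      rw [← hc]
      refine Finset.sum_congr rfl fun i _ => ?_
      rw [algebraMap_smul, Algebra.smul_def]
    have h0 := Fintype.linearIndependent_iff.1 hli _ this
    funext i
    have := h0 i
    rw [map_eq_zero_iff _ (IsFractionRing.injective (Bp k e) (Kp k e))] at this
    exact Subtype.ext this
  have hran : ∀ c, φ c ∈ V ^ (m + s) := by
    intro c
    refine Submodule.sum_mem _ fun i _ => ?_
    rw [add_comm, pow_add]
    refine Submodule.mul_mem_mul ?_ (hb i.2)
    exact pow_le_pow_left' hy s (algebraMap_mem_Y s _ ((mem_restrictTotalDegree _ _ _).1 (c i).2))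
  have := LinearMap.finrank_le_finrank_of_injective (f := φ.codRestrict (V ^ (m+s)) hran)
    (fun x y h => hinj (by simpa using congrArg Subtype.val h))
  rwa [Module.finrank_pi_fintype, Finset.sum_const, Finset.card_univ, ← hcard, finrank_rtd,
    smul_eq_mul] at this
end UB

section UB2
variable {k : Type*} [Field k] {e : ℕ} {E : Type*} [CommRing E] [Algebra k E] [Algebra (Bp k e) E]
  [Algebra (Kp k e) E] [IsScalarTower k (Bp k e) E] [IsScalarTower (Bp k e) (Kp k e) E]
lemma exists_common_denom {ι κ : Type*} [Finite ι] [Finite κ] (x : ι → κ → Kp k e) :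
    ∃ f : Bp k e, f ≠ 0 ∧ ∀ i j, ∃ G : Bp k e, algebraMap _ (Kp k e) f * x i j = algebraMap _ _ G := by
  obtain ⟨b, hb⟩ := IsLocalization.exist_integer_multiples_of_finite (nonZeroDivisors (Bp k e))
    (fun p : ι × κ => x p.1 p.2)
  refine ⟨b, nonZeroDivisors.ne_zero b.2, fun i j => ?_⟩
  obtain ⟨G, hG⟩ := hb (i, j)
  exact ⟨G, by rw [hG, Algebra.smul_def]⟩
def coLat {ι : Type*} (w : Module.Basis ι (Kp k e) E) (f : Bp k e) (M : ℕ) : Submodule k E where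
  carrier := {x | ∀ i, ∃ G : Bp k e, G.totalDegree ≤ M ∧
    algebraMap _ (Kp k e) f * w.repr x i = algebraMap _ (Kp k e) G}
  add_mem' := by
    intro a b ha hb i
    obtain ⟨G, hG, h1⟩ := ha i
    obtain ⟨H, hH, h2⟩ := hb i
    exact ⟨G + H, (totalDegree_add _ _).trans (max_le hG hH), by simp [mul_add, h1, h2]⟩
  zero_mem' := by intro i; exact ⟨0, by simp, by simp⟩
  smul_mem' := by
    intro c x hx i
    obtain ⟨G, hG, h1⟩ := hx i
    refine ⟨C c * G, (totalDegree_mul _ _).trans (by simpa using hG), ?_⟩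
    have : c • x = (algebraMap (Bp k e) (Kp k e) (C c)) • x := by
      rw [algebraMap_smul, ← algebraMap_smul (Bp k e) c x]; rfl
    rw [this, map_smul, Finsupp.smul_apply, smul_eq_mul, map_mul, ← h1]; ring
lemma coLat_mul {ι : Type*} (w : Module.Basis ι (Kp k e) E) (f : Bp k e) {M s : ℕ} {x : E}
    (hx : x ∈ coLat w f M) {y : E} (hy : y ∈ Ysp k (yE k e E) ^ s) : y * x ∈ coLat w f (s + M) := by
  obtain ⟨G, hG, rfl⟩ := Y_pow_le s hy
  rw [SetLike.mem_coe, mem_restrictTotalDegree] at hG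
  intro i
  obtain ⟨H, hH, h1⟩ := hx i
  refine ⟨G * H, (totalDegree_mul _ _).trans (add_le_add hG hH), ?_⟩
  have : (IsScalarTower.toAlgHom k (Bp k e) E).toLinearMap G * x =
      (algebraMap (Bp k e) (Kp k e) G) • x := by
    rw [algebraMap_smul, Algebra.smul_def]; rfl
  rw [this, map_smul, Finsupp.smul_apply, smul_eq_mul, map_mul, ← h1]; ring
def coVan {ι : Type*} (w : Module.Basis ι (Kp k e) E) (c : Fin e → k) (t : ℕ) (x : E) : Prop :=
  ∀ i, ∃ s G : Bp k e, eval c s ≠ 0 ∧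
    aeval (fun i => X i + C (c i) : Fin e → Bp k e) G ∈ idealOfVars (Fin e) k ^ t ∧
    algebraMap _ (Kp k e) s * w.repr x i = algebraMap _ (Kp k e) G
lemma coVan_sum {ι κ : Type*} (w : Module.Basis ι (Kp k e) E) (c : Fin e → k) (t : ℕ) (u : Finset κ)
    (x : κ → E) (h : ∀ j ∈ u, coVan w c t (x j)) : coVan w c t (∑ j ∈ u, x j) := by
  classical
  induction u using Finset.induction_on with
  | empty => intro i; exact ⟨1, 0, by simp, by simp, by simp⟩
  | insert a u ha ih =>
    rw [Finset.sum_insert ha]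
    intro i
    obtain ⟨s, G, h1, h2, h3⟩ := h a (by simp) i
    obtain ⟨s', G', h1', h2', h3'⟩ := ih (fun j hj => h j (by simp [hj])) i
    refine ⟨s * s', s' * G + s * G', by simp [h1, h1'], ?_, ?_⟩
    · simp only [map_add, map_mul]
      exact add_mem (Ideal.mul_mem_left _ _ h2) (Ideal.mul_mem_left _ _ h2')
    · simp only [map_add, map_mul, Finsupp.add_apply, ← h3, ← h3']; ring
lemma coVan_mul {ι : Type*} [Fintype ι] (w : Module.Basis ι (Kp k e) E) (c : Fin e → k)
    (f : Bp k e) (hf : eval c f ≠ 0)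
    (hw : ∀ i j l, ∃ G : Bp k e, algebraMap _ (Kp k e) f * w.repr (w i * w j) l = algebraMap _ _ G)
    {t t' : ℕ} {x y : E} (hx : coVan w c t x) (hy : coVan w c t' y) : coVan w c (t + t') (x * y) := by
  have : x * y = ∑ i, ∑ j, (w.repr x i * w.repr y j) • (w i * w j) := by
    conv_lhs => rw [← w.sum_repr x, ← w.sum_repr y]
    rw [Finset.sum_mul_sum]
    refine Finset.sum_congr rfl fun i _ => Finset.sum_congr rfl fun j _ => ?_
    rw [smul_mul_smul_comm]
  rw [this]
  refine coVan_sum w c _ _ _ fun i _ => coVan_sum w c _ _ _ fun j _ => fun l => ?_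
  obtain ⟨s, G, h1, h2, h3⟩ := hx i
  obtain ⟨s', G', h1', h2', h3'⟩ := hy j
  obtain ⟨H, hH⟩ := hw i j l
  refine ⟨s * s' * f, G * G' * H, by simp [h1, h1', hf], ?_, ?_⟩
  · simp only [map_mul, pow_add]
    exact Ideal.mul_mem_right _ _ (Ideal.mul_mem_mul h2 h2')
  · simp only [map_mul, ← h3, ← h3', ← hH, map_smul, Finsupp.smul_apply, smul_eq_mul]; ring
lemma coVan_zero_of {ι : Type*} (w : Module.Basis ι (Kp k e) E) (c : Fin e → k)
    (f : Bp k e) (hf : f ≠ 0) {t M : ℕ} {x : E} (hx : coVan w c t x) (hM : x ∈ coLat w f M)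
    (ht : M < t) : x = 0 := by
  apply w.repr.map_eq_zero_iff.1
  ext i
  obtain ⟨s, G, h1, h2, h3⟩ := hx i
  obtain ⟨H, hH, h4⟩ := hM i
  have hinj := IsFractionRing.injective (Bp k e) (Kp k e)
  have h5 : s * H = f * G := by
    apply hinj; simp only [map_mul, ← h3, ← h4]; ring
  let τ := aeval (R := k) (fun i => X i + C (c i) : Fin e → Bp k e)
  have hcc : ∀ q : Bp k e, constantCoeff (τ q) = eval c q := by
    intro q
    have : (MvPolynomial.constantCoeff : Bp k e →+* k).comp τ.toRingHom = eval c := by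
      apply MvPolynomial.ringHom_ext <;> intros <;> simp [τ]
    exact RingHom.congr_fun this q
  have h6 : τ H ∈ idealOfVars (Fin e) k ^ t := by
    apply cancel_pow (s := τ s) (by rwa [hcc])
    rw [← map_mul, h5, map_mul]
    exact Ideal.mul_mem_left _ _ h2
  have hdeg : ∀ q : Bp k e, (τ q).totalDegree ≤ q.totalDegree := fun q =>
    totalDegree_aeval_le _ (fun i => (totalDegree_add _ _).trans (by simp)) q
  have h7 : τ H = 0 := eq_zero_of_mem_pow h6 (((hdeg H).trans hH).trans_lt ht)
  have hτ : H = 0 := by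
    let τ' := aeval (R := k) (fun i => X i - C (c i) : Fin e → Bp k e)
    have : τ'.comp τ = AlgHom.id k _ := by
      apply MvPolynomial.algHom_ext; intro i
      simp [τ, τ', MvPolynomial.algebraMap_eq]
    have := AlgHom.congr_fun this H
    simpa [h7] using this.symm
  rw [hτ, map_zero] at h4
  simpa [(map_ne_zero_iff _ hinj).2 hf] using h4
theorem rk_upper [Infinite k] [IsReduced E] [Module.Finite (Kp k e) E]
    (V : Submodule k E) (hfg : V.FG) (h1 : (1 : E) ∈ V) {N : ℕ}
    (hN : V ^ (N + 1) ≤ Ysp k (yE k e E) * V ^ N) (m : ℕ) (U : Submodule k E) (hU : U ≤ V ^ m) :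
    Module.finrank k U ≤ rk k e U * (m + e).choose e := by
  classical
  by_contra hcon
  push Not at hcon
  have hfinV : Module.Finite k ↥(V ^ m) := Module.Finite.iff_fg.2 (hfg.pow m)
  have hUf : Module.Finite k U := Submodule.finiteDimensional_of_le hU
  set T := Submodule.span (Kp k e) (U : Set E) with hT
  obtain ⟨T', hT'⟩ := T.exists_isCompl
  let w := ((Module.finBasis (Kp k e) T).prod (Module.finBasis (Kp k e) T')).map
    (T.prodEquivOfIsCompl T' hT')
  have hwU : ∀ u ∈ U, ∀ j, w.repr u (Sum.inr j) = 0 := by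
    intro u hu j
    have : (T.prodEquivOfIsCompl T' hT').symm u = (⟨u, Submodule.subset_span hu⟩, 0) := by
      rw [LinearEquiv.symm_apply_eq]; simp
    simp [w, this]
  obtain ⟨t, ht⟩ := hfg.pow N
  obtain ⟨f, hf, hf2⟩ := exists_common_denom (k := k) (e := e)
    (ι := t ⊕ (_ × _)) (κ := _)
    (fun i l => Sum.elim (fun x : t => w.repr x.1 l) (fun p => w.repr (w p.1 * w p.2) l) i)
  choose Gt hGt using fun (x : t) l => hf2 (Sum.inl x) l
  let c := Finset.univ.sup fun x : t => Finset.univ.sup fun l => (Gt x l).totalDegree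
  have hVN : V ^ N ≤ coLat w f c := by
    rw [← ht, Submodule.span_le]
    intro x hx l
    refine ⟨Gt ⟨x, hx⟩ l, ?_, hGt ⟨x, hx⟩ l⟩
    exact (Finset.le_sup (f := fun l => (Gt ⟨x, hx⟩ l).totalDegree) (Finset.mem_univ l)).trans
      (Finset.le_sup (f := fun x : t => Finset.univ.sup fun l => (Gt x l).totalDegree)
        (Finset.mem_univ (⟨x, hx⟩ : t)))
  have hVM : ∀ M, V ^ M ≤ coLat w f (M + c) := by
    intro M
    refine (pow_mono_of_one h1 (Nat.le_add_left M N)).trans ?_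
    refine (red_pow hN M).trans ?_
    rw [Submodule.mul_le]
    intro y hy x hx
    exact coLat_mul w f (hVN hx) hy
  obtain ⟨c0, hc0⟩ : ∃ c0, eval c0 f ≠ 0 := by
    by_contra h; push Not at h
    exact hf (MvPolynomial.funext_iff.2 (by simpa using h))
  choose! H hH1 hH2 using fun (u : E) (hu : u ∈ U) (i : Fin (Module.finrank (Kp k e) T)) =>
    hVM m (hU hu) (Sum.inl i)
  have hinj := IsFractionRing.injective (Bp k e) (Kp k e)
  let τ := aeval (R := k) (fun i => X i + C (c0 i) : Fin e → Bp k e)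
  let φ : U →ₗ[k] (Fin (Module.finrank (Kp k e) T) × monF e m → k) :=
    { toFun := fun u p => coeff p.2.1 (τ (H u.1 p.1))
      map_add' := by
        intro x y; funext p
        have : H (x.1 + y.1) p.1 = H x.1 p.1 + H y.1 p.1 := by
          apply hinj
          rw [map_add, ← hH2 _ x.2, ← hH2 _ y.2, ← hH2 _ (add_mem x.2 y.2), map_add,
            Finsupp.add_apply, mul_add]
        simp [this]
      map_smul' := by
        intro a x; funext p
        have : H (a • x.1) p.1 = C a * H x.1 p.1 := by
          apply hinj
          have h3 : a • x.1 = (algebraMap (Bp k e) (Kp k e) (C a)) • x.1 := by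
            rw [algebraMap_smul, ← algebraMap_smul (Bp k e) a x.1]; rfl
          rw [map_mul, ← hH2 _ x.2, ← hH2 _ (U.smul_mem a x.2), h3, map_smul,
            Finsupp.smul_apply, smul_eq_mul]; ring
        simp [this, τ, MvPolynomial.algebraMap_eq] }
  have hlt : Module.finrank k (Fin (Module.finrank (Kp k e) T) × monF e m → k) <
      Module.finrank k U := by
    rw [Module.finrank_fintype_fun_eq_card, Fintype.card_prod, Fintype.card_fin, Fintype.card_coe,
      card_monF]
    exact hcon
  obtain ⟨u, hu, hu0⟩ := (Submodule.ne_bot_iff _).1 (LinearMap.ker_ne_bot_of_finrank_lt (f := φ) hlt)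
  apply hu0
  have hvan : coVan w c0 (m + 1) u.1 := by
    rintro (i | j)
    · refine ⟨f, H u.1 i, hc0, ?_, hH2 _ u.2 i⟩
      rw [mem_pow_idealOfVars_iff']
      intro x hx
      exact congrFun (LinearMap.mem_ker.1 hu) (i, ⟨x, mem_monF.2 (by omega)⟩)
    · exact ⟨1, 0, by simp, by simp, by simp [hwU u.1 u.2 j]⟩
  have hvans : ∀ s, coVan w c0 ((s + 1) * (m + 1)) (u.1 ^ (s + 1)) := by
    intro s
    induction s with
    | zero => simpa using hvan
    | succ s ih =>
      rw [pow_succ, Nat.succ_mul]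
      exact coVan_mul w c0 f hc0 (fun i j l => hf2 (Sum.inr (i, j)) l) ih hvan
  have hz := coVan_zero_of w c0 f hf (hvans c)
    (hVM ((c + 1) * m) (by rw [mul_comm, pow_mul]; exact Submodule.pow_mem_pow _ (hU u.2) _))
    (by ring_nf; omega)
  exact Subtype.ext (pow_eq_zero_iff (by omega) |>.1 hz)
end UB2

lemma choose_le_pow1 (m e : ℕ) : (m + e).choose e ≤ (m + 1) ^ e := by
  induction e with
  | zero => simp
  | succ e ih =>
    have h := Nat.add_one_mul_choose_eq (m + e) e
    have h2 : (m + (e + 1)).choose (e + 1) * (e + 1) ≤ (m + 1) ^ (e + 1) * (e + 1) := by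
      calc (m + (e + 1)).choose (e + 1) * (e + 1) = (m + e + 1) * (m + e).choose e := h.symm
        _ ≤ ((m + 1) * (e + 1)) * (m + 1) ^ e := Nat.mul_le_mul (by nlinarith) ih
        _ = _ := by ring
    exact Nat.le_of_mul_le_mul_right h2 (by omega)
lemma pow1_le_choose (m e : ℕ) : (m + 1) ^ e ≤ e.factorial * (m + e).choose e := by
  rw [← Nat.descFactorial_eq_factorial_mul_choose]
  have := Nat.pow_sub_le_descFactorial (m + e) e
  rwa [show m + e + 1 - e = m + 1 by omega] at this
lemma growth (a b c d e e' : ℕ) (ha : 1 ≤ a)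
    (h : ∀ s : ℕ, a * (s + e).choose e ≤ b * (c * s + d + e').choose e') :
    e < e' ∨ (e = e' ∧ a ≤ b * c ^ e) := by
  have key : ∀ s : ℕ, (a : ℝ) * ((s : ℝ)) ^ e * (e'.factorial) ≤
      b * ((c * s + d + e' : ℝ)) ^ e' * e.factorial := by
    intro s
    have h1 : (s : ℝ) ^ e ≤ e.factorial * (s + e).choose e := by
      have := pow1_le_choose s e
      calc (s : ℝ) ^ e ≤ ((s + 1 : ℕ) : ℝ) ^ e := by gcongr; push_cast; linarith
        _ ≤ _ := by exact_mod_cast this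
    have h2 : ((c * s + d + e').choose e' : ℝ) * e'.factorial ≤ (c * s + d + e' : ℝ) ^ e' := by
      have := Nat.choose_le_pow_div (α := ℝ) e' (c * s + d + e')
      rw [le_div_iff₀ (by positivity)] at this
      exact_mod_cast this
    have h3 : (a : ℝ) * (s + e).choose e ≤ b * (c * s + d + e').choose e' := by exact_mod_cast h s
    calc (a : ℝ) * (s : ℝ) ^ e * e'.factorial ≤ a * (e.factorial * (s + e).choose e) * e'.factorial := by
          gcongr
      _ = (a * (s + e).choose e) * (e.factorial * e'.factorial) := by ring
      _ ≤ (b * (c * s + d + e').choose e') * (e.factorial * e'.factorial) := by gcongr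
      _ = b * ((c * s + d + e').choose e' * e'.factorial) * e.factorial := by ring
      _ ≤ _ := by gcongr
  by_contra hcon
  push Not at hcon
  obtain ⟨hle, hne⟩ := hcon
  obtain ⟨g, rfl⟩ := Nat.exists_eq_add_of_le hle
  have hlim : Filter.Tendsto (fun s : ℕ => b * (((c * s + d + e' : ℝ)) / s) ^ e' * (e' + g).factorial)
      Filter.atTop (nhds (b * (c : ℝ) ^ e' * (e' + g).factorial)) := by
    refine Filter.Tendsto.mul_const _ (Filter.Tendsto.const_mul _ (Filter.Tendsto.pow ?_ _))
    have : Filter.Tendsto (fun s : ℕ => (c : ℝ) + (d + e') / (s : ℝ)) Filter.atTop (nhds (c + 0)) :=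
      tendsto_const_nhds.add (tendsto_const_div_atTop_nhds_zero_nat _)
    rw [add_zero] at this
    refine this.congr' ?_
    filter_upwards [Filter.eventually_gt_atTop 0] with s hs
    have : (s : ℝ) ≠ 0 := by positivity
    field_simp
    ring
  have hb : ∀ᶠ s : ℕ in Filter.atTop, (a : ℝ) * (s : ℝ) ^ g * e'.factorial ≤
      b * (((c * s + d + e' : ℝ)) / s) ^ e' * (e' + g).factorial := by
    filter_upwards [Filter.eventually_gt_atTop 0] with s hs
    have hs' : (0 : ℝ) < (s : ℝ) ^ e' := by positivity
    have := key s
    rw [div_pow, mul_div_assoc', div_mul_eq_mul_div, le_div_iff₀ hs']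
    calc _ = (a : ℝ) * (s : ℝ) ^ (e' + g) * e'.factorial := by ring
      _ ≤ _ := this
  rcases Nat.eq_zero_or_pos g with rfl | hg
  · simp only [pow_zero, mul_one, add_zero] at hb hlim hne
    have h4 := ge_of_tendsto hlim hb
    have h5 : (a : ℝ) ≤ b * (c : ℝ) ^ e' := le_of_mul_le_mul_right h4 (by positivity)
    have : a ≤ b * c ^ e' := by exact_mod_cast h5
    exact absurd (hne trivial) (by omega)
  · have h6 : Filter.Tendsto (fun s : ℕ => (a : ℝ) * (s : ℝ) ^ g * e'.factorial) Filter.atTop Filter.atTop := by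
      refine Filter.Tendsto.atTop_mul_const (by positivity) (Filter.Tendsto.const_mul_atTop (by positivity) ?_)
      exact (Filter.tendsto_pow_atTop (by omega)).comp tendsto_natCast_atTop_atTop
    exact not_tendsto_nhds_of_tendsto_atTop (Filter.tendsto_atTop_mono' _ hb h6) _ hlim
def Vm {n : ℕ} {k : Type*} [Field k] (p : Ideal (MvPolynomial (Fin n) k)) (m : ℕ) :
    Submodule k (MvPolynomial (Fin n) k ⧸ p) :=
  (restrictTotalDegree (Fin n) k m).map (Ideal.Quotient.mkₐ k p).toLinearMap
def hf {n : ℕ} {k : Type*} [Field k] (p : Ideal (MvPolynomial (Fin n) k)) (m : ℕ) : ℕ :=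
  Module.finrank k (Vm p m)
structure IsHF {n : ℕ} {k : Type*} [Field k] (p : Ideal (MvPolynomial (Fin n) k)) (e N : ℕ) : Prop where
  pos : 1 ≤ N
  upper : ∀ m, hf p m ≤ N * (m + e).choose e
  lower : ∃ m0, ∀ s, N * (s + e).choose e ≤ hf p (m0 + s)
  reg : ∀ m s, hf p m * (s + e).choose e ≤ (m + e).choose e * hf p (m + s)
section Abs
variable {k : Type*} [Field k] {e : ℕ} {A : Type*} [CommRing A] [IsDomain A] [Algebra k A]
  [Algebra (Bp k e) A] [IsScalarTower k (Bp k e) A] [FaithfulSMul (Bp k e) A]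
lemma finite_of_red {V : Submodule k A} (h1 : (1 : A) ∈ V) (hgen : ∀ a : A, ∃ m, a ∈ V ^ m)
    {N : ℕ} (hN : V ^ (N + 1) ≤ Ysp k (yE k e A) * V ^ N) :
    Submodule.span (Bp k e) ((V ^ N : Submodule k A) : Set A) = ⊤ := by
  rw [eq_top_iff]
  intro a _
  obtain ⟨m, hm⟩ := hgen a
  have h2 := red_pow hN m (pow_mono_of_one h1 (Nat.le_add_left m N) hm)
  refine Submodule.mul_induction_on h2 (fun y hy x hx => ?_) (fun x y hx hy => add_mem hx hy)
  obtain ⟨G, hG, hGy⟩ : y ∈ (restrictTotalDegree (Fin e) k m).map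
      (IsScalarTower.toAlgHom k (Bp k e) A).toLinearMap := Y_pow_le m hy
  rw [← hGy]
  change algebraMap (Bp k e) A G * x ∈ _
  rw [← Algebra.smul_def]
  exact Submodule.smul_mem _ _ (Submodule.subset_span hx)
lemma finite_of_red' {V : Submodule k A} (hfg : V.FG) (h1 : (1 : A) ∈ V)
    (hgen : ∀ a : A, ∃ m, a ∈ V ^ m)
    {N : ℕ} (hN : V ^ (N + 1) ≤ Ysp k (yE k e A) * V ^ N) : Module.Finite (Bp k e) A := by
  obtain ⟨t, ht⟩ := hfg.pow N
  refine ⟨⟨t, ?_⟩⟩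
  rw [← finite_of_red h1 hgen hN, ← ht]
  refine le_antisymm (Submodule.span_mono Submodule.subset_span) ?_
  rw [Submodule.span_le]
  exact Submodule.span_le_restrictScalars k (Bp k e) (t : Set A)
attribute [local instance] FractionRing.liftAlgebra
theorem abs_HF [Infinite k] {V : Submodule k A} (hfg : V.FG) (h1 : (1 : A) ∈ V)
    (hgen : ∀ a : A, ∃ m, a ∈ V ^ m) (hyV : ∀ i, yE k e A i ∈ V)
    {N : ℕ} (hN : V ^ (N + 1) ≤ Ysp k (yE k e A) * V ^ N) :
    let R := Module.finrank (Kp k e) (FractionRing A)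
    1 ≤ R ∧ (∀ m, Module.finrank k ↥(V ^ m) ≤ R * (m + e).choose e) ∧
    (∀ s, R * (s + e).choose e ≤ Module.finrank k ↥(V ^ (N + s))) ∧
    (∀ m s, Module.finrank k ↥(V ^ m) * (s + e).choose e ≤
      (m + e).choose e * Module.finrank k ↥(V ^ (m + s))) := by
  intro R
  have hBA := finite_of_red' hfg h1 hgen hN
  have := FractionRing.isScalarTower_liftAlgebra (Bp k e) (FractionRing A)
  let φ : A →ₐ[k] FractionRing A := IsScalarTower.toAlgHom k A (FractionRing A)
  have hφ : Function.Injective φ := IsFractionRing.injective A (FractionRing A)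
  set W := V.map φ.toLinearMap with hW
  have hWp : ∀ m, W ^ m = (V ^ m).map φ.toLinearMap := fun m => (Submodule.map_pow V φ m).symm
  have hWr : ∀ m, Module.finrank k ↥(W ^ m) = Module.finrank k ↥(V ^ m) := fun m => by
    rw [hWp]; exact (Submodule.equivMapOfInjective φ.toLinearMap hφ (V ^ m)).finrank_eq.symm
  have hWfg : W.FG := hfg.map _
  have h1W : (1 : FractionRing A) ∈ W := ⟨1, h1, map_one φ⟩
  have hyy : Ysp k (yE k e (FractionRing A)) = (Ysp k (yE k e A)).map φ.toLinearMap := by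
    rw [Ysp, Ysp, Submodule.map_span]
    congr 1
    rw [Set.image_insert_eq, ← Set.range_comp]
    congr 1
    exact (map_one φ).symm
  have hNW : W ^ (N + 1) ≤ Ysp k (yE k e (FractionRing A)) * W ^ N := by
    rw [hyy, hWp, hWp, ← Submodule.map_mul]
    exact Submodule.map_mono hN
  have hYW : Ysp k (yE k e (FractionRing A)) ≤ W := by
    rw [hyy]; apply Submodule.map_mono
    rw [Ysp, Submodule.span_le]
    rintro x (rfl | ⟨i, rfl⟩)
    exacts [h1, hyV i]
  have htop : Submodule.span (Kp k e) ((W ^ N : Submodule k (FractionRing A)) :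
      Set (FractionRing A)) = ⊤ := by
    have h5 := IsFractionRing.ideal_span_singleton_map_subset (R := Bp k e) (S := A) (K := Kp k e)
      (L := FractionRing A) (a := 1) (b := ((V ^ N : Submodule k A) : Set A))
      (by
        rw [IsScalarTower.algebraMap_eq (Bp k e) A (FractionRing A)]
        exact (IsFractionRing.injective A (FractionRing A)).comp
          (FaithfulSMul.algebraMap_injective (Bp k e) A))
      (by rw [finite_of_red h1 hgen hN]; exact Set.subset_univ _)
    rw [map_one, Ideal.span_singleton_one] at h5
    rw [eq_top_iff]
    intro z _
    rw [hWp]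
    exact h5 trivial
  have : Module.Finite (Kp k e) (FractionRing A) :=
    ⟨by rw [← htop]; exact span_fg _ (hWfg.pow N)⟩
  have hrkle : ∀ m, rk k e (W ^ m) ≤ R := fun m => Submodule.finrank_le _
  have hrkN : rk k e (W ^ N) = R := by rw [rk, htop, finrank_top]
  refine ⟨Module.finrank_pos, fun m => ?_, fun s => ?_, fun m s => ?_⟩
  · rw [← hWr]
    exact (rk_upper W hWfg h1W hNW m _ le_rfl).trans (Nat.mul_le_mul_right _ (hrkle m))
  · rw [← hWr, ← hrkN]
    exact rk_lower W hWfg hYW N s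
  · rw [← hWr, ← hWr]
    calc _ ≤ (rk k e (W ^ m) * (m + e).choose e) * (s + e).choose e :=
          Nat.mul_le_mul_right _ (rk_upper W hWfg h1W hNW m _ le_rfl)
      _ = (m + e).choose e * (rk k e (W ^ m) * (s + e).choose e) := by ring
      _ ≤ _ := Nat.mul_le_mul_left _ (rk_lower W hWfg hYW m s)
end Abs

section HFb
variable {n : ℕ} {k : Type*} [Field k]
instance rtd_fin (m : ℕ) : Module.Finite k (restrictTotalDegree (Fin n) k m) := by
  have h : 0 < Module.finrank k (restrictTotalDegree (Fin n) k m) := by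
    rw [finrank_rtd]; exact Nat.choose_pos (by omega)
  exact Module.finite_of_finrank_pos h
instance Vm_fin (p : Ideal (MvPolynomial (Fin n) k)) (m : ℕ) : Module.Finite k (Vm p m) :=
  Module.Finite.iff_fg.2 ((Module.Finite.iff_fg.1 (rtd_fin m)).map _)
lemma Vm_pow (p : Ideal (MvPolynomial (Fin n) k)) (m : ℕ) : Vm p m = Vm p 1 ^ m := by
  rw [Vm, rtd_pow, Submodule.map_pow]; rfl
lemma hf_eq (p : Ideal (MvPolynomial (Fin n) k)) (m : ℕ) :
    hf p m = Module.finrank k ↥(Vm p 1 ^ m) := by rw [hf, Vm_pow p m]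
lemma mem_Vm {p : Ideal (MvPolynomial (Fin n) k)} {m : ℕ} {x} :
    x ∈ Vm p m ↔ ∃ f : MvPolynomial (Fin n) k, f.totalDegree ≤ m ∧ Ideal.Quotient.mk p f = x := by
  simp [Vm, mem_restrictTotalDegree]
lemma Vm_mono (p : Ideal (MvPolynomial (Fin n) k)) {m m' : ℕ} (h : m ≤ m') : Vm p m ≤ Vm p m' := by
  intro x hx
  rw [mem_Vm] at *
  obtain ⟨f, hf, rfl⟩ := hx
  exact ⟨f, hf.trans h, rfl⟩
lemma hf_mono (p : Ideal (MvPolynomial (Fin n) k)) {m m' : ℕ} (h : m ≤ m') : hf p m ≤ hf p m' :=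
  Submodule.finrank_mono (Vm_mono p h)
def Im (p : Ideal (MvPolynomial (Fin n) k)) (m : ℕ) : Submodule k (MvPolynomial (Fin n) k) :=
  (p.restrictScalars k) ⊓ restrictTotalDegree (Fin n) k m
lemma mem_Im {p : Ideal (MvPolynomial (Fin n) k)} {m : ℕ} {f} :
    f ∈ Im p m ↔ f ∈ p ∧ f.totalDegree ≤ m := by
  simp [Im, mem_restrictTotalDegree]
lemma hf_add (p : Ideal (MvPolynomial (Fin n) k)) (m : ℕ) :
    hf p m + Module.finrank k (Im p m) = (m + n).choose n := by
  have h := LinearMap.finrank_range_add_finrank_ker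
    ((Ideal.Quotient.mkₐ k p).toLinearMap.domRestrict (restrictTotalDegree (Fin n) k m))
  rw [finrank_rtd, LinearMap.range_domRestrict] at h
  rw [← h]
  congr 1
  have : Im p m = (LinearMap.ker ((Ideal.Quotient.mkₐ k p).toLinearMap.domRestrict
      (restrictTotalDegree (Fin n) k m))).map (Submodule.subtype _) := by
    ext f
    simp [mem_Im, mem_restrictTotalDegree, Ideal.Quotient.eq_zero_iff_mem, and_comm]
  rw [this]
  exact (Submodule.equivMapOfInjective _ (Submodule.subtype_injective _) _).finrank_eq.symm
lemma hf_le_choose (p : Ideal (MvPolynomial (Fin n) k)) (m : ℕ) : hf p m ≤ (m + n).choose n := by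
  have := hf_add p m; omega
instance Im_fin (p : Ideal (MvPolynomial (Fin n) k)) (m : ℕ) : Module.Finite k (Im p m) :=
  Submodule.finiteDimensional_of_le (S₂ := restrictTotalDegree (Fin n) k m) inf_le_right
lemma hf_anti {p q : Ideal (MvPolynomial (Fin n) k)} {m : ℕ}
    (h : ∀ f ∈ p, f.totalDegree ≤ m → f ∈ q) : hf q m ≤ hf p m := by
  have h1 := hf_add p m
  have h2 := hf_add q m
  have : Module.finrank k (Im p m) ≤ Module.finrank k (Im q m) := by
    apply Submodule.finrank_mono
    intro f hf
    rw [mem_Im] at *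
    exact ⟨h f hf.1 hf.2, hf.2⟩
  omega
lemma hf_congr {p q : Ideal (MvPolynomial (Fin n) k)} {m : ℕ}
    (h : ∀ f : MvPolynomial (Fin n) k, f.totalDegree ≤ m → (f ∈ p ↔ f ∈ q)) : hf q m = hf p m :=
  le_antisymm (hf_anti fun f hf hm => (h f hm).1 hf) (hf_anti fun f hf hm => (h f hm).2 hf)
lemma IsHF.le_of_le {p q : Ideal (MvPolynomial (Fin n) k)} {e N e' N' : ℕ} (hp : IsHF p e N)
    (hq : IsHF q e' N') (hpq : p ≤ q) : e' < e ∨ (e' = e ∧ N' ≤ N) := by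
  obtain ⟨m0, hm⟩ := hq.lower
  have := growth N' N 1 m0 e' e hq.pos (fun s => (hm s).trans ((hf_anti (fun f hf _ => hpq hf)).trans
    ((hp.upper _).trans (by rw [one_mul, add_comm m0 s]))))
  simpa using this
lemma IsHF.unique {p : Ideal (MvPolynomial (Fin n) k)} {e N e' N' : ℕ} (hp : IsHF p e N)
    (hq : IsHF p e' N') : e' = e ∧ N' = N := by
  have := hp.le_of_le hq le_rfl
  have := hq.le_of_le hp le_rfl
  omega
lemma IsHF.le_n {p : Ideal (MvPolynomial (Fin n) k)} {e N : ℕ} (hp : IsHF p e N) : e ≤ n := by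
  obtain ⟨m0, hm⟩ := hp.lower
  have := growth N 1 1 m0 e n hp.pos (fun s => (hm s).trans ((hf_le_choose _ _).trans
    (by rw [one_mul, one_mul, add_comm m0 s])))
  omega
end HFb
section Setup
variable {n : ℕ} {k : Type*} [Field k]
structure Noe (p : Ideal (MvPolynomial (Fin n) k)) (e : ℕ) [Algebra (Bp k e) (MvPolynomial (Fin n) k ⧸ p)]
    (N : ℕ) : Prop where
  tower : IsScalarTower k (Bp k e) (MvPolynomial (Fin n) k ⧸ p)
  faith : FaithfulSMul (Bp k e) (MvPolynomial (Fin n) k ⧸ p)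
  memV : ∀ i, yE k e (MvPolynomial (Fin n) k ⧸ p) i ∈ Vm p 1
  red : Vm p 1 ^ (N + 1) ≤ Ysp k (yE k e (MvPolynomial (Fin n) k ⧸ p)) * Vm p 1 ^ N
lemma one_mem_Vm (p : Ideal (MvPolynomial (Fin n) k)) (m : ℕ) : (1 : MvPolynomial (Fin n) k ⧸ p) ∈ Vm p m :=
  mem_Vm.2 ⟨1, by simp, map_one _⟩
theorem exists_Noe [Infinite k] (p : Ideal (MvPolynomial (Fin n) k)) [hp : p.IsPrime] :
    ∃ (e : ℕ) (_ : Algebra (Bp k e) (MvPolynomial (Fin n) k ⧸ p)) (N : ℕ), Noe p e N := by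
  obtain ⟨e, y, hy, hind, N, hN⟩ := exists_noether (Vm p 1) (one_mem_Vm p 1)
    (Module.Finite.iff_fg.1 inferInstance)
  let alg : Algebra (Bp k e) (MvPolynomial (Fin n) k ⧸ p) := (aeval (R := k) y).toAlgebra
  have hyy : yE k e (MvPolynomial (Fin n) k ⧸ p) = y := by
    funext i; exact aeval_X y i
  refine ⟨e, alg, N, ?_, ?_, ?_, ?_⟩
  · exact IsScalarTower.of_algebraMap_eq fun x => ((aeval (R := k) y).commutes x).symm
  · exact (faithfulSMul_iff_algebraMap_injective _ _).2 hind
  · rw [hyy]; exact hy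
  · rw [hyy]; exact hN
lemma Vm_gen (p : Ideal (MvPolynomial (Fin n) k)) (a : MvPolynomial (Fin n) k ⧸ p) :
    ∃ m, a ∈ Vm p 1 ^ m := by
  obtain ⟨f, rfl⟩ := Ideal.Quotient.mk_surjective a
  exact ⟨f.totalDegree, by rw [← Vm_pow]; exact mem_Vm.2 ⟨f, le_rfl, rfl⟩⟩
theorem Noe.isHF [Infinite k] {p : Ideal (MvPolynomial (Fin n) k)} [hp : p.IsPrime] {e N : ℕ}
    [Algebra (Bp k e) (MvPolynomial (Fin n) k ⧸ p)] (h : Noe p e N) :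
    letI := h.faith
    letI := h.tower
    letI := FractionRing.liftAlgebra (Bp k e) (FractionRing (MvPolynomial (Fin n) k ⧸ p))
    IsHF p e (Module.finrank (Kp k e) (FractionRing (MvPolynomial (Fin n) k ⧸ p))) := by
  have := h.faith
  have := h.tower
  have hd : IsDomain (MvPolynomial (Fin n) k ⧸ p) := inferInstance
  obtain ⟨ha, hb, hc, hd⟩ := abs_HF (Module.Finite.iff_fg.1 (Vm_fin p 1)) (one_mem_Vm p 1)
    (Vm_gen p) h.memV h.red
  simp only [← hf_eq] at hb hc hd
  exact ⟨ha, hb, ⟨N, hc⟩, hd⟩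
theorem exists_HF [Infinite k] (p : Ideal (MvPolynomial (Fin n) k)) [hp : p.IsPrime] :
    ∃ e N, IsHF p e N := by
  obtain ⟨e, alg, N, h⟩ := exists_Noe p
  exact ⟨e, _, h.isHF⟩
end Setup

section Cut
variable {n : ℕ} {k : Type*} [Field k]
lemma finrank_map_add_le {E F : Type*} [AddCommGroup E] [Module k E] [AddCommGroup F] [Module k F]
    (U U' : Submodule k E) [Module.Finite k U] (φ : E →ₗ[k] F) (h : U' ≤ U ⊓ LinearMap.ker φ) :
    Module.finrank k (U.map φ) + Module.finrank k U' ≤ Module.finrank k U := by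
  have h3 := LinearMap.finrank_range_add_finrank_ker (φ.domRestrict U)
  rw [LinearMap.range_domRestrict] at h3
  rw [← h3]
  gcongr
  have : U' ≤ (LinearMap.ker (φ.domRestrict U)).map U.subtype := by
    intro x hx
    exact ⟨⟨x, (h hx).1⟩, (h hx).2, rfl⟩
  have h5 := (Submodule.equivMapOfInjective _ U.subtype_injective (LinearMap.ker (φ.domRestrict U))).finrank_eq
  rw [h5]
  exact Submodule.finrank_mono this
lemma hf_cut {p I : Ideal (MvPolynomial (Fin n) k)} [p.IsPrime] {g : MvPolynomial (Fin n) k}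
    (hg : g ∉ p) {δ : ℕ} (hδ : g.totalDegree ≤ δ) (hpI : p ≤ I) (hgI : g ∈ I) (m : ℕ) :
    hf I (m + δ) + hf p m ≤ hf p (m + δ) := by
  let φ : (MvPolynomial (Fin n) k ⧸ p) →ₗ[k] (MvPolynomial (Fin n) k ⧸ I) :=
    (Ideal.Quotient.factorₐ k hpI).toLinearMap
  let μ : (MvPolynomial (Fin n) k ⧸ p) →ₗ[k] (MvPolynomial (Fin n) k ⧸ p) :=
    LinearMap.mulLeft k (Ideal.Quotient.mk p g)
  have hμ : Function.Injective μ := by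
    intro a b hab
    exact mul_left_cancel₀ (by rwa [Ne, Ideal.Quotient.eq_zero_iff_mem]) hab
  have h1 : (Vm p (m + δ)).map φ = Vm I (m + δ) := by
    rw [Vm, ← Submodule.map_comp]; rfl
  have h2 : (Vm p m).map μ ≤ Vm p (m + δ) ⊓ LinearMap.ker φ := by
    rintro _ ⟨x, hx, rfl⟩
    obtain ⟨f, hf, rfl⟩ := mem_Vm.1 hx
    refine ⟨mem_Vm.2 ⟨g * f, (totalDegree_mul _ _).trans (by omega), by simp [μ]⟩, ?_⟩
    change φ (Ideal.Quotient.mk p g * Ideal.Quotient.mk p f) = 0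
    rw [← map_mul]
    exact Ideal.Quotient.eq_zero_iff_mem.2 (I.mul_mem_right _ hgI)
  have h3 := finrank_map_add_le (Vm p (m + δ)) _ φ h2
  rw [h1, ← (Submodule.equivMapOfInjective μ hμ (Vm p m)).finrank_eq] at h3
  exact h3
lemma exists_sep {ι : Type*} [Fintype ι] (q : ι → Ideal (MvPolynomial (Fin n) k))
    [hq : ∀ i, (q i).IsPrime] (hanti : ∀ i j, i ≠ j → ¬ q i ≤ q j) (j : ι) :
    ∃ a, a ∉ q j ∧ ∀ i, i ≠ j → a ∈ q i := by
  classical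
  have : ∀ i, i ≠ j → ∃ a, a ∈ q i ∧ a ∉ q j := fun i hi => Set.not_subset.1 (hanti i j hi)
  choose! a ha using this
  refine ⟨∏ i ∈ Finset.univ.erase j, a i, ?_, fun i hi => ?_⟩
  · rw [(hq j).prod_mem_iff]
    rintro ⟨i, hi, h⟩
    exact (ha i (Finset.ne_of_mem_erase hi)).2 h
  · exact Ideal.mem_of_dvd _ (Finset.dvd_prod_of_mem a (by simp [hi])) (ha i hi).1
lemma hf_sum_le {ι : Type*} [Fintype ι] (q : ι → Ideal (MvPolynomial (Fin n) k))
    [hq : ∀ i, (q i).IsPrime] (hanti : ∀ i j, i ≠ j → ¬ q i ≤ q j)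
    (I : Ideal (MvPolynomial (Fin n) k)) (hI : ∀ i, I ≤ q i) :
    ∃ c, ∀ m, ∑ i, hf (q i) m ≤ hf I (m + c) := by
  classical
  choose a ha ha' using exists_sep q hanti
  have hfree : ∀ i m, Module.Free k (Vm (q i) m) := fun i m => Module.Free.of_divisionRing k _
  have hproj : ∀ i m, Module.Projective k (Vm (q i) m) := fun i m => Module.Projective.of_free
  refine ⟨Finset.univ.sup fun i => (a i).totalDegree, fun m => ?_⟩
  have hsec : ∀ i, ∃ s : Vm (q i) m →ₗ[k] restrictTotalDegree (Fin n) k m,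
      ∀ x, Ideal.Quotient.mk (q i) (s x).1 = x.1 := by
    intro i
    let ψ : restrictTotalDegree (Fin n) k m →ₗ[k] Vm (q i) m :=
      (Ideal.Quotient.mkₐ k (q i)).toLinearMap.submoduleMap (restrictTotalDegree (Fin n) k m)
    obtain ⟨s, hs⟩ := ψ.exists_rightInverse_of_surjective
      (LinearMap.range_eq_top.2 (LinearMap.submoduleMap_surjective _ _))
    refine ⟨s, fun x => ?_⟩
    have := LinearMap.congr_fun hs x
    exact congrArg Subtype.val this
  choose s hs using hsec
  let Φ : (∀ i, Vm (q i) m) →ₗ[k] (MvPolynomial (Fin n) k ⧸ I) :=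
    ∑ i, (Ideal.Quotient.mkₐ k I).toLinearMap ∘ₗ (LinearMap.mulLeft k (a i)) ∘ₗ
      (Submodule.subtype _) ∘ₗ (s i) ∘ₗ (LinearMap.proj i)
  have hΦ : ∀ x, Φ x = Ideal.Quotient.mk I (∑ i, a i * (s i (x i)).1) := by
    intro x; simp [Φ]
  have hmem : ∀ x, Φ x ∈ Vm I (m + Finset.univ.sup fun i => (a i).totalDegree) := by
    intro x
    rw [hΦ]
    refine mem_Vm.2 ⟨_, totalDegree_finsetSum_le fun i _ => ?_, rfl⟩
    have h1 := (mem_restrictTotalDegree _ _ _).1 (s i (x i)).2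
    have h2 : (a i).totalDegree ≤ _ := Finset.le_sup (f := fun i => (a i).totalDegree) (Finset.mem_univ i)
    exact (totalDegree_mul _ _).trans (by omega)
  have hinj : Function.Injective (Φ.codRestrict _ hmem) := by
    rw [injective_iff_map_eq_zero]
    intro x hx
    have hx' : Φ x = 0 := congrArg Subtype.val hx
    rw [hΦ, Ideal.Quotient.eq_zero_iff_mem] at hx'
    funext i
    have h1 := hI i hx'
    rw [← Finset.add_sum_erase _ _ (Finset.mem_univ i)] at h1
    have h2 : ∑ j ∈ Finset.univ.erase i, a j * (s j (x j)).1 ∈ q i :=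
      Ideal.sum_mem _ fun j hj => Ideal.mul_mem_right _ _ (ha' j i (Finset.ne_of_mem_erase hj).symm)
    have h3 := ((hq i).mem_or_mem ((Ideal.add_mem_iff_left _ h2).1 h1)).resolve_left (ha i)
    have h4 := hs i (x i)
    rw [Ideal.Quotient.eq_zero_iff_mem.2 h3] at h4
    exact Subtype.ext h4.symm
  have := LinearMap.finrank_le_finrank_of_injective hinj
  rw [Module.finrank_pi_fintype] at this
  exact this
lemma sum_choose (e M : ℕ) : ∑ m ∈ Finset.range (M + 1), (m + e).choose e = (M + (e + 1)).choose (e + 1) := by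
  rw [Nat.sum_range_add_choose]; congr 1
lemma sum_window (h : ℕ → ℕ) (hm : Monotone h) (δ M : ℕ) :
    ∑ m ∈ Finset.range M, h (m + δ) ≤ ∑ m ∈ Finset.range M, h m + δ * h (M + δ) := by
  induction M with
  | zero => simp
  | succ M ih =>
    have h5 : ∀ δ, ∑ m ∈ Finset.range M, h (m + δ) + h (M + δ) ≤
      ∑ m ∈ Finset.range M, h m + h M + δ * h (M + 1 + δ) := by
      intro δ
      have e1 : ∑ m ∈ Finset.range M, h (m + δ) + h (M + δ) = ∑ m ∈ Finset.range (M+1), h (m + δ) := by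
        rw [Finset.sum_range_succ]
      have e2 : ∑ m ∈ Finset.range M, h m + h M = ∑ m ∈ Finset.range (M+1), h m := by
        rw [Finset.sum_range_succ]
      rw [e1, e2]
      have e3 := Finset.sum_range_add_sum_Ico (fun m => h m) (Nat.le_add_left δ (M+1))
      have e4 : ∑ m ∈ Finset.Ico δ (M + 1 + δ), h m = ∑ m ∈ Finset.range (M+1), h (m + δ) := by
        rw [Finset.sum_Ico_eq_sum_range]; simp [add_comm]
      have e5 := Finset.sum_range_add_sum_Ico (fun m => h m) (Nat.le_add_right (M+1) δ)
      have e6 : ∑ m ∈ Finset.Ico (M + 1) (M + 1 + δ), h m ≤ δ * h (M + 1 + δ) := by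
        refine (Finset.sum_le_card_nsmul _ _ (h (M + 1 + δ)) fun m hm' => hm ?_).trans (by simp)
        simp at hm'; omega
      omega
    rw [Finset.sum_range_succ, Finset.sum_range_succ]
    exact h5 δ
theorem cut_sum {p : Ideal (MvPolynomial (Fin n) k)} [p.IsPrime] {e N : ℕ} (hp : IsHF p e N)
    {g : MvPolynomial (Fin n) k} (hg : g ∉ p) {δ : ℕ} (hδ : g.totalDegree ≤ δ)
    {ι : Type*} [Fintype ι] (q : ι → Ideal (MvPolynomial (Fin n) k))
    [hq : ∀ i, (q i).IsPrime] (hanti : ∀ i j, i ≠ j → ¬ q i ≤ q j)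
    (hpq : ∀ i, p ≤ q i) (hgq : ∀ i, g ∈ q i) {e' N' : ι → ℕ} (hN : ∀ i, IsHF (q i) (e' i) (N' i)) :
    ∃ c, ∀ s, ∑ i, N' i * (s + (e' i + 1)).choose (e' i + 1) ≤ δ * N * (s + c + e).choose e := by
  have hI : ∀ i, p ⊔ Ideal.span {g} ≤ q i := fun i =>
    sup_le (hpq i) ((Ideal.span_singleton_le_iff_mem _).2 (hgq i))
  obtain ⟨c, hc⟩ := hf_sum_le q hanti _ hI
  choose m0 hm0 using fun i => (hN i).lower
  let M := Finset.univ.sup m0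
  have hl : ∀ s, ∑ i, N' i * (s + e' i).choose (e' i) ≤ ∑ i, hf (q i) (M + s) := fun s =>
    Finset.sum_le_sum fun i _ => (hm0 i s).trans (hf_mono _ (by
      have : m0 i ≤ M := Finset.le_sup (Finset.mem_univ i)
      omega))
  have hcut : ∀ m, hf (p ⊔ Ideal.span {g}) (m + δ) + hf p m ≤ hf p (m + δ) := fun m =>
    hf_cut hg hδ le_sup_left (Ideal.mem_sup_right (Ideal.mem_span_singleton_self g)) m
  refine ⟨1 + M + c + δ, fun s => ?_⟩
  have key : ∀ m, ∑ i, N' i * (m + e' i).choose (e' i) + hf p (m + (M + c)) ≤ hf p (m + δ + (M + c)) := by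
    intro m
    have h1 := hl m
    have h2 := hc (M + m)
    have h3 := hcut (m + (M + c))
    have h4 : hf (p ⊔ Ideal.span {g}) (M + m + c) ≤ hf (p ⊔ Ideal.span {g}) (m + (M + c) + δ) :=
      hf_mono _ (by omega)
    rw [show m + δ + (M + c) = m + (M + c) + δ by ring]
    omega
  have h6 := Finset.sum_le_sum (s := Finset.range (s + 1)) fun m _ => key m
  rw [Finset.sum_add_distrib, Finset.sum_comm] at h6
  simp only [← Finset.mul_sum, sum_choose] at h6
  have h7 := sum_window (fun m => hf p (m + (M + c))) (fun a b h => hf_mono _ (by omega)) δ (s + 1)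
  have h8 := hp.upper (s + 1 + δ + (M + c))
  have h9 : δ * hf p (s + 1 + δ + (M + c)) ≤ δ * N * (s + (1 + M + c + δ) + e).choose e := by
    rw [mul_assoc]
    refine Nat.mul_le_mul_left _ (h8.trans ?_)
    rw [show s + 1 + δ + (M + c) = s + (1 + M + c + δ) by ring]
  omega
theorem IsHF.lt_of_lt {p q : Ideal (MvPolynomial (Fin n) k)} [p.IsPrime] [q.IsPrime] {e N e' N' : ℕ}
    (hp : IsHF p e N) (hq : IsHF q e' N') (hpq : p < q) : e' < e := by
  obtain ⟨g, hgq, hgp⟩ := SetLike.exists_of_lt hpq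
  obtain ⟨c, hc⟩ := cut_sum hp hgp le_rfl (fun _ : Unit => q) (hq := fun _ => ‹_›)
    (fun i j h => absurd rfl h) (fun _ => hpq.le) (fun _ => hgq) (e' := fun _ => e')
    (N' := fun _ => N') (fun _ => hq)
  simp only [Finset.univ_unique, Finset.sum_const, Finset.card_singleton, one_smul] at hc
  have := growth N' (g.totalDegree * N) 1 c (e' + 1) e hq.pos (fun s => by rw [one_mul]; exact hc s)
  omega
end Cut

section Cut
variable {n : ℕ} {k : Type*} [Field k] [Infinite k]
lemma exists_contr {p q : Ideal (MvPolynomial (Fin n) k)} [p.IsPrime] {g : MvPolynomial (Fin n) k}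
    (hg : g ∉ p) (hq : q ∈ (p ⊔ Ideal.span {g}).minimalPrimes) {e N : ℕ}
    [Algebra (Bp k e) (MvPolynomial (Fin n) k ⧸ p)] (h : Noe p e N) :
    ∃ f : Bp k e, Prime f ∧ ∀ b : Bp k e,
      algebraMap (Bp k e) (MvPolynomial (Fin n) k ⧸ p) b ∈ q.map (Ideal.Quotient.mk p) → f ∣ b := by
  have := h.faith
  have := h.tower
  have hqp : q.IsPrime := hq.1.1
  have hpq : p ≤ q := le_sup_left.trans hq.1.2
  have hgq : g ∈ q := hq.1.2 (Ideal.mem_sup_right (Ideal.mem_span_singleton_self g))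
  letI : Module (Bp k e) (MvPolynomial (Fin n) k ⧸ p) := Algebra.toModule
  have hfin : Module.Finite (Bp k e) (MvPolynomial (Fin n) k ⧸ p) := finite_of_red' (Module.Finite.iff_fg.1 (Vm_fin p 1)) (one_mem_Vm p 1) (Vm_gen p) h.red
  have hint : Algebra.IsIntegral (Bp k e) (MvPolynomial (Fin n) k ⧸ p) := Algebra.IsIntegral.of_finite _ _
  have hht := Ideal.map_height_le_one_of_mem_minimalPrimes hq
  set Q := q.map (Ideal.Quotient.mk p) with hQ
  have hQp : Q.IsPrime := Ideal.map_isPrime_of_surjective Ideal.Quotient.mk_surjective (by simpa using hpq)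
  have hB : Q.under (Bp k e) ≠ ⊥ := by
    refine Ideal.comap_ne_bot_of_integral_mem (x := Ideal.Quotient.mk p g) ?_ (Ideal.mem_map_of_mem _ hgq)
      (Algebra.IsIntegral.isIntegral _)
    rwa [Ne, Ideal.Quotient.eq_zero_iff_mem]
  have hBp : (Q.under (Bp k e)).IsPrime := inferInstance
  obtain ⟨f, hf, hfp⟩ := hBp.exists_mem_prime_of_ne_bot hB
  refine ⟨f, hfp, fun b hb => ?_⟩
  have hb' : b ∈ Q.under (Bp k e) := hb
  have hsp : (Ideal.span {f}).IsPrime := (Ideal.span_singleton_prime hfp.ne_zero).2 hfp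
  by_contra hfb
  have hlt : Ideal.span {f} < Q.under (Bp k e) := by
    refine lt_of_le_of_ne ((Ideal.span_singleton_le_iff_mem _).2 hf) fun heq => hfb ?_
    rw [← heq] at hb'
    exact Ideal.mem_span_singleton.1 hb'
  obtain ⟨P, hPQ, hP, hPo⟩ := Ideal.exists_ideal_lt_liesOver_of_lt (p := Ideal.span {f}) (q := Q.under (Bp k e)) Q hlt
  have h1 : P.height < ((1 : ℕ) : ℕ∞) := (Ideal.height_le_iff (n := 1)).1 (by exact_mod_cast hht) P hP hPQ
  have h2 : P = ⊥ := by
    rw [← Ideal.height_eq_zero_iff_eq_bot]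
    exact ENat.lt_one_iff_eq_zero.1 (by exact_mod_cast h1)
  have h3 := hPo.over
  rw [h2] at h3
  have h4 : f ∈ (⊥ : Ideal (MvPolynomial (Fin n) k ⧸ p)).under (Bp k e) := by
    rw [← h3]; exact Ideal.mem_span_singleton_self f
  have h5 : algebraMap (Bp k e) (MvPolynomial (Fin n) k ⧸ p) f = 0 := h4
  exact hfp.ne_zero ((map_eq_zero_iff _ (FaithfulSMul.algebraMap_injective _ _)).1 h5)
theorem cut_dim {p q : Ideal (MvPolynomial (Fin n) k)} [p.IsPrime] {e N e' N' : ℕ} (hp : IsHF p e N)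
    {g : MvPolynomial (Fin n) k} (hg : g ∉ p) (hq : q ∈ (p ⊔ Ideal.span {g}).minimalPrimes)
    (hqN : IsHF q e' N') : e' + 1 = e := by
  have hqp : q.IsPrime := hq.1.1
  have hpq : p ≤ q := le_sup_left.trans hq.1.2
  have hgq : g ∈ q := hq.1.2 (Ideal.mem_sup_right (Ideal.mem_span_singleton_self g))
  have hlt := hp.lt_of_lt hqN (lt_of_le_of_ne hpq (fun h => hg (h ▸ hgq)))
  obtain ⟨e1, alg, M, h⟩ := exists_Noe p
  obtain rfl := (hp.unique h.isHF).1
  obtain ⟨f, hfp, hfd⟩ := exists_contr hg hq h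
  have := h.faith
  have := h.tower
  have hδ : 1 ≤ f.totalDegree := by
    by_contra hcon
    have h0 : f.totalDegree = 0 := by omega
    rw [totalDegree_eq_zero_iff_eq_C] at h0
    rw [h0] at hfp
    refine hfp.not_isUnit (IsUnit.map C (IsUnit.mk0 _ fun h1 => hfp.ne_zero (by rw [h1, C_0])))
  let ψ : Bp k e1 →ₐ[k] (MvPolynomial (Fin n) k ⧸ q) :=
    (Ideal.Quotient.factorₐ k hpq).comp (IsScalarTower.toAlgHom k (Bp k e1) (MvPolynomial (Fin n) k ⧸ p))
  have hker : ∀ b, ψ b = 0 → f ∣ b := by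
    intro b hb
    apply hfd
    obtain ⟨r, hr⟩ := Ideal.Quotient.mk_surjective (algebraMap (Bp k e1) (MvPolynomial (Fin n) k ⧸ p) b)
    have hb' : Ideal.Quotient.factorₐ k hpq (algebraMap (Bp k e1) (MvPolynomial (Fin n) k ⧸ p) b) = 0 := hb
    rw [← hr] at hb' ⊢
    exact Ideal.mem_map_of_mem _ (Ideal.Quotient.eq_zero_iff_mem.1 hb')
  have hmap : ∀ m, (restrictTotalDegree (Fin e1) k m).map ψ.toLinearMap ≤ Vm q m := by
    rintro m _ ⟨b, hb, rfl⟩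
    have h1 : algebraMap (Bp k e1) (MvPolynomial (Fin n) k ⧸ p) b ∈ Vm p m := by
      rw [Vm_pow]
      have hY : Ysp k (yE k e1 (MvPolynomial (Fin n) k ⧸ p)) ≤ Vm p 1 := by
        rw [Ysp, Submodule.span_le]
        rintro x (rfl | ⟨i, rfl⟩)
        exacts [one_mem_Vm p 1, h.memV i]
      exact pow_le_pow_left' hY m (algebraMap_mem_Y m b ((mem_restrictTotalDegree _ _ _).1 hb))
    obtain ⟨r, hr, hr2⟩ := mem_Vm.1 h1
    refine mem_Vm.2 ⟨r, hr, ?_⟩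
    change _ = Ideal.Quotient.factorₐ k hpq (algebraMap (Bp k e1) (MvPolynomial (Fin n) k ⧸ p) b)
    rw [← hr2]; rfl
  have key : ∀ m, (m + 1 + e1).choose e1 ≤ hf q (m + 1) + (m + e1).choose e1 := by
    intro m
    have h1 := LinearMap.finrank_range_add_finrank_ker
      (ψ.toLinearMap.domRestrict (restrictTotalDegree (Fin e1) k (m + 1)))
    rw [finrank_rtd, LinearMap.range_domRestrict] at h1
    have h2 : Module.finrank k ((restrictTotalDegree (Fin e1) k (m + 1)).map ψ.toLinearMap) ≤ hf q (m+1) :=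
      Submodule.finrank_mono (hmap (m + 1))
    let L := LinearMap.ker (ψ.toLinearMap.domRestrict (restrictTotalDegree (Fin e1) k (m + 1)))
    have h3 : Module.finrank k L ≤ (m + e1).choose e1 := by
      have h4 : L.map (Submodule.subtype _) ≤ (restrictTotalDegree (Fin e1) k m).map (LinearMap.mulLeft k f) := by
        rintro _ ⟨⟨b, hb⟩, hb2, rfl⟩
        obtain ⟨c, rfl⟩ := hker b hb2
        refine ⟨c, ?_, rfl⟩
        rw [SetLike.mem_coe, mem_restrictTotalDegree]
        rw [mem_restrictTotalDegree] at hb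
        by_cases hc : c = 0
        · simp [hc]
        rw [totalDegree_mul_of_isDomain hfp.ne_zero hc] at hb
        omega
      have h5 := Submodule.finrank_mono h4
      have h6 := (Submodule.equivMapOfInjective _ (Submodule.subtype_injective _) L).finrank_eq
      rw [← h6] at h5
      exact h5.trans ((Submodule.finrank_map_le _ _).trans (finrank_rtd k e1 m).le)
    have h3' : Module.finrank k (LinearMap.ker (ψ.toLinearMap.domRestrict (restrictTotalDegree (Fin e1) k (m + 1)))) ≤ (m + e1).choose e1 := h3
    omega
  have key2 : ∀ M, (M + e1).choose e1 ≤ ∑ m ∈ Finset.range (M + 1), hf q m := by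
    intro M
    induction M with
    | zero =>
      have h0 : 1 ≤ hf q 0 := by
        have hne : Nontrivial (Vm q 0) := ⟨⟨1, one_mem_Vm q 0⟩, 0, fun h => one_ne_zero (congrArg Subtype.val h)⟩
        exact Module.finrank_pos
      simpa using h0
    | succ M ih =>
      rw [Finset.sum_range_succ]
      have := key M
      omega
  have := growth 1 N' 1 0 e1 (e' + 1) le_rfl (fun s => by
    rw [one_mul, one_mul, add_zero, ← sum_choose, Finset.mul_sum]
    exact (key2 s).trans (Finset.sum_le_sum fun m _ => hqN.upper m))
  omega
theorem cut {p : Ideal (MvPolynomial (Fin n) k)} [p.IsPrime] {e N : ℕ} (hp : IsHF p e N)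
    {g : MvPolynomial (Fin n) k} (hg : g ∉ p) {δ : ℕ} (hδ : g.totalDegree ≤ δ)
    {ι : Type*} [Fintype ι] (q : ι → Ideal (MvPolynomial (Fin n) k)) (hinj : Function.Injective q)
    (hq : ∀ i, q i ∈ (p ⊔ Ideal.span {g}).minimalPrimes)
    {e' N' : ι → ℕ} (hN : ∀ i, IsHF (q i) (e' i) (N' i)) :
    (∀ i, e' i + 1 = e) ∧ ∑ i, N' i ≤ δ * N := by
  have h1 : ∀ i, e' i + 1 = e := fun i => cut_dim hp hg (hq i) (hN i)
  have hqp : ∀ i, (q i).IsPrime := fun i => (hq i).1.1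
  refine ⟨h1, ?_⟩
  rcases Nat.eq_zero_or_pos (∑ i, N' i) with h0 | hpos
  · omega
  obtain ⟨c, hc⟩ := cut_sum hp hg hδ q (fun i j hij hle => hij (hinj
    (le_antisymm hle ((hq j).2 (hq i).1 hle)))) (fun i => le_sup_left.trans (hq i).1.2)
    (fun i => (hq i).1.2 (Ideal.mem_sup_right (Ideal.mem_span_singleton_self g))) hN
  simp only [h1, ← Finset.sum_mul] at hc
  have := growth _ (δ * N) 1 c e e hpos (fun s => by rw [one_mul]; exact hc s)
  simpa using this
end Cut

section Apx
variable {n : ℕ} {k : Type*} [Field k] [Infinite k]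
structure Apx (p q : Ideal (MvPolynomial (Fin n) k)) (e N D c : ℕ) : Prop where
  prime : q.IsPrime
  le : q ≤ p
  agree : ∀ f ∈ p, f.totalDegree ≤ D → f ∈ q
  isHF : IsHF q e N
  good : N * (D + 1) ^ e ≤ c * hf q D
def cA (n : ℕ) : ℕ := 2 ^ n * n.factorial
lemma cA_pos (n : ℕ) : 1 ≤ cA n := Nat.mul_pos (by positivity) n.factorial_pos
lemma good_mono {q : Ideal (MvPolynomial (Fin n) k)} {e N D c D' : ℕ} (h : IsHF q e N)
    (hg : N * (D + 1) ^ e ≤ c * hf q D) (hD : D ≤ D') : N * (D' + 1) ^ e ≤ (cA n * c) * hf q D' := by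
  obtain ⟨s, rfl⟩ := Nat.exists_eq_add_of_le hD
  have hen := h.le_n
  have h1 : N * (s + 1) ^ e ≤ (e.factorial * c) * hf q (D + s) := by
    have hr := h.reg D s
    have h2 := pow1_le_choose s e
    have h3 := choose_le_pow1 D e
    have : N * (s + 1) ^ e * (D + 1) ^ e ≤ (e.factorial * c) * hf q (D + s) * (D + 1) ^ e := by
      calc N * (s + 1) ^ e * (D + 1) ^ e = (N * (D + 1) ^ e) * (s + 1) ^ e := by ring
        _ ≤ (c * hf q D) * (e.factorial * (s + e).choose e) := by gcongr
        _ = e.factorial * c * (hf q D * (s + e).choose e) := by ring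
        _ ≤ e.factorial * c * ((D + e).choose e * hf q (D + s)) := by gcongr
        _ ≤ e.factorial * c * ((D + 1) ^ e * hf q (D + s)) := by gcongr
        _ = _ := by ring
    exact Nat.le_of_mul_le_mul_right this (by positivity)
  have h2 : N * (D + 1) ^ e ≤ (e.factorial * c) * hf q (D + s) := by
    refine hg.trans ?_
    have := hf_mono q hD
    have := e.factorial_pos
    calc c * hf q D = 1 * c * hf q D := by ring
      _ ≤ _ := by gcongr; omega
  have h3 : N * (max (D + 1) (s + 1)) ^ e ≤ (e.factorial * c) * hf q (D + s) := by
    rcases max_choice (D + 1) (s + 1) with h | h <;> rw [h] <;> assumption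
  calc N * (D + s + 1) ^ e ≤ N * (2 * max (D + 1) (s + 1)) ^ e := by gcongr; omega
    _ = 2 ^ e * (N * (max (D + 1) (s + 1)) ^ e) := by rw [mul_pow]; ring
    _ ≤ 2 ^ e * ((e.factorial * c) * hf q (D + s)) := by gcongr
    _ ≤ 2 ^ n * ((n.factorial * c) * hf q (D + s)) := by
        have := Nat.factorial_le hen
        gcongr; omega
    _ = _ := by rw [cA]; ring
theorem Apx.extend {p : Ideal (MvPolynomial (Fin n) k)} [hp : p.IsPrime] (e : ℕ) :
    ∀ {q N D c}, Apx p q e N D c → ∀ {D'}, D ≤ D' → ∃ q' e' N', q ≤ q' ∧ Apx p q' e' N' D' (cA n ^ (e + 1) * c) := by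
  induction e using Nat.strong_induction_on with
  | _ e ih =>
  intro q N D c h D' hD
  have hc := cA_pos n
  by_cases hag : ∀ f ∈ p, f.totalDegree ≤ D' → f ∈ q
  · refine ⟨q, e, N, le_rfl, h.prime, h.le, hag, h.isHF, ?_⟩
    refine (good_mono h.isHF h.good hD).trans ?_
    have : cA n ≤ cA n ^ (e + 1) := Nat.le_self_pow (by omega) _
    gcongr
  push Not at hag
  have hex : ∃ m, ∃ f ∈ p, f.totalDegree ≤ m ∧ f ∉ q := by
    obtain ⟨f, h1, h2, h3⟩ := hag; exact ⟨_, f, h1, h2, h3⟩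
  classical
  have hle : Nat.find hex ≤ D' := Nat.find_min' hex hag
  have hmin := @Nat.find_min _ _ hex
  obtain ⟨g, hgp, hgd, hgq⟩ := Nat.find_spec hex
  set δ := Nat.find hex
  have hδ : D < δ := by
    by_contra hcon
    exact hgq (h.agree g hgp (by omega))
  have := h.prime
  obtain ⟨m, hm⟩ : ∃ m, δ = m + 1 := ⟨δ - 1, by omega⟩
  obtain ⟨q', hq', hq'p⟩ := Ideal.exists_minimalPrimes_le (I := q ⊔ Ideal.span {g}) (J := p)
    (sup_le h.le ((Ideal.span_singleton_le_iff_mem _).2 hgp))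
  have := hq'.1.1
  have hqq : q ≤ q' := le_sup_left.trans hq'.1.2
  obtain ⟨e', N', hN'⟩ := exists_HF q'
  have hcut := cut h.isHF hgq hgd (ι := Unit) (fun _ => q') (fun _ _ _ => rfl) (fun _ => hq')
    (e' := fun _ => e') (N' := fun _ => N') (fun _ => hN')
  simp only [Finset.univ_unique, Finset.sum_const, Finset.card_singleton, one_smul, forall_const] at hcut
  obtain ⟨he, hNN⟩ := hcut
  have hagm : ∀ f ∈ p, f.totalDegree ≤ m → f ∈ q := by
    intro f h1 h2
    by_contra h3
    exact hmin (show m < δ by omega) ⟨f, h1, h2, h3⟩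
  have hgood := good_mono h.isHF h.good (show D ≤ m by omega)
  have hfe : hf q' m = hf q m := hf_congr (fun f hfm => ⟨fun h => hqq h, fun h => hagm f (hq'p h) hfm⟩)
  have hA : Apx p q' e' N' m (cA n * c) := by
    refine ⟨hq'.1.1, hq'p, fun f h1 h2 => hqq (hagm f h1 h2), hN', ?_⟩
    rw [hfe]
    refine le_trans ?_ hgood
    calc N' * (m + 1) ^ e' ≤ (δ * N) * (m + 1) ^ e' := by gcongr
      _ = N * (m + 1) ^ e := by rw [← he, hm]; ring
  obtain ⟨q2, e2, N2, hq2, hA2⟩ := ih e' (by omega) hA (show m ≤ D' by omega)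
  refine ⟨q2, e2, N2, hqq.trans hq2, hA2.prime, hA2.le, hA2.agree, hA2.isHF, hA2.good.trans ?_⟩
  rw [← he]
  apply Nat.mul_le_mul_right
  rw [pow_succ (cA n) (e' + 1)]
  exact le_of_eq (by ring)
lemma bot_isHF : IsHF (⊥ : Ideal (MvPolynomial (Fin n) k)) n 1 := by
  have hbot : ∀ m, hf (⊥ : Ideal (MvPolynomial (Fin n) k)) m = (m + n).choose n := by
    intro m
    have h := hf_add (⊥ : Ideal (MvPolynomial (Fin n) k)) m
    have h0 : Im (⊥ : Ideal (MvPolynomial (Fin n) k)) m = ⊥ := by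
      rw [eq_bot_iff]; intro f hm
      exact (mem_Im.1 hm).1
    rw [h0] at h
    simpa using h
  obtain ⟨e, N, h⟩ := exists_HF (⊥ : Ideal (MvPolynomial (Fin n) k))
  obtain ⟨m0, hl⟩ := h.lower
  have g1 := growth 1 N 1 0 n e le_rfl (fun s => by simpa [hbot] using h.upper s)
  have g2 := growth N 1 1 m0 e n h.pos (fun s => by simpa [hbot, add_comm, add_left_comm] using hl s)
  have := h.pos
  have h1 : e = n := by omega
  subst h1
  have h2 : N = 1 := by simp at g1 g2; omega
  exact h2 ▸ h
def cB (n : ℕ) : ℕ := cA n ^ (n + 1)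
lemma cB_pos (n : ℕ) : 1 ≤ cB n := Nat.one_le_pow _ _ (cA_pos n)
theorem exists_Apx (p : Ideal (MvPolynomial (Fin n) k)) [hp : p.IsPrime] (D : ℕ) :
    ∃ q e N, Apx p q e N D (cB n) := by
  have h0 : Apx p ⊥ n 1 0 1 := by
    refine ⟨Ideal.isPrime_bot, bot_le, ?_, bot_isHF, ?_⟩
    · intro f h1 h2
      have h0 : f.totalDegree = 0 := by omega
      rw [totalDegree_eq_zero_iff_eq_C] at h0
      by_cases hc : coeff 0 f = 0
      · rw [h0, hc]; simp
      · exact absurd (Ideal.eq_top_of_isUnit_mem _ h1 (by rw [h0]; exact IsUnit.map C (IsUnit.mk0 _ hc))) hp.ne_top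
    · obtain ⟨m0, hl⟩ := (bot_isHF (n := n) (k := k)).lower
      have := (bot_isHF (n := n) (k := k)).reg 0 m0
      have h2 := hl 0
      have h3 : 0 < hf (⊥ : Ideal (MvPolynomial (Fin n) k)) 0 := by
        have hne : Nontrivial (Vm (⊥ : Ideal (MvPolynomial (Fin n) k)) 0) :=
          have := Ideal.isPrime_bot (α := MvPolynomial (Fin n) k)
          ⟨⟨1, one_mem_Vm _ 0⟩, 0, fun h => one_ne_zero (congrArg Subtype.val h)⟩
        exact Module.finrank_pos
      simpa using Nat.succ_le_of_lt h3
  obtain ⟨q, e, N, -, h⟩ := h0.extend n (Nat.zero_le D)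
  exact ⟨q, e, N, by simpa [cB] using h⟩
lemma Apx.hf_eq' {p q : Ideal (MvPolynomial (Fin n) k)} {e N D c : ℕ} (h : Apx p q e N D c) {m : ℕ} (hm : m ≤ D) :
    hf p m = hf q m :=
  hf_congr (fun f hfm => ⟨fun h' => h.le h', fun h' => h.agree f h' (hfm.trans hm)⟩)
theorem hf_doubling (p : Ideal (MvPolynomial (Fin n) k)) [hp : p.IsPrime] {m D : ℕ} (h : m ≤ D) :
    hf p D * (m + 1) ^ n ≤ cB n * (D + 1) ^ n * hf p m := by
  obtain ⟨q, e, N, hA⟩ := exists_Apx p m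
  have h1 : hf p D ≤ N * (D + 1) ^ e :=
    (hf_anti (fun f h' _ => hA.le h')).trans ((hA.isHF.upper D).trans (by gcongr; exact choose_le_pow1 D e))
  have hen := hA.isHF.le_n
  obtain ⟨r, hr⟩ := Nat.exists_eq_add_of_le hen
  have h2 := hA.good
  rw [← hA.hf_eq' le_rfl] at h2
  calc hf p D * (m + 1) ^ n ≤ N * (D + 1) ^ e * (m + 1) ^ n := by gcongr
    _ = (N * (m + 1) ^ e) * (D + 1) ^ e * (m + 1) ^ r := by rw [hr, pow_add]; ring
    _ ≤ (cB n * hf p m) * (D + 1) ^ e * (D + 1) ^ r := by gcongr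
    _ = cB n * (D + 1) ^ (e + r) * hf p m := by ring
    _ = _ := by rw [← hr]
end Apx

section Growth
variable {K : Type*} [Field K]
lemma det_one_add_ne [Infinite K] {r : ℕ} (M : Matrix (Fin r) (Fin r) K) :
    ∃ t : K, t ≠ 0 ∧ (1 + t • M).det ≠ 0 := by
  have h0 : M.charpolyRev ≠ 0 := by
    intro h
    have := Matrix.eval_charpolyRev (M := M)
    rw [h] at this; simp at this
  have h1 : (Polynomial.X * M.charpolyRev : Polynomial K) ≠ 0 := mul_ne_zero Polynomial.X_ne_zero h0
  by_contra! hcon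
  apply h1
  apply Polynomial.funext
  intro t
  by_cases ht : t = 0
  · simp [ht]
  have h2 := hcon (-t) (neg_ne_zero.2 ht)
  have h3 : Polynomial.eval t M.charpolyRev = (1 + (-t) • M).det := by
    rw [Matrix.charpolyRev, ← Polynomial.coe_evalRingHom, RingHom.map_det]
    congr 1
    ext i j
    rcases eq_or_ne i j with hij | hij <;> (simp [hij]; ring)
  rw [Polynomial.eval_mul, h3, h2]; simp
lemma exists_dual {ι F : Type*} [Fintype ι] [DecidableEq ι] [AddCommGroup F] [Module K F] {v : ι → F}
    (hv : LinearIndependent K v) : ∃ L : F →ₗ[K] (ι → K), ∀ i, L (v i) = Pi.single i 1 := by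
  obtain ⟨L, hL⟩ := LinearMap.exists_leftInverse_of_injective (Fintype.linearCombination K v)
      (LinearMap.ker_eq_bot.2 (linearIndependent_iff_injective_fintypeLinearCombination.1 hv))
  refine ⟨L, fun i => ?_⟩
  have := LinearMap.congr_fun hL (Pi.single i 1)
  simpa using this
lemma max_rank [Infinite K] {E F : Type*} [AddCommGroup E] [Module K E] [AddCommGroup F] [Module K F]
    [FiniteDimensional K E] [FiniteDimensional K F] (φ ψ : E →ₗ[K] F)
    (h : ∀ t : K, Module.finrank K (LinearMap.range (φ + t • ψ)) ≤ Module.finrank K (LinearMap.range φ))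
    {y : E} (hy : φ y = 0) : ψ y ∈ LinearMap.range φ := by
  by_contra hcon
  set r := Module.finrank K (LinearMap.range φ) with hr
  let b := Module.finBasis K (LinearMap.range φ)
  choose x hx using fun i => (b i).2
  let x' : Fin (r + 1) → E := Fin.cons y x
  let v : Fin (r + 1) → F := Fin.cons (ψ y) (fun i => (b i : F))
  have hv : LinearIndependent K v := by
    rw [linearIndependent_finCons]
    refine ⟨b.linearIndependent.map' _ (Submodule.ker_subtype _), ?_⟩
    intro hmem
    apply hcon
    refine Submodule.span_le.2 ?_ hmem
    rintro _ ⟨i, rfl⟩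
    exact (b i).2
  obtain ⟨L, hL⟩ : ∃ L : F →ₗ[K] (Fin (r + 1) → K), ∀ i, L (v i) = Pi.single i 1 := by
    exact exists_dual hv
  let M : Matrix (Fin (r+1)) (Fin (r+1)) K := fun i j => if i = 0 then 0 else L (ψ (x' i)) j
  have hM : ∀ i j, M i j = if i = 0 then 0 else L (ψ (x' i)) j := fun _ _ => rfl
  obtain ⟨t, ht, hdet⟩ := det_one_add_ne M
  have hrow : ∀ i, (1 + t • M) i = L ((φ + t • ψ) (if i = 0 then t⁻¹ • x' i else x' i)) := by
    intro i
    refine Fin.cases ?_ (fun j => ?_) i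
    · have h1 := hL 0
      simp only [v, Fin.cons_zero] at h1
      ext j
      simp [x', hy, hM, ht, h1, Matrix.one_apply, Pi.single_apply, eq_comm]
    · have h1 := hL j.succ
      simp only [v, Fin.cons_succ] at h1
      ext l
      simp [x', hM, hx, h1, Matrix.one_apply, Pi.single_apply, eq_comm]
  have hli : LinearIndependent K (fun i => (φ + t • ψ) (if i = 0 then t⁻¹ • x' i else x' i)) := by
    have h2 : LinearIndependent K (1 + t • M).row :=
      Matrix.linearIndependent_rows_iff_isUnit.2 ((Matrix.isUnit_iff_isUnit_det _).2 (IsUnit.mk0 _ hdet))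
    apply LinearIndependent.of_comp L
    convert h2 using 1
    ext i
    simp only [Function.comp, ← hrow]; rfl
  have h3 : r + 1 ≤ Module.finrank K (LinearMap.range (φ + t • ψ)) := by
    have h4 : Submodule.span K (Set.range (fun i => (φ + t • ψ) (if i = 0 then t⁻¹ • x' i else x' i))) ≤ LinearMap.range (φ + t • ψ) := by
      rw [Submodule.span_le]; rintro _ ⟨i, rfl⟩; exact ⟨_, rfl⟩
    have h5 := Submodule.finrank_mono h4
    rw [finrank_span_eq_card hli] at h5
    simpa using h5
  have := h t
  omega
variable {F : Type*} [Field F] [Algebra K F] [FiniteDimensional K F]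
lemma finrank_mulmap (W : Submodule K F) {z : F} (hz : z ≠ 0) :
    Module.finrank K (W.map (LinearMap.mulLeft K z)) = Module.finrank K W :=
  ((Submodule.equivMapOfInjective _ (fun _ _ h => mul_left_cancel₀ hz h) W).finrank_eq).symm
lemma dual_prod {W U : Submodule K F} (h : W * U ≠ ⊤) :
    Module.finrank K W + Module.finrank K U ≤ Module.finrank K F := by
  obtain ⟨l, hl0, hl⟩ := Submodule.exists_le_ker_of_lt_top (W * U) (lt_top_iff_ne_top.2 h)
  let Φ : F →ₗ[K] Module.Dual K F := (LinearMap.mul K F).compr₂ l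
  have hinj : Function.Injective Φ := by
    rw [← LinearMap.ker_eq_bot, eq_bot_iff]
    intro x hx
    by_contra hx0
    apply hl0
    ext y
    have := LinearMap.congr_fun (show Φ x = 0 from hx) (x⁻¹ * y)
    simp only [Φ, LinearMap.compr₂_apply, LinearMap.mul_apply_apply, LinearMap.zero_apply] at this
    rwa [mul_inv_cancel_left₀ hx0] at this
  have hle : W.map Φ ≤ U.dualAnnihilator := by
    rintro _ ⟨x, hx, rfl⟩
    rw [Submodule.mem_dualAnnihilator]
    intro y hy
    exact hl (Submodule.mul_mem_mul hx hy)
  have h1 := Submodule.finrank_mono hle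
  rw [← (Submodule.equivMapOfInjective _ hinj W).finrank_eq] at h1
  have h2 := Subspace.finrank_add_finrank_dualAnnihilator_eq U
  omega
lemma sub_ratio {W : Submodule K F} {U1 U2 : Submodule K F} (h1 : U1 ≤ W) (h2 : U2 ≤ W)
    (h : Module.finrank K W < Module.finrank K U1 + Module.finrank K U2) : ∃ w ∈ U1, w ∈ U2 ∧ w ≠ 0 := by
  have := Submodule.finrank_sup_add_finrank_inf_eq U1 U2
  have h3 := Submodule.finrank_mono (sup_le h1 h2)
  have h4 : 0 < Module.finrank K ↥(U1 ⊓ U2) := by omega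
  have h5 := Module.finrank_pos_iff.1 h4
  obtain ⟨⟨w, hw⟩, hw0⟩ := exists_ne (0 : ↥(U1 ⊓ U2))
  exact ⟨w, hw.1, hw.2, fun h => hw0 (Subtype.ext h)⟩
theorem growth_one [Infinite K] {W : Submodule K F} (h1 : (1 : F) ∈ W) (hgen : Algebra.adjoin K (W : Set F) = ⊤)
    (hW : 2 * Module.finrank K ↥(W * W) < 3 * Module.finrank K W) : W * W = ⊤ := by
  set w := Module.finrank K W with hw
  let Wz : F → Submodule K F := fun z => W ⊓ W.comap (LinearMap.mulLeft K z)
  have hWz : ∀ z x, x ∈ Wz z ↔ x ∈ W ∧ z * x ∈ W := fun z x => Iff.rfl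
  let Q : F → Prop := fun z => ∃ b ∈ W, b ≠ 0 ∧ z * b ∈ W
  have hQ : ∀ z, Q z → w < 2 * Module.finrank K (Wz z) := by
    rintro z ⟨b, hb, hb0, ha⟩
    by_cases hz : z = 0
    · have : Wz z = W := by
        ext x; simp [hWz, hz]
      rw [this]
      have : 0 < w := by
        have : Nontrivial W := ⟨⟨1, h1⟩, 0, fun h => one_ne_zero (congrArg Subtype.val h)⟩
        exact Module.finrank_pos
      omega
    have hab : z * b ≠ 0 := mul_ne_zero hz hb0
    have e1 := finrank_mulmap W hb0
    have e2 := finrank_mulmap W hab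
    have e3 := Submodule.finrank_sup_add_finrank_inf_eq (W.map (LinearMap.mulLeft K b)) (W.map (LinearMap.mulLeft K (z * b)))
    have e4 : W.map (LinearMap.mulLeft K b) ⊔ W.map (LinearMap.mulLeft K (z * b)) ≤ W * W := by
      refine sup_le ?_ ?_
      · rintro _ ⟨x, hx, rfl⟩; exact Submodule.mul_mem_mul hb hx
      · rintro _ ⟨x, hx, rfl⟩; exact Submodule.mul_mem_mul ha hx
    have e5 := Submodule.finrank_mono e4
    have e6 : W.map (LinearMap.mulLeft K b) ⊓ W.map (LinearMap.mulLeft K (z * b)) ≤ (Wz z).map (LinearMap.mulLeft K (z * b)) := by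
      rintro _ ⟨⟨x, hx, rfl⟩, ⟨y, hy, hxy⟩⟩
      refine ⟨y, (hWz _ _).2 ⟨hy, ?_⟩, hxy⟩
      simp only [LinearMap.mulLeft_apply] at hxy
      have : z * y = x := mul_left_cancel₀ hb0 (by rw [← hxy]; ring)
      rwa [this]
    have e7 := Submodule.finrank_mono e6
    rw [finrank_mulmap _ hab] at e7
    omega
  have hQall : ∀ z, Q z := by
    let A : Subalgebra K F :=
      { carrier := {z | Q z}
        mul_mem' := by
          intro z1 z2 q1 q2
          by_cases hz : z2 = 0
          · exact ⟨1, h1, one_ne_zero, by simp [hz]⟩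
          have f1 := hQ _ q1
          have q2' : Q z2⁻¹ := by
            obtain ⟨b, hb, hb0, ha⟩ := q2
            exact ⟨z2 * b, ha, mul_ne_zero hz hb0, by rwa [inv_mul_cancel_left₀ hz]⟩
          have f2 := hQ _ q2'
          obtain ⟨x, hx1, hx2, hx0⟩ := sub_ratio (W := W) (U1 := Wz z1) (U2 := Wz z2⁻¹) inf_le_left inf_le_left (by omega)
          refine ⟨z2⁻¹ * x, hx2.2, mul_ne_zero (inv_ne_zero hz) hx0, ?_⟩
          rw [mul_assoc, mul_inv_cancel_left₀ hz]
          exact hx1.2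
        add_mem' := by
          intro z1 z2 q1 q2
          have f1 := hQ _ q1
          have f2 := hQ _ q2
          obtain ⟨x, hx1, hx2, hx0⟩ := sub_ratio (W := W) (U1 := Wz z1) (U2 := Wz z2) inf_le_left inf_le_left (by omega)
          refine ⟨x, hx1.1, hx0, ?_⟩
          rw [add_mul]
          exact W.add_mem hx1.2 hx2.2
        algebraMap_mem' := by
          intro r
          refine ⟨1, h1, one_ne_zero, ?_⟩
          rw [mul_one, Algebra.algebraMap_eq_smul_one]
          exact W.smul_mem _ h1 }
    have hA : (⊤ : Subalgebra K F) ≤ A := by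
      rw [← hgen]
      apply Algebra.adjoin_le
      intro x hx
      exact ⟨1, h1, one_ne_zero, by simpa using hx⟩
    exact fun z => hA (Algebra.mem_top (x := z))
  let φ : F → (W →ₗ[K] (F ⧸ W)) := fun z => W.mkQ ∘ₗ (LinearMap.mulLeft K z) ∘ₗ W.subtype
  have hrk : ∀ z, 2 * Module.finrank K (LinearMap.range (φ z)) < w := by
    intro z
    have e1 := LinearMap.finrank_range_add_finrank_ker (φ z)
    have e2 : Module.finrank K (LinearMap.ker (φ z)) = Module.finrank K (Wz z) := by
      have : (LinearMap.ker (φ z)).map W.subtype = Wz z := by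
        ext x
        simp [φ, hWz, LinearMap.mem_ker, and_comm]
      rw [← this]
      exact (Submodule.equivMapOfInjective _ (Submodule.subtype_injective _) _).finrank_eq
    have := hQ z (hQall z)
    omega
  obtain ⟨z0, hz0⟩ : ∃ z0, ∀ z, Module.finrank K (LinearMap.range (φ z)) ≤ Module.finrank K (LinearMap.range (φ z0)) := by
    have hb : BddAbove (Set.range fun z => Module.finrank K (LinearMap.range (φ z))) :=
      ⟨w, by rintro _ ⟨z, rfl⟩; have := hrk z; simp only; omega⟩
    have := Nat.sSup_mem (Set.range_nonempty _) hb
    obtain ⟨z0, h0⟩ := this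
    exact ⟨z0, fun z => by rw [show Module.finrank K (LinearMap.range (φ z0)) = _ from h0]; exact le_csSup hb ⟨z, rfl⟩⟩
  obtain ⟨y, hy, hy0, hzy⟩ := hQall z0
  have hker : φ z0 ⟨y, hy⟩ = 0 := by simp [φ, hzy]
  have hall : ∀ z, φ z ⟨y, hy⟩ ∈ LinearMap.range (φ z0) := by
    intro z
    apply max_rank (φ z0) (φ z) _ hker
    intro t
    have : φ z0 + t • φ z = φ (z0 + t • z) := by
      ext x; simp [φ, add_mul]
    rw [this]; exact hz0 _
  have hsurj : LinearMap.range (φ z0) = ⊤ := by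
    rw [eq_top_iff]
    rintro v -
    obtain ⟨u, rfl⟩ := W.mkQ_surjective v
    have := hall (u * y⁻¹)
    simpa [φ, mul_assoc, inv_mul_cancel₀ hy0] using this
  have e1 := hrk z0
  rw [hsurj, finrank_top] at e1
  have e2 := Submodule.finrank_quotient_add_finrank W
  by_contra hne
  have := dual_prod hne
  omega
theorem growth_pow [Infinite K] (i : ℕ) : ∀ {W : Submodule K F}, (1 : F) ∈ W →
    Algebra.adjoin K (W : Set F) = ⊤ →
    2 ^ i * Module.finrank K F < 3 ^ i * Module.finrank K W → W ^ (2 ^ i) = ⊤ := by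
  induction i with
  | zero =>
    intro W _ _ h
    have := Submodule.finrank_le W
    simp at h; omega
  | succ i ih =>
    intro W h1 hgen h
    rw [pow_succ 2 i, mul_comm, pow_mul, pow_two]
    by_cases hW : 2 * Module.finrank K ↥(W * W) < 3 * Module.finrank K W
    · rw [growth_one h1 hgen hW]
      have : ∀ j, (⊤ : Submodule K F) ≤ ⊤ ^ (j + 1) := by
        intro j
        simpa using pow_mono_of_one (V := (⊤ : Submodule K F)) trivial (show 1 ≤ j + 1 by omega)
      obtain ⟨j, hj⟩ : ∃ j, 2 ^ i = j + 1 := ⟨2 ^ i - 1, by have := Nat.pos_of_ne_zero (pow_ne_zero i two_ne_zero); omega⟩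
      rw [hj]; exact top_le_iff.1 (this j)
    · apply ih
      · simpa using Submodule.mul_mem_mul h1 h1
      · rw [eq_top_iff, ← hgen]
        apply Algebra.adjoin_mono
        intro x hx
        simpa using Submodule.mul_mem_mul hx h1
      · rw [pow_succ, pow_succ] at h
        have h2 : 3 ^ i * (3 * Module.finrank K W) ≤ 3 ^ i * (2 * Module.finrank K ↥(W * W)) := by
          apply Nat.mul_le_mul_left; omega
        nlinarith
end Growth

section FDs
variable {n : ℕ} {k : Type*} [Field k] {e : ℕ} {F : Type*} [Field F] [Algebra k F] [Algebra (Bp k e) F]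
  [Algebra (Kp k e) F] [IsScalarTower k (Bp k e) F] [IsScalarTower (Bp k e) (Kp k e) F]
def im {E : Type*} [CommRing E] [Algebra k E] (φ : MvPolynomial (Fin n) k →ₐ[k] E) (m : ℕ) : Submodule k E :=
  (restrictTotalDegree (Fin n) k m).map φ.toLinearMap
lemma mem_im {E : Type*} [CommRing E] [Algebra k E] {φ : MvPolynomial (Fin n) k →ₐ[k] E} {m : ℕ} {x : E} :
    x ∈ im φ m ↔ ∃ f, f.totalDegree ≤ m ∧ φ f = x := by
  simp [im, Submodule.mem_map, mem_restrictTotalDegree]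
lemma im_pow {E : Type*} [CommRing E] [Algebra k E] (φ : MvPolynomial (Fin n) k →ₐ[k] E) (m : ℕ) :
    im φ m = im φ 1 ^ m := by
  rw [im, im, rtd_pow m]
  exact Submodule.map_pow _ φ m
lemma im_fg {E : Type*} [CommRing E] [Algebra k E] (φ : MvPolynomial (Fin n) k →ₐ[k] E) (m : ℕ) :
    (im φ m).FG := by
  have := rtd_fin (n := n) (k := k) m
  exact (Module.Finite.iff_fg.1 this).map _
lemma one_mem_im {E : Type*} [CommRing E] [Algebra k E] (φ : MvPolynomial (Fin n) k →ₐ[k] E) (m : ℕ) :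
    (1 : E) ∈ im φ m := mem_im.2 ⟨1, by simp, map_one _⟩
structure FD (q : Ideal (MvPolynomial (Fin n) k)) (M : ℕ) (φ : MvPolynomial (Fin n) k →ₐ[k] F) : Prop where
  fin : Module.Finite (Kp k e) F
  ker : ∀ f, φ f = 0 ↔ f ∈ q
  memV : ∀ i, yE k e F i ∈ im φ 1
  top : Submodule.span (Kp k e) ((im φ M : Submodule k F) : Set F) = ⊤
  red : im φ 1 ^ (M + 1) ≤ Ysp k (yE k e F) * im φ 1 ^ M
  isHF : IsHF q e (Module.finrank (Kp k e) F)
attribute [local instance] FractionRing.liftAlgebra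
theorem FD_abs [Infinite k] {q : Ideal (MvPolynomial (Fin n) k)} {A : Type*} [CommRing A] [IsDomain A]
    [Algebra k A] [Algebra (Bp k e) A] [IsScalarTower k (Bp k e) A] [FaithfulSMul (Bp k e) A]
    (π : MvPolynomial (Fin n) k →ₐ[k] A) (hπ : Function.Surjective π) (hker : ∀ f, π f = 0 ↔ f ∈ q)
    {N : ℕ} (hmemV : ∀ i, yE k e A i ∈ im π 1) (hred : im π 1 ^ (N + 1) ≤ Ysp k (yE k e A) * im π 1 ^ N)
    (hHF : IsHF q e (Module.finrank (Kp k e) (FractionRing A))) :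
    letI := FractionRing.isScalarTower_liftAlgebra (Bp k e) (FractionRing A)
    FD (e := e) q N ((IsScalarTower.toAlgHom k A (FractionRing A)).comp π) := by
  have t1 := FractionRing.isScalarTower_liftAlgebra (Bp k e) (FractionRing A)
  let φ : A →ₐ[k] FractionRing A := IsScalarTower.toAlgHom k A (FractionRing A)
  have hφ : Function.Injective φ := IsFractionRing.injective A (FractionRing A)
  have him : ∀ m, im (φ.comp π) m = (im π m).map φ.toLinearMap := by
    intro m; ext x
    rw [mem_im, Submodule.mem_map]
    constructor
    · rintro ⟨f, h1, rfl⟩; exact ⟨_, mem_im.2 ⟨f, h1, rfl⟩, rfl⟩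
    · rintro ⟨_, h2, rfl⟩
      obtain ⟨f, h1, rfl⟩ := mem_im.1 h2
      exact ⟨f, h1, rfl⟩
  have hgen : ∀ a : A, ∃ m, a ∈ im π 1 ^ m := by
    intro a
    obtain ⟨f, rfl⟩ := hπ a
    exact ⟨f.totalDegree, by rw [← im_pow]; exact mem_im.2 ⟨f, le_rfl, rfl⟩⟩
  have hBA := finite_of_red' (im_fg π 1) (one_mem_im π 1) hgen hred
  have htop : Submodule.span (Kp k e) (((im π N).map φ.toLinearMap : Submodule k (FractionRing A)) :
      Set (FractionRing A)) = ⊤ := by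
    have h5 := IsFractionRing.ideal_span_singleton_map_subset (R := Bp k e) (S := A) (K := Kp k e)
      (L := FractionRing A) (a := 1) (b := ((im π 1 ^ N : Submodule k A) : Set A))
      (by
        rw [IsScalarTower.algebraMap_eq (Bp k e) A (FractionRing A)]
        exact (IsFractionRing.injective A (FractionRing A)).comp
          (FaithfulSMul.algebraMap_injective (Bp k e) A))
      (by rw [finite_of_red (one_mem_im π 1) hgen hred]; exact Set.subset_univ _)
    rw [map_one, Ideal.span_singleton_one] at h5
    rw [eq_top_iff]
    intro z _
    rw [im_pow]
    exact h5 trivial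
  have hyy : Ysp k (yE k e (FractionRing A)) = (Ysp k (yE k e A)).map φ.toLinearMap := by
    rw [Ysp, Ysp, Submodule.map_span]
    congr 1
    rw [Set.image_insert_eq, ← Set.range_comp]
    congr 1
    exact (map_one φ).symm
  refine ⟨⟨?_⟩, ?_, ?_, ?_, ?_, hHF⟩
  · rw [← htop]
    exact span_fg _ ((im_fg π N).map _)
  · intro f
    rw [← hker]
    exact map_eq_zero_iff φ hφ
  · intro i
    rw [him]
    exact ⟨_, hmemV i, rfl⟩
  · rw [him]; exact htop
  · rw [hyy, him, ← Submodule.map_pow _ φ, ← Submodule.map_pow _ φ, ← Submodule.map_mul]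
    exact Submodule.map_mono hred
theorem FD_elim_aux {k : Type} [Field k] [Infinite k] {q : Ideal (MvPolynomial (Fin n) k)} {A : Type} [CommRing A] [IsDomain A]
    [Algebra k A] [Algebra (Bp k e) A] [IsScalarTower k (Bp k e) A] [FaithfulSMul (Bp k e) A]
    (π : MvPolynomial (Fin n) k →ₐ[k] A) (hπ : Function.Surjective π) (hker : ∀ f, π f = 0 ↔ f ∈ q)
    {N : ℕ} (hmemV : ∀ i, yE k e A i ∈ im π 1) (hred : im π 1 ^ (N + 1) ≤ Ysp k (yE k e A) * im π 1 ^ N)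
    (hHF : IsHF q e (Module.finrank (Kp k e) (FractionRing A))) {P : Prop}
    (H : ∀ (F : Type) [Field F] [Algebra k F] [Algebra (Bp k e) F] [Algebra (Kp k e) F]
      [IsScalarTower k (Bp k e) F] [IsScalarTower (Bp k e) (Kp k e) F] (M : ℕ)
      (φ : MvPolynomial (Fin n) k →ₐ[k] F), FD (e := e) q M φ → P) : P := by
  have t1 := FractionRing.isScalarTower_liftAlgebra (Bp k e) (FractionRing A)
  exact H (FractionRing A) N _ (FD_abs π hπ hker hmemV hred hHF)
theorem FD_elim {k : Type} [Field k] [Infinite k] (q : Ideal (MvPolynomial (Fin n) k)) [hp : q.IsPrime] {P : Prop}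
    (H : ∀ (e : ℕ) (F : Type) [Field F] [Algebra k F] [Algebra (Bp k e) F] [Algebra (Kp k e) F]
      [IsScalarTower k (Bp k e) F] [IsScalarTower (Bp k e) (Kp k e) F] (M : ℕ)
      (φ : MvPolynomial (Fin n) k →ₐ[k] F), FD (e := e) q M φ → P) : P := by
  obtain ⟨e, alg, N, h⟩ := exists_Noe q
  have := h.faith
  have := h.tower
  refine FD_elim_aux (e := e) (Ideal.Quotient.mkₐ k q) (Ideal.Quotient.mkₐ_surjective k q)
    (fun f => Ideal.Quotient.eq_zero_iff_mem) (N := N) h.memV h.red h.isHF (H e)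
lemma finrank_map_le_of_ker {E E1 E2 : Type*} [AddCommGroup E] [Module k E] [AddCommGroup E1] [Module k E1]
    [AddCommGroup E2] [Module k E2] (f : E →ₗ[k] E1) (g : E →ₗ[k] E2) (U : Submodule k E) [Module.Finite k U]
    (h : ∀ u ∈ U, f u = 0 → g u = 0) : Module.finrank k (U.map g) ≤ Module.finrank k (U.map f) := by
  have h1 := LinearMap.finrank_range_add_finrank_ker (f.domRestrict U)
  have h2 := LinearMap.finrank_range_add_finrank_ker (g.domRestrict U)
  rw [LinearMap.range_domRestrict] at h1 h2
  have h3 : LinearMap.ker (f.domRestrict U) ≤ LinearMap.ker (g.domRestrict U) := by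
    intro u hu
    exact h u u.2 hu
  have := Submodule.finrank_mono h3
  omega
lemma FD.hf_le {q : Ideal (MvPolynomial (Fin n) k)} {E : Type*} [CommRing E] [Algebra k E]
    (ψ : MvPolynomial (Fin n) k →ₐ[k] E) {m : ℕ} (h : ∀ f ∈ q, f.totalDegree ≤ m → ψ f = 0) :
    Module.finrank k (im ψ m) ≤ hf q m := by
  have := rtd_fin (n := n) (k := k) m
  refine finrank_map_le_of_ker (Ideal.Quotient.mkₐ k q).toLinearMap ψ.toLinearMap _ ?_
  intro u hu h0
  exact h u (Ideal.Quotient.eq_zero_iff_mem.1 h0) ((mem_restrictTotalDegree _ _ _).1 hu)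
lemma FD.hf_eq {q : Ideal (MvPolynomial (Fin n) k)} {M : ℕ} {φ : MvPolynomial (Fin n) k →ₐ[k] F}
    (h : FD (e := e) q M φ) (m : ℕ) : Module.finrank k (im φ m) = hf q m := by
  have := rtd_fin (n := n) (k := k) m
  refine le_antisymm (FD.hf_le _ fun f hq _ => (h.ker f).2 hq) ?_
  refine finrank_map_le_of_ker φ.toLinearMap (Ideal.Quotient.mkₐ k q).toLinearMap _ ?_
  intro u hu h0
  exact Ideal.Quotient.eq_zero_iff_mem.2 ((h.ker u).1 h0)
theorem FD.span_top [Infinite k] {q : Ideal (MvPolynomial (Fin n) k)} {M : ℕ} {φ : MvPolynomial (Fin n) k →ₐ[k] F}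
    (h : FD (e := e) q M φ) {c D i : ℕ} (hg : Module.finrank (Kp k e) F * (D + 1) ^ e ≤ c * hf q D)
    (hi : 2 ^ i * c < 3 ^ i) : Submodule.span (Kp k e) ((im φ (2 ^ i * (D + 1)) : Submodule k F) : Set F) = ⊤ := by
  have := h.fin
  have hinf : Infinite (Kp k e) := Infinite.of_injective _ (FaithfulSMul.algebraMap_injective k (Kp k e))
  set W := Submodule.span (Kp k e) ((im φ (D + 1) : Submodule k F) : Set F) with hW
  have h1 : (1 : F) ∈ W := Submodule.subset_span (one_mem_im φ _)
  have hgen : Algebra.adjoin (Kp k e) (W : Set F) = ⊤ := by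
    have hX : ∀ f, φ f ∈ Algebra.adjoin (Kp k e) (W : Set F) := by
      intro f
      induction f using MvPolynomial.induction_on with
      | C a =>
        exact Algebra.subset_adjoin (Submodule.subset_span (mem_im.2 ⟨C a, by simp, rfl⟩))
      | add f g hf hg => rw [map_add]; exact add_mem hf hg
      | mul_X f i hf =>
        rw [map_mul]
        refine mul_mem hf (Algebra.subset_adjoin (Submodule.subset_span (mem_im.2 ⟨X i, ?_, rfl⟩)))
        rw [totalDegree_X]; omega
    rw [eq_top_iff]
    intro z _
    have hz : z ∈ Submodule.span (Kp k e) ((im φ M : Submodule k F) : Set F) := by rw [h.top]; trivial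
    have : Submodule.span (Kp k e) ((im φ M : Submodule k F) : Set F) ≤ (Algebra.adjoin (Kp k e) (W : Set F)).toSubmodule := by
      rw [Submodule.span_le]
      intro x hx
      obtain ⟨f, -, rfl⟩ := mem_im.1 hx
      exact hX f
    exact this hz
  have hrk : Module.finrank (Kp k e) F ≤ c * Module.finrank (Kp k e) W := by
    have h2 := rk_upper (im φ 1) (im_fg φ 1) (one_mem_im φ 1) h.red D (im φ D) (im_pow φ D).le
    rw [h.hf_eq] at h2
    have h3 : rk k e (im φ D) ≤ Module.finrank (Kp k e) W := by
      apply Submodule.finrank_mono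
      apply Submodule.span_mono
      rw [im_pow, im_pow φ (D + 1)]
      exact pow_mono_of_one (one_mem_im φ 1) (by omega)
    have h4 := choose_le_pow1 D e
    have h5 : Module.finrank (Kp k e) F * (D + 1) ^ e ≤ (c * Module.finrank (Kp k e) W) * (D + 1) ^ e := by
      calc _ ≤ c * hf q D := hg
        _ ≤ c * (rk k e (im φ D) * (D + e).choose e) := by gcongr
        _ ≤ c * (Module.finrank (Kp k e) W * (D + 1) ^ e) := by gcongr
        _ = _ := by ring
    exact Nat.le_of_mul_le_mul_right h5 (by positivity)
  have hpos : 0 < Module.finrank (Kp k e) W := by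
    have : Nontrivial W := ⟨⟨1, h1⟩, 0, fun h => one_ne_zero (congrArg Subtype.val h)⟩
    exact Module.finrank_pos
  have hT := growth_pow i h1 hgen (by
    calc 2 ^ i * Module.finrank (Kp k e) F ≤ 2 ^ i * (c * Module.finrank (Kp k e) W) := by gcongr
      _ = (2 ^ i * c) * Module.finrank (Kp k e) W := by ring
      _ < _ := by gcongr)
  rw [eq_top_iff, ← hT, hW, Submodule.span_pow, Submodule.span_le]
  refine Set.Subset.trans ?_ Submodule.subset_span
  have : im φ (2 ^ i * (D + 1)) = im φ (D + 1) ^ (2 ^ i) := by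
    rw [mul_comm, im_pow, pow_mul, ← im_pow]
  rw [this]
  exact Submodule.pow_subset_pow _
end FDs

section Der
variable {n : ℕ} {k : Type*} [Field k] {e : ℕ} {F : Type*} [Field F] [Algebra k F] [Algebra (Bp k e) F]
  [Algebra (Kp k e) F] [IsScalarTower k (Bp k e) F] [IsScalarTower (Bp k e) (Kp k e) F]
lemma exists_der [CharZero k] (hfin : Module.Finite (Kp k e) F) (v : Fin e → F) :
    ∃ δ : Derivation k F F, ∀ i, δ (yE k e F i) = v i := by
  have hc : CharZero (Kp k e) := charZero_of_injective_algebraMap (FaithfulSMul.algebraMap_injective k (Kp k e))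
  have h1 : Algebra.FormallyEtale (Kp k e) F := Algebra.FormallyEtale.of_isSeparable _ _
  have h2 : Algebra.FormallyEtale (Bp k e) (Kp k e) :=
    Algebra.FormallyEtale.of_isLocalization (nonZeroDivisors (Bp k e))
  have h3 : Algebra.FormallyEtale (Bp k e) F := Algebra.FormallyEtale.comp (Bp k e) (Kp k e) F
  let d : Derivation k (Bp k e) F := mkDerivation k v
  let L : TensorProduct (Bp k e) F (Ω[Bp k e⁄k]) →ₗ[F] F := d.liftKaehlerDifferential.liftBaseChange F
  let L2 : Ω[F⁄k] →ₗ[F] F :=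
    L ∘ₗ (KaehlerDifferential.tensorKaehlerEquivOfFormallyEtale k (Bp k e) F).symm.toLinearMap
  refine ⟨L2.compDer (KaehlerDifferential.D k F), fun i => ?_⟩
  have : yE k e F i = algebraMap (Bp k e) F (X i) := rfl
  rw [this]
  change L ((KaehlerDifferential.tensorKaehlerEquivOfFormallyEtale k (Bp k e) F).symm
    (KaehlerDifferential.D k F (algebraMap (Bp k e) F (X i)))) = v i
  rw [KaehlerDifferential.tensorKaehlerEquivOfFormallyEtale_symm_D_algebraMap]
  simp [L, d, mkDerivation_X]
lemma grad_formula {E : Type*} [CommRing E] [Algebra k E] (φ : MvPolynomial (Fin n) k →ₐ[k] E)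
    (Δ : MvPolynomial (Fin n) k → E) (h0 : ∀ a, Δ (C a) = 0) (hadd : ∀ f g, Δ (f + g) = Δ f + Δ g)
    (hmul : ∀ f g, Δ (f * g) = φ f * Δ g + φ g * Δ f) (f : MvPolynomial (Fin n) k) :
    Δ f = ∑ l, φ (pderiv l f) * Δ (X l) := by
  induction f using MvPolynomial.induction_on with
  | C a => simp [h0]
  | add f g hf hg => simp only [hadd, hf, hg, map_add, add_mul, Finset.sum_add_distrib]
  | mul_X f i hf =>
    rw [hmul, hf]
    simp only [Derivation.leibniz, smul_eq_mul, map_add, map_mul, pderiv_X, add_mul, Finset.sum_add_distrib]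
    congr 1
    · simp [Pi.single_apply, Finset.sum_ite_eq, apply_ite φ]
    · rw [Finset.mul_sum]; exact Finset.sum_congr rfl fun l _ => by ring
def dualMap (φ : MvPolynomial (Fin n) k →ₐ[k] F) (c : Fin n → F) : MvPolynomial (Fin n) k →ₐ[k] DualNumber F :=
  aeval (fun l => TrivSqZeroExt.inl (φ (X l)) + TrivSqZeroExt.inr (c l))
lemma dualMap_fst (φ : MvPolynomial (Fin n) k →ₐ[k] F) (c : Fin n → F) (f : MvPolynomial (Fin n) k) :
    (dualMap φ c f).fst = φ f := by
  have : (TrivSqZeroExt.fstHom k F F).comp (dualMap φ c) = φ := by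
    apply MvPolynomial.algHom_ext
    intro i
    simp [dualMap]
  exact AlgHom.congr_fun this f
lemma dualMap_snd (φ : MvPolynomial (Fin n) k →ₐ[k] F) (c : Fin n → F) (f : MvPolynomial (Fin n) k) :
    (dualMap φ c f).snd = ∑ l, φ (pderiv l f) * c l := by
  rw [grad_formula φ (fun f => (dualMap φ c f).snd)]
  · simp [dualMap]
  · intro a
    have : dualMap φ c (C a) = algebraMap k _ a := (dualMap φ c).commutes a
    simp only [this]
    rw [TrivSqZeroExt.algebraMap_eq_inl']; simp
  · intro f g; simp
  · intro f g
    simp [dualMap_fst, mul_comm]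
lemma der_formula (φ : MvPolynomial (Fin n) k →ₐ[k] F) (δ : Derivation k F F) (f : MvPolynomial (Fin n) k) :
    δ (φ f) = ∑ l, φ (pderiv l f) * δ (φ (X l)) := by
  apply grad_formula φ (fun f => δ (φ f))
  · intro a
    have : φ (C a) = algebraMap k _ a := φ.commutes a
    simp [this]
  · simp
  · simp
lemma choose_lt_two {e a : ℕ} (ha : 1 ≤ a) : (a + 2 * e * a + e).choose e < 2 * (2 * e * a + e).choose e := by
  rcases Nat.eq_zero_or_pos e with rfl | he
  · simp
  have h1 : ∀ s j : ℕ, (a + s + 1).ascFactorial j * s ^ j ≤ (s + a) ^ j * (s + 1).ascFactorial j := by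
    intro s j
    induction j with
    | zero => simp
    | succ j ih =>
      rw [Nat.ascFactorial_succ, Nat.ascFactorial_succ, pow_succ, pow_succ]
      calc (a + s + 1 + j) * (a + s + 1).ascFactorial j * (s ^ j * s)
          = ((a + s + 1 + j) * s) * ((a + s + 1).ascFactorial j * s ^ j) := by ring
        _ ≤ ((s + a) * (s + 1 + j)) * ((s + a) ^ j * (s + 1).ascFactorial j) :=
            Nat.mul_le_mul (by nlinarith) ih
        _ = _ := by ring
  have h2 : (2 * e + 1) ^ e < 2 * (2 * e) ^ e := by
    have hb := one_add_mul_le_pow (a := -(1 / (2 * (e : ℝ) + 1))) (by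
      rw [neg_le_neg_iff, div_le_iff₀ (by positivity)]; linarith) e
    have hp : (0 : ℝ) < 2 * e + 1 := by positivity
    have e1 : 1 + -(1 / (2 * (e : ℝ) + 1)) = 2 * e / (2 * e + 1) := by field_simp; ring
    rw [e1, div_pow, le_div_iff₀ (by positivity)] at hb
    have e2 : (1 : ℝ) / 2 < 1 + e * -(1 / (2 * (e : ℝ) + 1)) := by
      have : 1 + e * -(1 / (2 * (e : ℝ) + 1)) = (e + 1) / (2 * e + 1) := by field_simp; ring
      rw [this, lt_div_iff₀ hp]; linarith
    have e3 : (1 : ℝ) / 2 * (2 * e + 1) ^ e < (2 * e) ^ e := lt_of_lt_of_le (by gcongr) hb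
    have e4 : ((2 * e + 1 : ℕ) : ℝ) ^ e < ((2 * (2 * e) ^ e : ℕ) : ℝ) := by push_cast; linarith
    exact_mod_cast e4
  have h3 := h1 (2 * e * a) e
  have q1 := Nat.ascFactorial_eq_factorial_mul_choose (a + 2 * e * a) e
  have q2 := Nat.ascFactorial_eq_factorial_mul_choose (2 * e * a) e
  rw [q1, q2] at h3
  have hpos : 0 < (2 * e * a) ^ e * e.factorial := by positivity
  have hc : 0 < (2 * e * a + e).choose e := Nat.choose_pos (by omega)
  have h4 : (2 * e * a + a) ^ e < 2 * (2 * e * a) ^ e := by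
    rw [show 2 * e * a + a = (2 * e + 1) * a by ring, mul_pow, mul_pow]
    have : 0 < a ^ e := by positivity
    nlinarith
  refine lt_of_mul_lt_mul_left (a := (2 * e * a) ^ e * e.factorial) ?_ (Nat.zero_le _)
  calc (2 * e * a) ^ e * e.factorial * (a + 2 * e * a + e).choose e
      = e.factorial * (a + 2 * e * a + e).choose e * (2 * e * a) ^ e := by ring
    _ ≤ _ := h3
    _ < (2 * (2 * e * a) ^ e) * (e.factorial * (2 * e * a + e).choose e) :=
        Nat.mul_lt_mul_of_pos_right h4 (Nat.mul_pos (Nat.factorial_pos e) hc)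
    _ = _ := by ring
def gv {E : Type*} [CommRing E] [Algebra k E] (φ : MvPolynomial (Fin n) k →ₐ[k] E) (f : MvPolynomial (Fin n) k) : Fin n → E := fun l => φ (pderiv l f)
lemma finrank_dual [Module.Finite (Kp k e) F] :
    Module.finrank (Kp k e) (DualNumber F) = 2 * Module.finrank (Kp k e) F := by
  have : Module.finrank (Kp k e) (DualNumber F) = Module.finrank (Kp k e) (F × F) := rfl
  rw [this, Module.finrank_prod]; ring
theorem grad_span [CharZero k] [Infinite k] {q : Ideal (MvPolynomial (Fin n) k)} {M : ℕ}
    {φ : MvPolynomial (Fin n) k →ₐ[k] F}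
    (h : FD (e := e) q M φ) {c D i : ℕ} (hg : Module.finrank (Kp k e) F * (D + 1) ^ e ≤ c * hf q D)
    (hi : 2 ^ i * c < 3 ^ i) {g : MvPolynomial (Fin n) k} (hgq : g ∈ q) :
    gv φ g ∈ Submodule.span F (gv φ '' {f | f ∈ q ∧ f.totalDegree ≤ 3 * (2 * n + 1) * (2 ^ i * (D + 1))}) := by
  by_contra hcon
  have hfin := h.fin
  obtain ⟨l, hl2, hl1⟩ := Submodule.exists_le_ker_of_notMem hcon
  let c0 : Fin n → F := fun m => l (Pi.single m 1)
  have hlc : ∀ v, l v = ∑ m, v m * c0 m := by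
    intro v
    conv_lhs => rw [← Finset.univ_sum_single v]
    rw [map_sum]
    refine Finset.sum_congr rfl fun m _ => ?_
    have : Pi.single (M := fun _ => F) m (v m) = v m • Pi.single (M := fun _ => F) m 1 := by
      rw [← Pi.single_smul]; simp
    rw [this, map_smul]; rfl
  choose Y hY1 hY2 using fun i => mem_im.1 (h.memV i)
  obtain ⟨δ, hδ⟩ := exists_der hfin (fun i => ∑ m, φ (pderiv m (Y i)) * c0 m)
  let c' : Fin n → F := fun m => c0 m - δ (φ (X m))
  let ψ := dualMap φ c'
  have hψ2 : ∀ f, (ψ f).snd = l (gv φ f) - δ (φ f) := by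
    intro f
    rw [dualMap_snd, hlc, der_formula, ← Finset.sum_sub_distrib]
    exact Finset.sum_congr rfl fun m _ => by simp only [c', gv]; ring
  have hψ1 : ∀ f, (ψ f).fst = φ f := dualMap_fst φ c'
  set m0 := 2 ^ i * (D + 1) with hm0
  have hm0p : 1 ≤ m0 := Nat.mul_pos (by positivity) (by omega)
  set L := 3 * (2 * n + 1) * m0 with hL
  have hq0 : ∀ f ∈ q, f.totalDegree ≤ L → ψ f = 0 := by
    intro f hfq hd
    ext
    · rw [hψ1, (h.ker f).2 hfq]; rfl
    · rw [hψ2, (h.ker f).2 hfq, map_zero, sub_zero]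
      exact hl1 (Submodule.subset_span ⟨f, ⟨hfq, hd⟩, rfl⟩)
  have hg0 : (ψ g).fst = 0 := by rw [hψ1, (h.ker g).2 hgq]
  have hg1 : (ψ g).snd ≠ 0 := by
    rw [hψ2, (h.ker g).2 hgq, map_zero, sub_zero]; exact hl2
  have hyψ : ∀ i, yE k e (DualNumber F) i = ψ (Y i) := by
    intro j
    have e1 : yE k e (DualNumber F) j = algebraMap (Bp k e) (DualNumber F) (X j) := rfl
    have e2 : yE k e F j = algebraMap (Bp k e) F (X j) := rfl
    rw [e1, TrivSqZeroExt.algebraMap_eq_inl', ← e2]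
    ext
    · rw [hψ1, hY2]; rfl
    · rw [hψ2, hY2, hδ, hlc]; simp [gv]
  have htop := h.span_top hg hi
  rw [← hm0] at htop
  let T : ℕ → Submodule (Kp k e) (DualNumber F) := fun j =>
    Submodule.span (Kp k e) ((im ψ (j * m0) : Submodule k (DualNumber F)) : Set (DualNumber F))
  have hTmul : ∀ a b x y, x ∈ T a → y ∈ T b → x * y ∈ T (a + b) := by
    intro a b x y hx hy
    have h1 := Submodule.mul_mem_mul hx hy
    rw [Submodule.span_mul_span] at h1
    refine Submodule.span_mono ?_ h1
    rw [add_mul, im_pow, im_pow ψ (b * m0), im_pow ψ (a * m0 + b * m0), pow_add]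
    exact Submodule.mul_subset_mul _ _
  have hTmono : ∀ a b, a ≤ b → T a ≤ T b := by
    intro a b hab
    apply Submodule.span_mono
    intro x hx
    obtain ⟨f, h1, h2⟩ := mem_im.1 hx
    exact mem_im.2 ⟨f, h1.trans (Nat.mul_le_mul_right _ hab), h2⟩
  let π : DualNumber F →ₗ[Kp k e] F := (TrivSqZeroExt.fstHom (Kp k e) F F).toLinearMap
  have hπT : (T 1).map π = ⊤ := by
    rw [Submodule.map_span, ← htop]
    congr 1
    ext x
    constructor
    · rintro ⟨_, hy, rfl⟩
      obtain ⟨f, h1, rfl⟩ := mem_im.1 hy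
      exact mem_im.2 ⟨f, by simpa using h1, (hψ1 f).symm⟩
    · intro hx
      obtain ⟨f, h1, rfl⟩ := mem_im.1 hx
      exact ⟨ψ f, mem_im.2 ⟨f, by simpa using h1, rfl⟩, hψ1 f⟩
  have hfinD : Module.Finite (Kp k e) (DualNumber F) := inferInstanceAs (Module.Finite (Kp k e) (F × F))
  obtain ⟨x, hx, hx1, hx2⟩ : ∃ x ∈ T 2, x.fst = 0 ∧ x.snd ≠ 0 := by
    by_contra! hno
    have hinj : Function.Injective (π.domRestrict (T 2)) := by
      rw [← LinearMap.ker_eq_bot, eq_bot_iff]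
      rintro ⟨x, hx⟩ hx0
      have h0 : x.fst = 0 := hx0
      exact Subtype.ext (TrivSqZeroExt.ext h0 (hno x hx h0))
    have e1 : Module.finrank (Kp k e) (T 2) ≤ Module.finrank (Kp k e) F := LinearMap.finrank_le_finrank_of_injective hinj
    have e2 : Module.finrank (Kp k e) F ≤ Module.finrank (Kp k e) (T 1) := by
      rw [← finrank_top (Kp k e) F, ← hπT]; exact Submodule.finrank_map_le _ _
    have e3 : T 1 = T 2 := Submodule.eq_of_le_of_finrank_le (hTmono 1 2 (by omega)) (e1.trans e2)
    have hall : ∀ f, ψ f ∈ T 1 := by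
      intro f
      induction f using MvPolynomial.induction_on with
      | C a => exact Submodule.subset_span (mem_im.2 ⟨C a, by simp, rfl⟩)
      | add f g hf hg => rw [map_add]; exact add_mem hf hg
      | mul_X f i hf =>
        rw [map_mul, e3]
        refine hTmul 1 1 _ _ hf (Submodule.subset_span (mem_im.2 ⟨X i, ?_, rfl⟩))
        rw [totalDegree_X]; omega
    exact hg1 (hno (ψ g) (hTmono 1 2 (by omega) (hall g)) hg0)
  have hT3 : T 3 = ⊤ := by
    have hsurj : ∀ u : F, ∃ t ∈ T 1, t.fst = u := by
      intro u
      have : u ∈ (T 1).map π := by rw [hπT]; trivial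
      obtain ⟨t, h1, h2⟩ := this
      exact ⟨t, h1, h2⟩
    have hnil : ∀ u : F, TrivSqZeroExt.inr u ∈ T 3 := by
      intro u
      obtain ⟨t, ht, htu⟩ := hsurj (u * x.snd⁻¹)
      have h3 := hTmul 1 2 t x ht hx
      have h4 : t * x = TrivSqZeroExt.inr u := by
        ext
        · simp [hx1]
        · simp [hx1, htu, hx2]
      rwa [h4] at h3
    rw [eq_top_iff]
    rintro z -
    obtain ⟨t, ht, htz⟩ := hsurj z.fst
    have : z = t + TrivSqZeroExt.inr (z.snd - t.snd) := by
      ext <;> simp [htz]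
    rw [this]
    exact add_mem (hTmono 1 3 (by omega) ht) (hnil _)
  have hlow := rk_lower (k := k) (e := e) (im ψ 1) (im_fg ψ 1) (by
    rw [Ysp, Submodule.span_le]
    rintro z (rfl | ⟨j, rfl⟩)
    · exact one_mem_im ψ 1
    · rw [hyψ]; exact mem_im.2 ⟨Y j, hY1 j, rfl⟩) (3 * m0) (2 * e * (3 * m0))
  rw [← im_pow, ← im_pow] at hlow
  have hen := h.isHF.le_n
  have hLL : 3 * m0 + 2 * e * (3 * m0) ≤ L := by rw [hL]; nlinarith
  have hrk : rk k e (im ψ (3 * m0)) = 2 * Module.finrank (Kp k e) F := by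
    rw [rk, show Submodule.span (Kp k e) ((im ψ (3 * m0) : Submodule k (DualNumber F)) : Set (DualNumber F)) = ⊤ from hT3, finrank_top, finrank_dual]
  rw [hrk] at hlow
  have hup := (FD.hf_le ψ fun f h1 h2 => hq0 f h1 (h2.trans hLL)).trans (h.isHF.upper _)
  have hch := choose_lt_two (e := e) (a := 3 * m0) (by omega)
  have hN := h.isHF.pos
  have := hlow.trans hup
  nlinarith
end Der

section Der
variable {n : ℕ} {k : Type*} [Field k] {e : ℕ} {F : Type*} [Field F] [Algebra k F] [Algebra (Bp k e) F]
  [Algebra (Kp k e) F] [IsScalarTower k (Bp k e) F] [IsScalarTower (Bp k e) (Kp k e) F]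
lemma td_sum_le {ι σ : Type*} {K : Type*} [CommRing K] (s : Finset ι) (f : ι → MvPolynomial σ K) {L : ℕ} (h : ∀ i ∈ s, (f i).totalDegree ≤ L) :
    (∑ i ∈ s, f i).totalDegree ≤ L :=
  (totalDegree_finsetSum s f).trans (Finset.sup_le h)
lemma td_det_le {σ : Type*} {K : Type*} [CommRing K] {r L : ℕ} (A : Matrix (Fin r) (Fin r) (MvPolynomial σ K)) (h : ∀ i j, (A i j).totalDegree ≤ L) :
    A.det.totalDegree ≤ r * L := by
  rw [Matrix.det_apply]
  refine td_sum_le _ _ fun s _ => ?_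
  have : (∏ i, A (s i) i).totalDegree ≤ r * L := by
    refine (totalDegree_finsetProd _ _).trans ((Finset.sum_le_sum fun i _ => h (s i) i).trans ?_)
    simp
  rcases Int.units_eq_one_or (Equiv.Perm.sign s) with h | h <;> rw [h]
  · simpa using this
  · simpa using this
lemma td_adj_le {σ : Type*} {K : Type*} [CommRing K] {r L : ℕ} (A : Matrix (Fin r) (Fin r) (MvPolynomial σ K)) (h : ∀ i j, (A i j).totalDegree ≤ L)
    (i j) : (A.adjugate i j).totalDegree ≤ r * L := by
  rw [Matrix.adjugate_apply]
  apply td_det_le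
  intro a b
  rw [Matrix.updateRow_apply]
  split_ifs
  · rw [Pi.single_apply]; split_ifs <;> simp
  · exact h a b
lemma td_pderiv_le {σ : Type*} {K : Type*} [CommRing K] (f : MvPolynomial σ K) (i : σ) : (pderiv i f).totalDegree ≤ f.totalDegree := by
  classical
  rw [f.as_sum, map_sum]
  conv_rhs => rw [← f.as_sum]
  refine td_sum_le _ _ fun s hs => ?_
  rw [pderiv_monomial]
  refine (totalDegree_monomial_le _ _).trans ?_
  refine le_trans ?_ (le_totalDegree hs)
  have : s - Finsupp.single i 1 ≤ s := tsub_le_self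
  exact Finsupp.degree_mono this
lemma exists_minor {r n : ℕ} (A : Matrix (Fin r) (Fin n) F) (hA : LinearIndependent F A.row) :
    ∃ I : Fin r → Fin n, Function.Injective I ∧ (A.submatrix id I).det ≠ 0 := by
  have hrk : A.rank = r := by rw [hA.rank_matrix]; simp
  have h1 : Submodule.span F (range A.col) = ⊤ := by
    apply Submodule.eq_top_of_finrank_eq
    rw [← Matrix.rank_eq_finrank_span_cols, hrk]; simp
  obtain ⟨b, hb1, -, hb3⟩ := Submodule.exists_fun_fin_finrank_span_eq F (range A.col)
  have hr : Module.finrank F (Submodule.span F (range A.col)) = r := by rw [h1]; simp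
  choose I hI using hb1
  have hli : LinearIndependent F fun s : Fin r => A.col (I (Fin.cast hr.symm s)) := by
    simp only [hI]
    exact hb3.comp _ (Fin.cast_injective _)
  refine ⟨fun s => I (Fin.cast hr.symm s), ?_, ?_⟩
  · intro s t hst
    exact hli.injective (congrArg A.col hst)
  · rw [← isUnit_iff_ne_zero, ← Matrix.isUnit_iff_isUnit_det, ← Matrix.linearIndependent_cols_iff_isUnit]
    exact hli
theorem jac_aux [CharZero k] [Infinite k] {q : Ideal (MvPolynomial (Fin n) k)} {M : ℕ}
    {φ : MvPolynomial (Fin n) k →ₐ[k] F}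
    (h : FD (e := e) q M φ) {c D i : ℕ} (hg : Module.finrank (Kp k e) F * (D + 1) ^ e ≤ c * hf q D)
    (hi : 2 ^ i * c < 3 ^ i) :
    ∃ (lam : Fin e → Fin n) (Θ : Fin e → Fin n → MvPolynomial (Fin n) k) (J : MvPolynomial (Fin n) k),
      Function.Injective lam ∧ J.totalDegree ≤ (n + 1) * (3 * (2 * n + 1) * (2 ^ i * (D + 1))) ∧
      (∀ j m, (Θ j m).totalDegree ≤ (n + 1) * (3 * (2 * n + 1) * (2 ^ i * (D + 1)))) ∧ J ∉ q ∧
      (∀ i j, Θ i (lam j) = if i = j then J else 0) ∧ (∀ g ∈ q, ∀ i, ∑ m, Θ i m * pderiv m g ∈ q) := by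
  classical
  have hfin := h.fin
  set L := 3 * (2 * n + 1) * (2 ^ i * (D + 1)) with hL
  set s0 : Set (Fin n → F) := gv φ '' {f | f ∈ q ∧ f.totalDegree ≤ L} with hs0
  set G := Submodule.span F s0 with hG
  have hgG : ∀ g ∈ q, gv φ g ∈ G := fun g hgq => grad_span h hg hi hgq
  have hdim : Module.finrank F G + e ≤ n := by
    choose δ hδ using fun j : Fin e => exists_der (k := k) (F := F) hfin (Pi.single j 1)
    let Λ : (Fin n → F) →ₗ[F] (Fin e → F) := LinearMap.pi fun j => Fintype.linearCombination F (fun m => δ j (φ (X m)))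
    have hΛ : ∀ f, Λ (gv φ f) = fun j => δ j (φ f) := by
      intro f; ext j
      rw [der_formula]; simp [Λ, Fintype.linearCombination_apply, gv]
    have hker : G ≤ LinearMap.ker Λ := by
      rw [hG, Submodule.span_le]
      rintro _ ⟨f, ⟨hf1, _⟩, rfl⟩
      have := hΛ f
      rw [(h.ker f).2 hf1] at this
      change Λ _ = 0
      rw [this]; ext; simp
    have hsurj : LinearMap.range Λ = ⊤ := by
      rw [eq_top_iff, ← (Pi.basisFun F (Fin e)).span_eq, Submodule.span_le]
      rintro _ ⟨j, rfl⟩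
      obtain ⟨Y, -, hY⟩ := mem_im.1 (h.memV j)
      refine ⟨gv φ Y, ?_⟩
      rw [hΛ, hY]; ext m
      rw [hδ]; simp [Pi.single_apply, eq_comm]
    have h1 := Λ.finrank_range_add_finrank_ker
    rw [hsurj, finrank_top] at h1
    have h2 := Submodule.finrank_mono hker
    simp at h1; omega
  obtain ⟨r, hr, b, hb1, hb2, hb3⟩ : ∃ r, Module.finrank F G = r ∧ ∃ b : Fin r → (Fin n → F), (∀ i, b i ∈ s0) ∧
      Submodule.span F (range b) = Submodule.span F s0 ∧ LinearIndependent F b :=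
    ⟨_, rfl, Submodule.exists_fun_fin_finrank_span_eq F s0⟩
  choose f hf1 hf2 using hb1
  let A0 : Matrix (Fin r) (Fin n) F := fun i m => b i m
  obtain ⟨I, hI, hdet⟩ := exists_minor A0 hb3
  let A : Matrix (Fin r) (Fin r) (MvPolynomial (Fin n) k) := fun s t => pderiv (I t) (f s)
  have hAd : ∀ s t, (A s t).totalDegree ≤ L := fun s t => (td_pderiv_le _ _).trans (hf1 s).2
  let J := A.det
  have hrn : r ≤ n := by omega
  have hJd : J.totalDegree ≤ n * L := (td_det_le A hAd).trans (Nat.mul_le_mul_right _ hrn)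
  have hJq : J ∉ q := by
    rw [← h.ker]
    have : φ J = (A0.submatrix id I).det := by
      change φ.toRingHom A.det = _
      rw [RingHom.map_det]
      congr 1; ext s t
      change φ (pderiv (I t) (f s)) = b s (I t)
      rw [← hf2]; rfl
    rw [this]; exact hdet
  obtain ⟨lam, hlam, hlamI⟩ : ∃ lam : Fin e → Fin n, Function.Injective lam ∧ ∀ j s, lam j ≠ I s := by
    have hc : e ≤ (Finset.univ \ Finset.univ.image I).card := by
      rw [Finset.card_sdiff_of_subset (Finset.subset_univ _), Finset.card_image_of_injective _ hI]; simp; omega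
    obtain ⟨t, ht, htc⟩ := Finset.exists_subset_card_eq hc
    refine ⟨fun j => t.orderEmbOfFin htc j, (t.orderEmbOfFin htc).injective, fun j s hjs => ?_⟩
    have := ht (t.orderEmbOfFin_mem htc j)
    simp [hjs] at this
  let w : Fin e → Fin r → MvPolynomial (Fin n) k := fun i => A.adjugate.mulVec fun s => pderiv (lam i) (f s)
  have hwd : ∀ i t, (w i t).totalDegree ≤ (n + 1) * L := by
    intro i t
    refine td_sum_le _ _ fun s _ => (totalDegree_mul _ _).trans ?_
    have h1 := td_adj_le A hAd t s
    have h2 := (td_pderiv_le (f s) (lam i)).trans (hf1 s).2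
    nlinarith
  let Θ : Fin e → Fin n → MvPolynomial (Fin n) k := fun i m => (if m = lam i then J else 0) - ∑ t, if m = I t then w i t else 0
  refine ⟨lam, Θ, J, hlam, by nlinarith, ?_, hJq, ?_, ?_⟩
  · intro i m
    refine (totalDegree_sub _ _).trans (max_le ?_ (td_sum_le _ _ fun t _ => ?_))
    · split_ifs
      · nlinarith
      · simp
    · split_ifs
      · exact hwd _ _
      · simp
  · intro i j
    simp only [Θ, hlamI, if_false, Finset.sum_const_zero, sub_zero, hlam.eq_iff, eq_comm]
  · intro g hgq i
    have key : ∀ g, ∑ m, Θ i m * pderiv m g = J * pderiv (lam i) g - ∑ t, w i t * pderiv (I t) g := by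
      intro g
      simp only [Θ, sub_mul, Finset.sum_sub_distrib, ite_mul, zero_mul, Finset.sum_mul]
      congr 1
      · simp
      · rw [Finset.sum_comm]; simp
    have hzero : ∀ s, ∑ m, Θ i m * pderiv m (f s) = 0 := by
      intro s
      rw [key]
      have : A.mulVec (w i) s = J * pderiv (lam i) (f s) := by
        simp only [w, Matrix.mulVec_mulVec, Matrix.mul_adjugate, Matrix.smul_mulVec, Matrix.one_mulVec]; rfl
      rw [← this, Matrix.mulVec, dotProduct]
      rw [sub_eq_zero]
      exact Finset.sum_congr rfl fun t _ => mul_comm _ _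
    rw [← h.ker]
    let ℓ : (Fin n → F) →ₗ[F] F := Fintype.linearCombination F (fun m => φ (Θ i m))
    have hℓ : ∀ g, ℓ (gv φ g) = φ (∑ m, Θ i m * pderiv m g) := by
      intro g
      simp [ℓ, Fintype.linearCombination_apply, gv, mul_comm]
    rw [← hℓ]
    have hGk : G ≤ LinearMap.ker ℓ := by
      rw [hG, ← hb2, Submodule.span_le]
      rintro _ ⟨s, rfl⟩
      change ℓ _ = 0
      rw [← hf2, hℓ, hzero, map_zero]
    exact hGk (hgG g hgq)
end Der
theorem jac {n : ℕ} {k : Type} [Field k] [CharZero k] [Infinite k] {q : Ideal (MvPolynomial (Fin n) k)} [hq : q.IsPrime]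
    {e N c D i : ℕ} (h : IsHF q e N) (hg : N * (D + 1) ^ e ≤ c * hf q D) (hi : 2 ^ i * c < 3 ^ i) :
    ∃ (lam : Fin e → Fin n) (Θ : Fin e → Fin n → MvPolynomial (Fin n) k) (J : MvPolynomial (Fin n) k),
      Function.Injective lam ∧ J.totalDegree ≤ (n + 1) * (3 * (2 * n + 1) * (2 ^ i * (D + 1))) ∧
      (∀ j m, (Θ j m).totalDegree ≤ (n + 1) * (3 * (2 * n + 1) * (2 ^ i * (D + 1)))) ∧ J ∉ q ∧
      (∀ i j, Θ i (lam j) = if i = j then J else 0) ∧ (∀ g ∈ q, ∀ i, ∑ m, Θ i m * pderiv m g ∈ q) := by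
  apply FD_elim q
  intro e' F _ _ _ _ _ _ M φ hFD
  obtain ⟨rfl, rfl⟩ := h.unique hFD.isHF
  exact jac_aux hFD hg hi

section Flow
variable {n : ℕ}
def ZR (q : Ideal (MvPolynomial (Fin n) ℝ)) : Set (Fin n → ℝ) := {x | ∀ f ∈ q, eval x f = 0}
lemma hasDerivWithinAt_eval {γ : ℝ → Fin n → ℝ} {v : Fin n → ℝ} {t : ℝ} {s : Set ℝ} (h : HasDerivWithinAt γ v s t)
    (f : MvPolynomial (Fin n) ℝ) :
    HasDerivWithinAt (fun t => eval (γ t) f) (∑ m, eval (γ t) (pderiv m f) * v m) s t := by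
  rw [hasDerivWithinAt_pi] at h
  induction f using MvPolynomial.induction_on with
  | C a => simpa using hasDerivWithinAt_const t s a
  | add f g hf hg =>
    simp only [map_add, add_mul, Finset.sum_add_distrib]
    exact hf.add hg
  | mul_X f i hf =>
    have e0 : (fun t => eval (γ t) (f * X i)) = fun t => eval (γ t) f * γ t i := by ext t; simp
    rw [e0]
    convert! hf.mul (h i) using 1
    simp only [Derivation.leibniz, smul_eq_mul, map_add, map_mul, pderiv_X, add_mul, Finset.sum_add_distrib, eval_X]
    rw [add_comm]
    congr 1
    · rw [Finset.sum_mul]; exact Finset.sum_congr rfl fun _ _ => by ring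
    · simp [Pi.single_apply, apply_ite]
lemma continuous_eval' (f : MvPolynomial (Fin n) ℝ) : Continuous fun x : Fin n → ℝ => eval x f := f.continuous_eval
lemma contDiff_eval (f : MvPolynomial (Fin n) ℝ) : ContDiff ℝ 1 fun x : Fin n → ℝ => eval x f := by
  induction f using MvPolynomial.induction_on with
  | C a => simpa using contDiff_const
  | add f g hf hg => simpa using hf.add hg
  | mul_X f i hf => simpa using hf.mul (contDiff_apply ℝ ℝ i)
theorem flow {q : Ideal (MvPolynomial (Fin n) ℝ)} (Θ : Fin n → MvPolynomial (Fin n) ℝ)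
    (hΘ : ∀ g ∈ q, ∑ m, Θ m * pderiv m g ∈ q) {z : Fin n → ℝ} (hz : z ∈ ZR q) :
    ∃ ε > 0, ∃ γ : ℝ → Fin n → ℝ, γ 0 = z ∧ (∀ t ∈ Ico (0 : ℝ) ε, γ t ∈ ZR q) ∧
      HasDerivAt γ (fun m => eval z (Θ m)) 0 := by
  let v : (Fin n → ℝ) → (Fin n → ℝ) := fun x m => eval x (Θ m)
  have hv : ContDiff ℝ 1 v := contDiff_pi.2 fun m => contDiff_eval _
  obtain ⟨γ, hγ0, r, hr, hγ⟩ :=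
    ContDiffAt.exists_forall_mem_closedBall_exists_eq_forall_mem_Ioo_hasDerivAt₀ (hv.contDiffAt (x := z)) 0
  simp only [zero_sub, zero_add] at hγ
  obtain ⟨G, hG⟩ := (inferInstance : IsNoetherianRing (MvPolynomial (Fin n) ℝ)).noetherian q
  have hmem : ∀ g : G, ∃ h : G → MvPolynomial (Fin n) ℝ, ∑ m, Θ m * pderiv m (g : MvPolynomial (Fin n) ℝ) = ∑ j, h j * (j : MvPolynomial (Fin n) ℝ) := by
    intro g
    have h1 := hΘ g (hG ▸ Ideal.subset_span g.2)
    rw [← hG] at h1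
    obtain ⟨h, hh⟩ := Submodule.mem_span_finset'.1 h1
    exact ⟨h, by simpa using hh.symm⟩
  choose h hh using hmem
  have hcont : ContinuousOn γ (Icc 0 (r / 2)) := fun t ht => (hγ t ⟨by linarith [ht.1], by linarith [ht.2]⟩).continuousAt.continuousWithinAt
  obtain ⟨K, hK⟩ : ∃ K : ℝ, ∀ t ∈ Icc 0 (r / 2), ∀ g : G, ∑ j, |eval (γ t) (h g j)| ≤ K := by
    have hc : ContinuousOn (fun t => ∑ g : G, ∑ j, |eval (γ t) (h g j)|) (Icc 0 (r / 2)) := by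
      refine continuousOn_finsetSum _ fun g _ => continuousOn_finsetSum _ fun j _ => ?_
      exact ((continuous_eval' _).comp_continuousOn hcont).abs
    obtain ⟨K, hK⟩ := isCompact_Icc.bddAbove_image hc
    refine ⟨K, fun t ht g => le_trans ?_ (hK ⟨t, ht, rfl⟩)⟩
    exact Finset.single_le_sum (f := fun g => ∑ j, |eval (γ t) (h g j)|) (fun i _ => Finset.sum_nonneg fun _ _ => abs_nonneg _) (Finset.mem_univ g)
  let y : ℝ → G → ℝ := fun t g => eval (γ t) (g : MvPolynomial (Fin n) ℝ)
  let y' : ℝ → G → ℝ := fun t g => ∑ j, eval (γ t) (h g j) * y t j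
  have hy : ∀ t ∈ Icc 0 (r / 2), y t = 0 := by
    refine eq_zero_of_abs_deriv_le_mul_abs_self_of_eq_zero_right (f' := y') (K := K) ?_ ?_ ?_ ?_
    · exact continuousOn_pi.2 fun g => (continuous_eval' _).comp_continuousOn hcont
    · intro t ht
      refine hasDerivWithinAt_pi.2 fun g => ?_
      have h1 := hasDerivWithinAt_eval ((hγ t ⟨by linarith [ht.1], by linarith [ht.2]⟩).hasDerivWithinAt (s := Ici t)) (g : MvPolynomial (Fin n) ℝ)
      convert! h1 using 1
      have h2 := congrArg (eval (γ t)) (hh g)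
      simp only [map_sum, map_mul] at h2
      simp only [y', y, v]
      rw [← h2]
      exact Finset.sum_congr rfl fun _ _ => mul_comm _ _
    · ext g
      simp only [y, hγ0]
      exact hz _ (hG ▸ Ideal.subset_span g.2)
    · intro t ht
      have hKt := hK t (Ico_subset_Icc_self ht)
      by_cases hne : Nonempty G
      · refine (pi_norm_le_iff_of_nonempty _).2 fun g => ?_
        calc ‖y' t g‖ ≤ ∑ j, ‖eval (γ t) (h g j) * y t j‖ := norm_sum_le _ _
          _ ≤ ∑ j, |eval (γ t) (h g j)| * ‖y t‖ := by
              refine Finset.sum_le_sum fun j _ => ?_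
              rw [norm_mul]
              exact mul_le_mul_of_nonneg_left (norm_le_pi_norm _ _) (abs_nonneg _)
          _ = (∑ j, |eval (γ t) (h g j)|) * ‖y t‖ := by rw [Finset.sum_mul]
          _ ≤ _ := mul_le_mul_of_nonneg_right (hKt g) (norm_nonneg _)
      · have := not_nonempty_iff.1 hne
        simp [Subsingleton.elim (y' t) 0, Subsingleton.elim (y t) 0]
  refine ⟨r / 2, by linarith, γ, hγ0, ?_, ?_⟩
  · intro t ht f hf
    have h1 := hy t (Ico_subset_Icc_self ht)
    have : q ≤ RingHom.ker (eval (γ t)) := by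
      rw [← hG, Ideal.span_le]
      intro g hg
      exact congrFun h1 ⟨g, hg⟩
    exact this hf
  · have := hγ 0 ⟨by linarith, by linarith⟩
    rw [hγ0] at this
    exact this
theorem crit {q : Ideal (MvPolynomial (Fin n) ℝ)} (Θ : Fin n → MvPolynomial (Fin n) ℝ)
    (hΘ : ∀ g ∈ q, ∑ m, Θ m * pderiv m g ∈ q) {z : Fin n → ℝ} (hz : z ∈ ZR q) (Ψ : MvPolynomial (Fin n) ℝ)
    {U : Set (Fin n → ℝ)} (hU : U ∈ nhds z) (hmax : ∀ x ∈ U, x ∈ ZR q → eval x Ψ ≤ eval z Ψ) :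
    ∑ m, eval z (Θ m) * eval z (pderiv m Ψ) = 0 := by
  have key : ∀ Θ : Fin n → MvPolynomial (Fin n) ℝ, (∀ g ∈ q, ∑ m, Θ m * pderiv m g ∈ q) →
      ∑ m, eval z (Θ m) * eval z (pderiv m Ψ) ≤ 0 := by
    intro Θ hΘ
    obtain ⟨ε, hε, γ, h0, h1, h2⟩ := flow Θ hΘ hz
    have h3 := hasDerivWithinAt_eval (h2.hasDerivWithinAt (s := Ici 0)) Ψ
    rw [h0] at h3
    have hloc : IsLocalMaxOn (fun t => eval (γ t) Ψ) (Ici 0) 0 := by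
      have e1 : ∀ᶠ t in nhdsWithin (0 : ℝ) (Ici 0), γ t ∈ U :=
        (h2.continuousAt.continuousWithinAt (s := Ici 0)).eventually (by rw [h0]; exact hU)
      have e2 : ∀ᶠ t in nhdsWithin (0 : ℝ) (Ici 0), t < ε := nhdsWithin_le_nhds (Iio_mem_nhds hε)
      filter_upwards [e1, e2, self_mem_nhdsWithin] with t ht1 ht2 ht3
      rw [h0]
      exact hmax _ ht1 (h1 t ⟨ht3, ht2⟩)
    have h4 := hloc.hasFDerivWithinAt_nonpos h3.hasFDerivWithinAt (y := 1) (mem_posTangentConeAt_of_segment_subset (by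
      rw [zero_add, segment_eq_Icc zero_le_one]; exact Icc_subset_Ici_self))
    simpa [mul_comm] using h4
  apply le_antisymm (key Θ hΘ)
  have := key (fun m => - Θ m) (fun g hg => by
    simp only [neg_mul, Finset.sum_neg_distrib]; exact neg_mem (hΘ g hg))
  simpa using this
end Flow

section Cross
variable {n : ℕ}
lemma card_le_hf {k : Type*} [Field k] {q : Ideal (MvPolynomial (Fin n) k)} {ι : Type*} [Fintype ι] (f : ι → MvPolynomial (Fin n) k) {m : ℕ}
    (hd : ∀ i, (f i).totalDegree ≤ m) (h : ∀ c : ι → k, ∑ i, c i • f i ∈ q → c = 0) : Fintype.card ι ≤ hf q m := by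
  let v : ι → Vm q m := fun i => ⟨Ideal.Quotient.mk q (f i), mem_Vm.2 ⟨f i, hd i, rfl⟩⟩
  have hv : LinearIndependent k v := by
    rw [Fintype.linearIndependent_iff]
    intro c hc i
    have h1 : ∑ i, c i • f i ∈ q := by
      rw [← Ideal.Quotient.eq_zero_iff_mem]
      have := congrArg (Submodule.subtype _) hc
      simp only [map_sum, map_smul, map_zero] at this
      change (Ideal.Quotient.mkₐ k q) _ = 0
      rw [map_sum]
      simp only [map_smul]
      exact this
    exact congrFun (h c h1) i
  exact hv.fintype_card_le_finrank
def PhiP (A J : MvPolynomial (Fin n) ℝ) (R2 : ℝ) : MvPolynomial (Fin n) ℝ :=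
  (A * J) ^ 2 * (C R2 - ∑ i, X i ^ 2)
lemma eval_PhiP (A J : MvPolynomial (Fin n) ℝ) (R2 : ℝ) (x : Fin n → ℝ) :
    eval x (PhiP A J R2) = (eval x A * eval x J) ^ 2 * (R2 - ∑ i, x i ^ 2) := by
  simp [PhiP]
lemma isCompact_ball (R2 : ℝ) : IsCompact {x : Fin n → ℝ | ∑ i, x i ^ 2 ≤ R2} := by
  apply Metric.isCompact_of_isClosed_isBounded
  · exact isClosed_le (by fun_prop) continuous_const
  · refine (Metric.isBounded_closedBall (x := (0 : Fin n → ℝ)) (r := |R2| + 1)).subset fun x hx => ?_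
    rw [mem_closedBall_zero_iff, pi_norm_le_iff_of_nonneg (by positivity)]
    intro i
    have h1 : x i ^ 2 ≤ R2 := (Finset.single_le_sum (f := fun i => x i ^ 2) (fun i _ => sq_nonneg _) (Finset.mem_univ i)).trans hx
    rw [Real.norm_eq_abs]
    apply abs_le_of_sq_le_sq _ (by positivity)
    nlinarith [le_abs_self R2, abs_nonneg R2]
lemma crit_point {q : Ideal (MvPolynomial (Fin n) ℝ)} {e s : ℕ} {lam : Fin e → Fin n}
    {Θ : Fin e → Fin n → MvPolynomial (Fin n) ℝ} {J : MvPolynomial (Fin n) ℝ}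
    (hlam : ∀ i j, Θ i (lam j) = if i = j then J else 0) (hΘ : ∀ g ∈ q, ∀ i, ∑ m, Θ i m * pderiv m g ∈ q)
    (P : Fin s → MvPolynomial (Fin n) ℝ) {R2 : ℝ} {x : Fin n → ℝ} (hx : x ∈ ZR q) (hxJ : eval x J ≠ 0)
    (hxP : ∀ j, eval x (P j) ≠ 0) (hR : ∑ i, x i ^ 2 < R2) :
    ∀ᶠ ε in nhdsWithin (0 : ℝ) (Ioi 0), ∀ a : Fin e → ℝ, (∀ l, |a l| ≤ ε) → ∃ z, z ∈ ZR q ∧ ∑ i, z i ^ 2 ≤ R2 ∧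
      (∀ j, 0 < eval x (P j) * eval z (P j)) ∧ eval z J ≠ 0 ∧
      (∀ l, ∑ m, eval z (Θ l m) * eval z (pderiv m (PhiP (∏ j, P j) J R2)) = - a l * eval z J) ∧
      ε ≤ ∏ j, eval x (P j) * eval z (P j) := by
  set A := ∏ j, P j with hA
  set Φ := PhiP A J R2 with hΦ
  set K := {x : Fin n → ℝ | ∑ i, x i ^ 2 ≤ R2} with hK
  have hKc : IsCompact K := isCompact_ball R2
  have hAx : eval x A ≠ 0 := by rw [hA, map_prod]; exact Finset.prod_ne_zero_iff.2 fun j _ => hxP j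
  have hc : 0 < eval x Φ := by
    rw [hΦ, eval_PhiP]
    have : 0 < R2 - ∑ i, x i ^ 2 := by linarith
    positivity
  set c := eval x Φ with hcdef
  obtain ⟨M, hM⟩ : ∃ M : ℝ, ∀ z ∈ K, eval z J ^ 2 * (R2 - ∑ i, z i ^ 2) ≤ M := by
    have hcont : ContinuousOn (fun z : Fin n → ℝ => eval z J ^ 2 * (R2 - ∑ i, z i ^ 2)) K := by
      have := continuous_eval' J
      fun_prop
    obtain ⟨M, hM⟩ := hKc.bddAbove_image hcont
    exact ⟨M, fun z hz => hM ⟨z, hz, rfl⟩⟩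
  obtain ⟨ρ, hρ⟩ : ∃ ρ : ℝ, ∀ z ∈ K, ∑ l, |z (lam l)| ≤ ρ := by
    have hcont : ContinuousOn (fun z : Fin n → ℝ => ∑ l, |z (lam l)|) K := by fun_prop
    obtain ⟨M, hM⟩ := hKc.bddAbove_image hcont
    exact ⟨M, fun z hz => hM ⟨z, hz, rfl⟩⟩
  have hxK : x ∈ K := hR.le
  have hM0 : 0 < M := lt_of_lt_of_le (by have : 0 < R2 - ∑ i, x i ^ 2 := by linarith
                                         positivity) (hM x hxK)
  have ev1 : ∀ᶠ ε in nhdsWithin (0 : ℝ) (Ioi 0), 2 * ε * ρ < c / 2 := by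
    apply nhdsWithin_le_nhds
    have : ContinuousAt (fun ε : ℝ => 2 * ε * ρ) 0 := by fun_prop
    exact this.eventually_lt continuousAt_const (by simpa using hc)
  have ev2 : ∀ᶠ ε in nhdsWithin (0 : ℝ) (Ioi 0), ε ^ 2 < eval x A ^ 2 * (c / (2 * M)) := by
    apply nhdsWithin_le_nhds
    have : ContinuousAt (fun ε : ℝ => ε ^ 2) 0 := by fun_prop
    exact this.eventually_lt continuousAt_const (by simp only [ne_eq, OfNat.ofNat_ne_zero, not_false_eq_true, zero_pow]; positivity)
  filter_upwards [ev1, ev2, self_mem_nhdsWithin] with ε h1 h2 h3 a ha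
  have hε : 0 < ε := h3
  set Kt := K ∩ (ZR q ∩ {z | ∀ j, 0 ≤ eval x (P j) * eval z (P j)}) with hKt
  have hclosed : IsClosed (ZR q ∩ {z | ∀ j, 0 ≤ eval x (P j) * eval z (P j)}) := by
    apply IsClosed.inter
    · rw [ZR]; simp only [ofPred_forall]
      exact isClosed_iInter fun f => isClosed_iInter fun _ => isClosed_eq (continuous_eval' f) continuous_const
    · simp only [ofPred_forall]
      exact isClosed_iInter fun j => isClosed_le continuous_const (continuous_const.mul (continuous_eval' _))
  have hKtc : IsCompact Kt := hKc.inter_right hclosed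
  set Ψ := Φ + ∑ l, C (a l) * X (lam l) with hΨ
  have hΨe : ∀ z, eval z Ψ = eval z Φ + ∑ l, a l * z (lam l) := by intro z; simp [hΨ]
  obtain ⟨z, ⟨hzK, hzq, hzP⟩, hzmax⟩ := hKtc.exists_isMaxOn ⟨x, hxK, hx, fun j => mul_self_nonneg _⟩ (continuous_eval' Ψ).continuousOn
  have hbd : ∀ z ∈ K, |∑ l, a l * z (lam l)| ≤ ε * ρ := by
    intro z hz
    calc |∑ l, a l * z (lam l)| ≤ ∑ l, |a l * z (lam l)| := Finset.abs_sum_le_sum_abs _ _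
      _ ≤ ∑ l, ε * |z (lam l)| := Finset.sum_le_sum fun l _ => by rw [abs_mul]; exact mul_le_mul_of_nonneg_right (ha l) (abs_nonneg _)
      _ = ε * ∑ l, |z (lam l)| := by rw [Finset.mul_sum]
      _ ≤ _ := mul_le_mul_of_nonneg_left (hρ z hz) hε.le
  have hΦz : c / 2 < eval z Φ := by
    have e1 : eval x Ψ ≤ eval z Ψ := hzmax ⟨hxK, hx, fun j => mul_self_nonneg _⟩
    rw [hΨe, hΨe] at e1
    have e2 := abs_le.1 (hbd z hzK)
    have e3 := abs_le.1 (hbd x hxK)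
    nlinarith [e2.2, e3.1]
  have hΦz' := hΦz
  rw [hΦ, eval_PhiP] at hΦz'
  have hzK' : 0 ≤ R2 - ∑ i, z i ^ 2 := sub_nonneg.2 hzK
  have hAz : eval z A ≠ 0 := by intro h; rw [h] at hΦz'; norm_num at hΦz'; linarith
  have hJz : eval z J ≠ 0 := by intro h; rw [h] at hΦz'; norm_num at hΦz'; linarith
  have hzR : ∑ i, z i ^ 2 < R2 := by
    rcases hzK'.lt_or_eq with h | h
    · linarith
    · rw [← h] at hΦz'; norm_num at hΦz'; linarith
  have hzPne : ∀ j, eval z (P j) ≠ 0 := by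
    intro j
    rw [hA, map_prod, Finset.prod_ne_zero_iff] at hAz
    exact hAz j (Finset.mem_univ j)
  have hzP' : ∀ j, 0 < eval x (P j) * eval z (P j) := fun j => lt_of_le_of_ne (hzP j) (mul_ne_zero (hxP j) (hzPne j)).symm
  refine ⟨z, hzq, hzK, hzP', hJz, ?_, ?_⟩
  · intro l
    have hU : {y : Fin n → ℝ | ∑ i, y i ^ 2 < R2} ∩ {y | ∀ j, 0 < eval x (P j) * eval y (P j)} ∈ nhds z := by
      apply IsOpen.mem_nhds
      · apply IsOpen.inter
        · exact isOpen_lt (by fun_prop) continuous_const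
        · simp only [ofPred_forall]
          exact isOpen_iInter_of_finite fun j => isOpen_lt continuous_const (continuous_const.mul (continuous_eval' _))
      · exact ⟨hzR, hzP'⟩
    have := crit (Θ l) (fun g hg => hΘ g hg l) hzq Ψ hU (fun y hy hyq => hzmax ⟨(show ∑ i, y i ^ 2 < R2 from hy.1).le, hyq, fun j => (hy.2 j).le⟩)
    have e1 : ∀ m, eval z (pderiv m Ψ) = eval z (pderiv m Φ) + ∑ l', if lam l' = m then a l' else 0 := by
      intro m
      simp [hΨ, pderiv_X, Pi.single_apply, apply_ite]
    simp only [e1, mul_add, Finset.sum_add_distrib] at this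
    have e2 : ∑ m, eval z (Θ l m) * ∑ l', (if lam l' = m then a l' else 0) = a l * eval z J := by
      simp only [Finset.mul_sum]
      rw [Finset.sum_comm]
      simp [hlam, apply_ite, mul_comm]
    rw [e2] at this
    linarith
  · have e1 : ∏ j, eval x (P j) * eval z (P j) = eval x A * eval z A := by
      rw [Finset.prod_mul_distrib, hA, map_prod, map_prod]
    have e2 : 0 < ∏ j, eval x (P j) * eval z (P j) := Finset.prod_pos fun j _ => hzP' j
    apply le_of_sq_le_sq _ e2.le
    rw [e1, mul_pow]
    refine h2.le.trans (mul_le_mul_of_nonneg_left ?_ (sq_nonneg _))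
    rw [div_le_iff₀ (by positivity)]
    have e3 := hM z hzK
    have e4 : (eval z A * eval z J) ^ 2 * (R2 - ∑ i, z i ^ 2) ≤ eval z A ^ 2 * M := by
      rw [mul_pow, mul_assoc]; exact mul_le_mul_of_nonneg_left e3 (sq_nonneg _)
    linarith
lemma stone {K : Set (Fin n → ℝ)} (hK : IsCompact K) {h : (Fin n → ℝ) → ℝ} (hc : Continuous h) {δ : ℝ} (hδ : 0 < δ) :
    ∃ u : MvPolynomial (Fin n) ℝ, ∀ y ∈ K, |eval y u - h y| < δ := by
  let φ : MvPolynomial (Fin n) ℝ →ₐ[ℝ] C(Fin n → ℝ, ℝ) := aeval fun i => ⟨fun x => x i, by fun_prop⟩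
  have hφ : ∀ f x, φ f x = eval x f := by
    intro f x
    induction f using MvPolynomial.induction_on with
    | C a =>
      have : φ (C a) = algebraMap ℝ _ a := φ.commutes a
      rw [this]; simp
    | add f g h1 h2 => simp [h1, h2]
    | mul_X f i h1 => rw [map_mul, ContinuousMap.mul_apply, h1]; simp [φ]
  have hsep : φ.range.SeparatesPoints := by
    intro x y hxy
    obtain ⟨i, hi⟩ := Function.ne_iff.1 hxy
    refine ⟨fun x => x i, ⟨φ (X i), ⟨X i, rfl⟩, ?_⟩, hi⟩
    ext x; exact (hφ _ _).trans (by simp)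
  obtain ⟨g, ⟨u, rfl⟩, hg⟩ := ContinuousMap.exists_mem_subalgebra_near_continuous_of_isCompact_of_separatesPoints hsep ⟨h, hc⟩ hK hδ
  refine ⟨u, fun y hy => ?_⟩
  have := hg y hy
  rw [Real.norm_eq_abs] at this
  simpa [hφ] using this
theorem cross_core {q : Ideal (MvPolynomial (Fin n) ℝ)} {e s N D B : ℕ} (hN : IsHF q e N) {lam : Fin e → Fin n}
    {Θ : Fin e → Fin n → MvPolynomial (Fin n) ℝ} {J : MvPolynomial (Fin n) ℝ}
    (hlam : ∀ i j, Θ i (lam j) = if i = j then J else 0) (hΘ : ∀ g ∈ q, ∀ i, ∑ m, Θ i m * pderiv m g ∈ q)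
    (hJB : J.totalDegree ≤ B) (hΘB : ∀ i m, (Θ i m).totalDegree ≤ B)
    (P : Fin s → MvPolynomial (Fin n) ℝ) (hPD : (∏ j, P j).totalDegree ≤ D)
    (S : Finset (Fin n → ℝ)) (hS : ∀ x ∈ S, x ∈ ZR q) (hSJ : ∀ x ∈ S, eval x J ≠ 0)
    (hSP : ∀ x ∈ S, ∀ j, eval x (P j) ≠ 0)
    (hsep : ∀ x ∈ S, ∀ y ∈ S, (∀ j, 0 < eval x (P j) * eval y (P j)) → x = y) :
    S.card ≤ N * (2 * D + 3 * B + 2) ^ e := by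
  classical
  set R2 : ℝ := 1 + ∑ x ∈ S, ∑ i, x i ^ 2 with hR2
  have hR : ∀ x ∈ S, ∑ i, x i ^ 2 < R2 := by
    intro x hx
    have := Finset.single_le_sum (f := fun x : Fin n → ℝ => ∑ i, x i ^ 2) (fun x _ => Finset.sum_nonneg fun _ _ => sq_nonneg _) hx
    linarith
  set Φ := PhiP (∏ j, P j) J R2 with hΦ
  set K := {x : Fin n → ℝ | ∑ i, x i ^ 2 ≤ R2} with hK
  have hev : ∀ᶠ ε in nhdsWithin (0 : ℝ) (Ioi 0), ∀ x : S, ∀ a : Fin e → ℝ, (∀ l, |a l| ≤ ε) → ∃ z, z ∈ ZR q ∧ ∑ i, z i ^ 2 ≤ R2 ∧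
      (∀ j, 0 < eval x.1 (P j) * eval z (P j)) ∧ eval z J ≠ 0 ∧
      (∀ l, ∑ m, eval z (Θ l m) * eval z (pderiv m Φ) = - a l * eval z J) ∧
      ε ≤ ∏ j, eval x.1 (P j) * eval z (P j) := by
    rw [Filter.eventually_all]
    intro x
    exact crit_point hlam hΘ P (hS x x.2) (hSJ x x.2) (hSP x x.2) (hR x x.2)
  obtain ⟨ε, hcrit, hε⟩ := (hev.and self_mem_nhdsWithin).exists
  replace hε : 0 < ε := hε
  set δ : ℝ := ε / (S.card + 1) with hδ
  have hδp : 0 < δ := by positivity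
  let h : S → (Fin n → ℝ) → ℝ := fun x y => ∏ j, max 0 (eval x.1 (P j) * eval y (P j))
  have hh : ∀ x, Continuous (h x) := by
    intro x
    refine continuous_finsetProd _ fun j _ => continuous_const.max (continuous_const.mul (continuous_eval' _))
  choose u hu using fun x => stone (isCompact_ball R2) (hh x) hδp
  have hdet : ∀ z : S → (Fin n → ℝ), (∀ x, ∑ i, z x i ^ 2 ≤ R2) → (∀ x : S, ∀ j, 0 < eval x.1 (P j) * eval (z x) (P j)) →
      (∀ x : S, ε ≤ ∏ j, eval x.1 (P j) * eval (z x) (P j)) → (Matrix.of fun x y : S => eval (z x) (u y)).det ≠ 0 := by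
    intro z hz1 hz2 hz3
    apply det_ne_zero_of_sum_row_lt_diag
    intro x
    have hoff : ∀ y : S, y ≠ x → |eval (z x) (u y)| ≤ δ := by
      intro y hy
      have h1 := hu y (z x) (hz1 x)
      have h2 : h y (z x) = 0 := by
        have : ∃ j, ¬ 0 < eval y.1 (P j) * eval x.1 (P j) := by
          by_contra! hcon
          exact hy (Subtype.ext (hsep _ y.2 _ x.2 hcon))
        obtain ⟨j, hj⟩ := this
        apply Finset.prod_eq_zero (Finset.mem_univ j)
        apply max_eq_left
        have h3 := hz2 x j
        rw [not_lt] at hj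
        have h4 : eval x.1 (P j) ≠ 0 := hSP x x.2 j
        have h5 : (eval y.1 (P j) * eval (z x) (P j)) * eval x.1 (P j) ^ 2 ≤ 0 := by nlinarith
        have h6 : 0 < eval x.1 (P j) ^ 2 := by positivity
        by_contra! h7
        nlinarith
      rw [h2, sub_zero] at h1
      exact h1.le
    have hdiag : ε - δ < |eval (z x) (u x)| := by
      have h1 := hu x (z x) (hz1 x)
      have h2 : h x (z x) = ∏ j, eval x.1 (P j) * eval (z x) (P j) := by
        apply Finset.prod_congr rfl; intro j _
        exact max_eq_right (hz2 x j).le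
      have h3 := hz3 x
      rw [h2] at h1
      have := (abs_lt.1 h1).1
      linarith [le_abs_self (eval (z x) (u x))]
    have hεδ : ε = δ * (S.card + 1) := by rw [hδ]; field_simp
    calc ∑ y ∈ Finset.univ.erase x, ‖(Matrix.of fun x y : S => eval (z x) (u y)) x y‖
        ≤ ∑ y ∈ Finset.univ.erase x, δ := Finset.sum_le_sum fun y hy => hoff y (Finset.ne_of_mem_erase hy)
      _ = ((S.card : ℝ) - 1) * δ := by
          have hS1 : 1 ≤ S.card := Finset.card_pos.2 ⟨x, x.2⟩
          rw [Finset.sum_const, Finset.card_erase_of_mem (Finset.mem_univ x)]; simp [Nat.cast_sub hS1]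
      _ ≤ ε - δ := by rw [hεδ]; nlinarith
      _ < _ := hdiag
  let b : Fin e → MvPolynomial (Fin n) ℝ := fun l => ∑ m, Θ l m * pderiv m Φ
  set E := 2 * D + 3 * B + 2 with hE
  have hbE : ∀ l, (b l).totalDegree ≤ E := by
    intro l
    refine td_sum_le _ _ fun m _ => (totalDegree_mul _ _).trans ?_
    have h1 := td_pderiv_le Φ m
    have h2 : Φ.totalDegree ≤ 2 * (D + B) + 2 := by
      refine (totalDegree_mul _ _).trans (add_le_add ((totalDegree_pow _ _).trans (Nat.mul_le_mul_left _ ((totalDegree_mul _ _).trans (add_le_add hPD hJB)))) ?_)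
      refine (totalDegree_sub _ _).trans (max_le (by simp) (td_sum_le _ _ fun i _ => (totalDegree_pow _ _).trans (by simp)))
    have := hΘB l m
    omega
  set U := Finset.univ.sup fun x => (u x).totalDegree with hU
  have hcount : ∀ m, S.card * (m + e).choose e ≤ N * (E * m + U + e).choose e := by
    intro m
    refine le_trans ?_ (hN.upper _)
    let f : S × monF e m → MvPolynomial (Fin n) ℝ := fun p => u p.1 * ((p.2.1.prod fun l t => b l ^ t) * J ^ (m - p.2.1.degree))
    have := card_le_hf (q := q) f (m := E * m + U) ?_ ?_
    · simpa [card_monF] using this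
    · rintro ⟨x, β, hβ⟩
      rw [mem_monF] at hβ
      have h1 : (u x).totalDegree ≤ U := Finset.le_sup (f := fun x => (u x).totalDegree) (Finset.mem_univ x)
      have h2 : (β.prod fun l t => b l ^ t).totalDegree ≤ E * β.degree := by
        rw [Finsupp.prod]
        refine (totalDegree_finsetProd _ _).trans ?_
        rw [Finsupp.degree_apply, Finset.mul_sum]
        exact Finset.sum_le_sum fun l _ => (totalDegree_pow _ _).trans (by rw [mul_comm]; exact Nat.mul_le_mul_right _ (hbE l))
      have h3 : (J ^ (m - β.degree)).totalDegree ≤ E * (m - β.degree) :=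
        (totalDegree_pow _ _).trans (by rw [mul_comm]; exact Nat.mul_le_mul_right _ (by omega))
      have h4 : E * β.degree + E * (m - β.degree) = E * m := by rw [← mul_add]; congr 1; omega
      have h5 := totalDegree_mul (u x) ((β.prod fun l t => b l ^ t) * J ^ (m - β.degree))
      have h6 := totalDegree_mul (β.prod fun l t => b l ^ t) (J ^ (m - β.degree))
      change (u x * ((β.prod fun l t => b l ^ t) * J ^ (m - β.degree))).totalDegree ≤ _
      omega
    · intro c hc
      let G : S → MvPolynomial (Fin e) ℝ := fun x => ∑ β : monF e m, monomial β.1 (c (x, β))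
      have hGc : ∀ x β, coeff β.1 (G x) = c (x, β) := by
        intro x β
        simp only [G, coeff_sum, coeff_monomial, ← Subtype.ext_iff]
        simp
      have hG0 : ∀ x, G x = 0 := by
        intro x
        refine MvPolynomial.funext_set (fun _ => Icc (-ε) ε) (fun _ => Icc_infinite (by linarith)) ?_
        intro a ha
        rw [map_zero]
        choose z hz1 hz2 hz3 hz4 hz5 hz6 using fun x : S => hcrit x (fun l => - a l) (fun l => by
          rw [abs_neg, abs_le]; exact ha l (mem_univ l))
        have hd := hdet z hz2 hz3 hz6
        have hbz : ∀ x l, eval (z x) (b l) = a l * eval (z x) J := by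
          intro x l
          have := hz5 x l
          simp only [b, map_sum, map_mul]
          rw [this]; ring
        have hv : (Matrix.of fun x y : S => eval (z x) (u y)).mulVec (fun y => eval a (G y)) = 0 := by
          ext x
          have h0 := hz1 x _ hc
          rw [map_sum, Fintype.sum_prod_type] at h0
          have hJm : eval (z x) J ^ m ≠ 0 := pow_ne_zero _ (hz4 x)
          have h1 : ∀ y : S, ∑ β : monF e m, eval (z x) (c (y, β) • f (y, β)) = eval (z x) (u y) * eval a (G y) * eval (z x) J ^ m := by
            intro y
            simp only [G, map_sum, eval_monomial, Finset.mul_sum, Finset.sum_mul]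
            refine Finset.sum_congr rfl fun β _ => ?_
            have hβ := mem_monF.1 β.2
            simp only [f, smul_eval, map_mul, map_pow, Finsupp.prod, map_prod, hbz, mul_pow, Finset.prod_mul_distrib]
            rw [Finset.prod_pow_eq_pow_sum, ← Finsupp.degree_apply]
            have hpw : eval (z x) J ^ m = eval (z x) J ^ (β.1.degree) * eval (z x) J ^ (m - β.1.degree) := by
              rw [← pow_add, Nat.add_sub_cancel' hβ]
            rw [hpw]
            ring
          simp only [h1] at h0
          rw [← Finset.sum_mul] at h0
          exact (mul_eq_zero.1 h0).resolve_right hJm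
        exact congrFun (Matrix.eq_zero_of_mulVec_eq_zero hd hv) x
      ext ⟨x, β⟩
      rw [← hGc, hG0]; simp
  rcases Nat.eq_zero_or_pos S.card with h0 | h0
  · rw [h0]; exact Nat.zero_le _
  · rcases growth _ _ _ _ _ _ h0 hcount with h1 | ⟨_, h1⟩
    · exact absurd h1 (lt_irrefl _)
    · exact h1
end Cross

section Comps
variable {n : ℕ} {k : Type} [Field k] [Infinite k]
theorem comps {p : Ideal (MvPolynomial (Fin n) k)} [p.IsPrime] {e N : ℕ} (hp : IsHF p e N)
    {g : MvPolynomial (Fin n) k} (hg : g ∉ p) {δ : ℕ} (hδ : g.totalDegree ≤ δ) :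
    ∃ (ι : Type) (_ : Fintype ι) (q : ι → Ideal (MvPolynomial (Fin n) k)) (N' : ι → ℕ),
      (∀ i, (q i).IsPrime) ∧ (∀ i, p ≤ q i) ∧ (∀ i, g ∈ q i) ∧ (∀ i, IsHF (q i) (e - 1) (N' i)) ∧
      (∀ _ : ι, 1 ≤ e) ∧ ∑ i, N' i ≤ δ * N ∧
      (∀ P : Ideal (MvPolynomial (Fin n) k), P.IsPrime → p ≤ P → g ∈ P → ∃ i, q i ≤ P) := by
  classical
  have hfin := Ideal.finite_minimalPrimes_of_isNoetherianRing _ (p ⊔ Ideal.span {g})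
  have := hfin.fintype
  have hpr : ∀ i : (p ⊔ Ideal.span {g}).minimalPrimes, i.1.IsPrime := fun i => i.2.1.1
  choose e' N' hN using fun i : (p ⊔ Ideal.span {g}).minimalPrimes => exists_HF i.1
  obtain ⟨h1, h2⟩ := cut hp hg hδ (fun i : (p ⊔ Ideal.span {g}).minimalPrimes => i.1) Subtype.val_injective (fun i => i.2) hN
  refine ⟨_, this, fun i => i.1, N', hpr, fun i => le_sup_left.trans i.2.1.2,
    fun i => i.2.1.2 (Ideal.mem_sup_right (Ideal.mem_span_singleton_self g)), fun i => ?_, fun i => by have := h1 i; omega, h2, ?_⟩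
  · have := hN i
    rwa [show e' i = e - 1 by have := h1 i; omega] at this
  · intro P hP hpP hgP
    obtain ⟨i, hi, hiP⟩ := Ideal.exists_minimalPrimes_le (I := p ⊔ Ideal.span {g}) (J := P)
      (sup_le hpP ((Ideal.span_singleton_le_iff_mem _).2 hgP))
    exact ⟨⟨i, hi⟩, hiP⟩
end Comps
section CrossX
variable {n : ℕ}
lemma ker_eval_prime (x : Fin n → ℝ) : (RingHom.ker (eval x)).IsPrime := RingHom.ker_isPrime _
lemma mem_ZR_iff {q : Ideal (MvPolynomial (Fin n) ℝ)} {x : Fin n → ℝ} : x ∈ ZR q ↔ q ≤ RingHom.ker (eval x) := Iff.rfl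
def Sep {s : ℕ} (P : Fin s → MvPolynomial (Fin n) ℝ) (S : Finset (Fin n → ℝ)) : Prop :=
  (∀ x ∈ S, ∀ j, eval x (P j) ≠ 0) ∧ ∀ x ∈ S, ∀ y ∈ S, (∀ j, 0 < eval x (P j) * eval y (P j)) → x = y
lemma Sep.mono {s : ℕ} {P : Fin s → MvPolynomial (Fin n) ℝ} {S T : Finset (Fin n → ℝ)} (h : Sep P S) (hT : T ⊆ S) : Sep P T :=
  ⟨fun x hx => h.1 x (hT hx), fun x hx y hy => h.2 x (hT hx) y (hT hy)⟩
def CrossB (n e C : ℕ) : Prop := ∀ (p : Ideal (MvPolynomial (Fin n) ℝ)) [p.IsPrime] (N s D : ℕ) (P : Fin s → MvPolynomial (Fin n) ℝ)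
  (S : Finset (Fin n → ℝ)), IsHF p e N → (∏ j, P j).totalDegree ≤ D → (∀ x ∈ S, x ∈ ZR p) → Sep P S → S.card ≤ C * (N * (D + 1) ^ e)
theorem cross_inner (e C0 : ℕ) (ih : 1 ≤ e → CrossB n (e - 1) C0) (f : ℕ) : ∀ K c : ℕ, ∃ C, ∀ (p q : Ideal (MvPolynomial (Fin n) ℝ)) [p.IsPrime]
    (N f' Nq D' s D : ℕ) (P : Fin s → MvPolynomial (Fin n) ℝ) (S : Finset (Fin n → ℝ)), f' < f → Apx p q f' Nq D' c →
    D' + 1 ≤ K * (D + 1) → D ≤ D' → IsHF p e N → (∏ j, P j).totalDegree ≤ D → (∀ x ∈ S, x ∈ ZR p) → Sep P S →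
    S.card ≤ C * (N * (D + 1) ^ e) := by
  induction f with
  | zero => intro K c; exact ⟨0, fun p q _ N f' Nq D' s D P S h => absurd h (Nat.not_lt_zero _)⟩
  | succ f ihf =>
  intro K c
  obtain ⟨i, hi⟩ : ∃ i : ℕ, 2 ^ i * c < 3 ^ i := by
    have h1 : (1 : ℝ) < 3 / 2 := by norm_num
    obtain ⟨i, hi⟩ := pow_unbounded_of_one_lt (c : ℝ) h1
    refine ⟨i, ?_⟩
    rw [div_pow, lt_div_iff₀ (by positivity)] at hi
    have : (2 : ℝ) ^ i * c < 3 ^ i := by linarith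
    exact_mod_cast this
  set K1 := (n + 1) * (3 * (2 * n + 1) * 2 ^ i) with hK1
  have hK1p : 1 ≤ K1 := Nat.mul_pos (by omega) (Nat.mul_pos (by omega) (by positivity))
  obtain ⟨C1, hC1⟩ := ihf ((K1 + 1) * K) (cA n ^ (f + 1) * c)
  refine ⟨C1 + (5 * K1) ^ n * c * K ^ e + C0 * (K1 * K), ?_⟩
  intro p q _ N f' Nq D' s D P S hf' hA hD' hDD hp hPD hS hsep
  have hqp := hA.prime
  set B := K1 * (D' + 1) with hB
  obtain ⟨lam, Θ, J, hlamj, hJB, hΘB, hJq, hlam, hΘ⟩ := jac hA.isHF hA.good hi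
  have hBeq : (n + 1) * (3 * (2 * n + 1) * (2 ^ i * (D' + 1))) = B := by rw [hB, hK1]; ring
  rw [hBeq] at hJB
  simp only [hBeq] at hΘB
  by_cases hJp : J ∈ p
  · obtain ⟨q', e', N', hqq, hA'⟩ := hA.extend (D' := B + D') f' (by omega)
    have hA'p := hA'.prime
    have hJq' : J ∈ q' := hA'.agree J hJp (by omega)
    have hlt := hA.isHF.lt_of_lt hA'.isHF (lt_of_le_of_ne hqq fun h => hJq (h ▸ hJq'))
    have hcc : Apx p q' e' N' (B + D') (cA n ^ (f + 1) * c) := by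
      refine ⟨hA'.prime, hA'.le, hA'.agree, hA'.isHF, hA'.good.trans ?_⟩
      gcongr
      · exact cA_pos n
      · omega
    have := hC1 p q' N e' N' (B + D') s D P S (by omega) hcc (by
      calc B + D' + 1 = (K1 + 1) * (D' + 1) := by rw [hB]; ring
        _ ≤ (K1 + 1) * (K * (D + 1)) := by gcongr
        _ = _ := by ring) (by omega) hp hPD hS hsep
    refine this.trans (Nat.mul_le_mul_right _ (by omega))
  · classical
    have hfn := hA.isHF.le_n
    have hcard := Finset.card_filter_add_card_filter_not (s := S) (fun x => eval x J = 0)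
    have h1 : (S.filter fun x => ¬ eval x J = 0).card ≤ (5 * K1) ^ n * c * K ^ e * (N * (D + 1) ^ e) := by
      have := cross_core hA.isHF hlam hΘ hJB hΘB P hPD (S.filter fun x => ¬ eval x J = 0)
        (fun x hx g hg => hS x (Finset.mem_filter.1 hx).1 g (hA.le hg)) (fun x hx => (Finset.mem_filter.1 hx).2)
        (hsep.mono (Finset.filter_subset _ _)).1 (hsep.mono (Finset.filter_subset _ _)).2
      have hE : 2 * D + 3 * B + 2 ≤ 5 * K1 * (D' + 1) := by rw [hB]; nlinarith
      have hgood := hA.good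
      rw [← hA.hf_eq' le_rfl] at hgood
      have hup := hp.upper D'
      have hch := choose_le_pow1 D' e
      calc _ ≤ Nq * (2 * D + 3 * B + 2) ^ f' := this
        _ ≤ Nq * (5 * K1 * (D' + 1)) ^ f' := by gcongr
        _ = (5 * K1) ^ f' * (Nq * (D' + 1) ^ f') := by rw [mul_pow]; ring
        _ ≤ (5 * K1) ^ n * (c * (N * (D' + 1) ^ e)) := by
            refine Nat.mul_le_mul (Nat.pow_le_pow_right (by omega) hfn) (hgood.trans (Nat.mul_le_mul_left _ (hup.trans (Nat.mul_le_mul_left _ hch))))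
        _ ≤ (5 * K1) ^ n * (c * (N * (K * (D + 1)) ^ e)) := by gcongr
        _ = _ := by rw [mul_pow K (D+1) e]; ring
    have h2 : (S.filter fun x => eval x J = 0).card ≤ C0 * (K1 * K) * (N * (D + 1) ^ e) := by
      obtain ⟨ι, _, qq, N', hpr, -, -, hHF, he, hsum, hcov⟩ := comps hp hJp hJB
      have hsub : (S.filter fun x => eval x J = 0) ⊆ Finset.univ.biUnion fun i => S.filter fun x => x ∈ ZR (qq i) := by
        intro x hx
        rw [Finset.mem_filter] at hx
        obtain ⟨i, hi⟩ := hcov _ (ker_eval_prime x) (hS x hx.1) hx.2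
        simp only [Finset.mem_biUnion, Finset.mem_univ, true_and, Finset.mem_filter]
        exact ⟨i, hx.1, hi⟩
      have hi1 : ∀ i, (S.filter fun x => x ∈ ZR (qq i)).card ≤ C0 * (N' i * (D + 1) ^ (e - 1)) := by
        intro i
        have := hpr i
        exact ih (he i) (qq i) (N' i) s D P _ (hHF i) hPD (fun x hx => (Finset.mem_filter.1 hx).2) (hsep.mono (Finset.filter_subset _ _))
      refine (Finset.card_le_card hsub).trans (Finset.card_biUnion_le.trans ((Finset.sum_le_sum fun i _ => hi1 i).trans ?_))
      rw [← Finset.mul_sum, ← Finset.sum_mul]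
      rcases isEmpty_or_nonempty ι with h | ⟨⟨i0⟩⟩
      · simp
      have he1 := he i0
      calc C0 * ((∑ i, N' i) * (D + 1) ^ (e - 1)) ≤ C0 * ((K1 * (K * (D + 1)) * N) * (D + 1) ^ (e - 1)) := by
            gcongr
            refine hsum.trans ?_
            rw [hB]; gcongr
        _ = C0 * (K1 * K) * (N * ((D + 1) ^ (e - 1) * (D + 1))) := by ring
        _ = _ := by rw [← pow_succ, Nat.sub_add_cancel he1]
    calc S.card = _ := hcard.symm
      _ ≤ C0 * (K1 * K) * (N * (D + 1) ^ e) + (5 * K1) ^ n * c * K ^ e * (N * (D + 1) ^ e) := Nat.add_le_add h2 h1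
      _ ≤ C1 * (N * (D + 1) ^ e) + (C0 * (K1 * K) * (N * (D + 1) ^ e) + (5 * K1) ^ n * c * K ^ e * (N * (D + 1) ^ e)) := Nat.le_add_left _ _
      _ = _ := by ring
theorem cross_e (n e : ℕ) : ∃ C, CrossB n e C := by
  induction e with
  | zero =>
    obtain ⟨C, hC⟩ := cross_inner (n := n) 0 0 (by omega) (n + 1) 1 (cB n)
    refine ⟨C, fun p _ N s D P S h1 h2 h3 h4 => ?_⟩
    obtain ⟨q, f, Nq, hA⟩ := exists_Apx p D
    exact hC p q N f Nq D s D P S (Nat.lt_succ_of_le hA.isHF.le_n) hA (by omega) le_rfl h1 h2 h3 h4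
  | succ e ih =>
    obtain ⟨C0, hC0⟩ := ih
    obtain ⟨C, hC⟩ := cross_inner (n := n) (e + 1) C0 (fun _ => hC0) (n + 1) 1 (cB n)
    refine ⟨C, fun p _ N s D P S h1 h2 h3 h4 => ?_⟩
    obtain ⟨q, f, Nq, hA⟩ := exists_Apx p D
    exact hC p q N f Nq D s D P S (Nat.lt_succ_of_le hA.isHF.le_n) hA (by omega) le_rfl h1 h2 h3 h4
theorem cross (n : ℕ) : ∃ C, 1 ≤ C ∧ ∀ e, CrossB n e C := by
  choose C hC using cross_e n
  refine ⟨1 + ∑ e ∈ Finset.range (n + 1), C e, by omega, fun e p _ N s D P S h1 h2 h3 h4 => ?_⟩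
  refine (hC e p N s D P S h1 h2 h3 h4).trans (Nat.mul_le_mul_right _ ?_)
  have := Finset.single_le_sum (f := C) (fun _ _ => Nat.zero_le _) (Finset.mem_range.2 (by have := h1.le_n; omega : e < n + 1))
  omega
end CrossX

section Odd
lemma odd_root : ∀ (m : ℕ) (f : Polynomial ℝ), f.natDegree = m → Odd m → ∃ x, f.IsRoot x := by
  intro m
  induction m using Nat.strong_induction_on with
  | _ m ih =>
  intro f hf hm
  have h0 : f ≠ 0 := by rintro rfl; simp at hf; subst hf; simp at hm
  have hu : ¬ IsUnit f := fun h => by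
    rw [Polynomial.natDegree_eq_zero_of_isUnit h] at hf; subst hf; simp at hm
  obtain ⟨g, hg, h, rfl⟩ := WfDvdMonoid.exists_irreducible_factor hu h0
  have h2 := hg.natDegree_le_two
  have h1 : 0 < g.natDegree := hg.natDegree_pos
  have hh : h ≠ 0 := right_ne_zero_of_mul h0
  rw [Polynomial.natDegree_mul hg.ne_zero hh] at hf
  rcases (by omega : g.natDegree = 1 ∨ g.natDegree = 2) with h3 | h3
  · obtain ⟨x, hx⟩ := Polynomial.exists_root_of_degree_eq_one ((Polynomial.degree_eq_iff_natDegree_eq_of_pos one_pos).2 h3)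
    exact ⟨x, by simp [Polynomial.IsRoot, hx.eq_zero]⟩
  · obtain ⟨x, hx⟩ := ih h.natDegree (by omega) h rfl (by rw [Nat.odd_iff] at *; omega)
    exact ⟨x, by simp [Polynomial.IsRoot, hx.eq_zero]⟩
lemma common_eig {ι : Type} : ∀ (m : ℕ) (V : Type) [AddCommGroup V] [Module ℝ V] [Module.Finite ℝ V] (T : ι → V →ₗ[ℝ] V),
    Module.finrank ℝ V = m → Odd m → (∀ i j v, T i (T j v) = T j (T i v)) → ∃ v ≠ 0, ∀ i, ∃ c : ℝ, T i v = c • v := by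
  intro m
  induction m using Nat.strong_induction_on with
  | _ m ih =>
  intro V _ _ _ T hV hm hT
  have : Nontrivial V := Module.nontrivial_of_finrank_pos (R := ℝ) (by rw [hV]; exact hm.pos)
  by_cases hs : ∀ i, ∃ c : ℝ, ∀ v, T i v = c • v
  · obtain ⟨v, hv⟩ := exists_ne (0 : V)
    exact ⟨v, hv, fun i => ⟨(hs i).choose, (hs i).choose_spec v⟩⟩
  push Not at hs
  obtain ⟨i, hi⟩ := hs
  obtain ⟨c, hc⟩ := odd_root m (T i).charpoly (by rw [LinearMap.charpoly_natDegree, hV]) hm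
  have hev := (Module.End.hasEigenvalue_iff_isRoot_charpoly _ _).2 hc
  obtain ⟨v, hv⟩ := hev.exists_hasEigenvector
  set U : V →ₗ[ℝ] V := T i - c • LinearMap.id with hU
  have hUT : ∀ j w, U (T j w) = T j (U w) := by intro j w; simp [hU, hT i j w]
  have hrn := LinearMap.finrank_range_add_finrank_ker U
  have hk : 0 < Module.finrank ℝ (LinearMap.ker U) := by
    rw [Module.finrank_pos_iff_exists_ne_zero]
    refine ⟨⟨v, ?_⟩, fun h => hv.2 (by simpa using congrArg Subtype.val h)⟩
    simp [hU, hv.apply_eq_smul]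
  have hr : 0 < Module.finrank ℝ (LinearMap.range U) := by
    obtain ⟨w, hw⟩ := hi c
    rw [Module.finrank_pos_iff_exists_ne_zero]
    refine ⟨⟨U w, w, rfl⟩, fun h => hw ?_⟩
    have := congrArg Subtype.val h
    simp only [hU] at this
    simpa [sub_eq_zero] using this
  have key : ∀ W : Submodule ℝ V, (∀ j, ∀ w ∈ W, T j w ∈ W) → Module.finrank ℝ W < m → Odd (Module.finrank ℝ W) →
      ∃ v ≠ 0, ∀ i, ∃ c : ℝ, T i v = c • v := by
    intro W hW h1 h2
    obtain ⟨v, hv, h⟩ := ih _ h1 W (fun j => (T j).restrict (hW j)) rfl h2 (fun i j w => Subtype.ext (hT i j w))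
    exact ⟨v, by simpa using hv, fun i => ⟨(h i).choose, by simpa using congrArg Subtype.val (h i).choose_spec⟩⟩
  rcases Nat.even_or_odd (Module.finrank ℝ (LinearMap.ker U)) with h | h
  · refine key (LinearMap.range U) ?_ (by omega) (by rw [Nat.odd_iff] at *; rw [Nat.even_iff] at h; omega)
    rintro j _ ⟨w, rfl⟩
    exact ⟨T j w, hUT j w⟩
  · refine key (LinearMap.ker U) ?_ (by omega) h
    intro j w hw
    rw [LinearMap.mem_ker] at *
    rw [hUT, hw, map_zero]
lemma alg_point {ι A : Type} [CommRing A] [Algebra ℝ A] [Module.Finite ℝ A] (y : ι → A) (h : Odd (Module.finrank ℝ A)) :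
    ∃ lam : Module.Dual ℝ A, lam ≠ 0 ∧ ∃ c : ι → ℝ, ∀ i x, lam (y i * x) = c i * lam x := by
  obtain ⟨lam, hlam, h⟩ := common_eig _ (Module.Dual ℝ A) (fun i => (LinearMap.mulLeft ℝ (y i)).dualMap) rfl
    (by rwa [Subspace.dual_finrank_eq]) (fun i j v => LinearMap.ext fun x => congrArg v (mul_left_comm (y j) (y i) x))
  choose c hc using h
  exact ⟨lam, hlam, c, fun i x => LinearMap.congr_fun (hc i) x⟩
lemma alg_point2 {N : ℕ} {A : Type} [CommRing A] [Algebra ℝ A] [Module.Finite ℝ A] (φ : MvPolynomial (Fin N) ℝ →ₐ[ℝ] A)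
    (hs : Function.Surjective φ) (h : Odd (Module.finrank ℝ A)) : ∃ c : Fin N → ℝ, ∀ g, φ g = 0 → eval c g = 0 := by
  obtain ⟨lam, hlam, c, h1⟩ := alg_point (fun i : Fin N => φ (X i)) h
  have h2 : ∀ g : MvPolynomial (Fin N) ℝ, lam (φ g) = eval c g * lam 1 := by
    intro g
    induction g using MvPolynomial.induction_on with
    | C r =>
      rw [← algebraMap_eq, AlgHom.commutes, Algebra.algebraMap_eq_smul_one, map_smul]; simp
    | add p q hp hq => simp only [map_add, hp, hq, add_mul]
    | mul_X p i hp => rw [mul_comm, map_mul, h1, hp]; simp; ring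
  have h3 : lam 1 ≠ 0 := fun h0 => hlam (by
    ext x
    obtain ⟨g, rfl⟩ := hs x
    simp [h2, h0])
  refine ⟨c, fun g hg => ?_⟩
  have h4 := h2 g
  rw [hg, map_zero] at h4
  exact (mul_eq_zero.1 h4.symm).resolve_right h3
lemma nak {E V : Type} [Fintype E] [DecidableEq E] [AddCommGroup V] [Module ℝ V] (Q : Matrix E E ℝ) :
    {u : ℝ | ¬ ∀ (W : Submodule ℝ V) (v : E → V), (∀ e, v e - u • ∑ e', Q e e' • v e' ∈ W) → ∀ e, v e ∈ W}.Countable := by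
  have h0 : Q.charpolyRev ≠ 0 := by
    intro h
    have := Matrix.eval_charpolyRev (M := Q)
    rw [h] at this; simp at this
  refine (Q.charpolyRev.roots.toFinset.finite_toSet.subset ?_).countable
  intro u hu
  by_contra hu2
  refine hu fun W v h e => ?_
  have hdet : (1 - u • Q).det ≠ 0 := by
    simp only [Finset.mem_coe, Multiset.mem_toFinset, Polynomial.mem_roots h0, Polynomial.IsRoot] at hu2
    intro h; apply hu2
    rw [Matrix.charpolyRev, ← Polynomial.coe_evalRingHom, RingHom.map_det, ← h]
    congr 1
    ext i j
    by_cases hij : i = j <;> simp [hij] <;> ring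
  have hinv := Matrix.nonsing_inv_mul (1 - u • Q) (isUnit_iff_ne_zero.2 hdet)
  have h2 : v e = ∑ e', (1 - u • Q)⁻¹ e e' • (v e' - u • ∑ e'', Q e' e'' • v e'') := by
    have h3 : ∀ e', v e' - u • ∑ e'', Q e' e'' • v e'' = ∑ e'', (1 - u • Q) e' e'' • v e'' := by
      intro e'
      simp [Matrix.one_apply, sub_smul, Finset.sum_sub_distrib, ite_smul, Finset.smul_sum, smul_smul]
    simp_rw [h3, Finset.smul_sum, smul_smul]
    rw [Finset.sum_comm]
    simp_rw [← Finset.sum_smul]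
    have : ∀ y, ∑ x, (1 - u • Q)⁻¹ e x * (1 - u • Q) x y = if e = y then 1 else 0 := by
      intro y
      have := congrFun (congrFun hinv e) y
      rwa [Matrix.mul_apply, Matrix.one_apply] at this
    simp only [this]; simp
  rw [h2]
  exact W.sum_mem fun e' _ => W.smul_mem _ (h e')
end Odd
section Gen
variable {N d : ℕ} (f : Fin N → MvPolynomial (Fin N) ℝ)
abbrev Gu (d : ℕ) (u : ℝ) (i : Fin N) : MvPolynomial (Fin N) ℝ := X i ^ d + C u * f i
def ImS (d : ℕ) (u : ℝ) (m : ℕ) : Submodule ℝ (MvPolynomial (Fin N) ℝ) :=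
  Submodule.span ℝ ((fun z : (Fin N →₀ ℕ) × Fin N => monomial z.1 1 * Gu f d u z.2) '' ((monF N m ×ˢ Finset.univ : Finset ((Fin N →₀ ℕ) × Fin N)) : Set ((Fin N →₀ ℕ) × Fin N)))
def norF (N d m : ℕ) : Finset ((Fin N →₀ ℕ) × Fin N) := (monF N m ×ˢ Finset.univ).filter fun z => ∀ j < z.2, z.1 j < d
def Nm (d : ℕ) (u : ℝ) (m : ℕ) : Submodule ℝ (MvPolynomial (Fin N) ℝ) :=
  Submodule.span ℝ ((fun z : (Fin N →₀ ℕ) × Fin N => monomial z.1 1 * Gu f d u z.2) '' (norF N d m))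
def boxF (N d : ℕ) : Finset (Fin N →₀ ℕ) := (Fintype.piFinset fun _ : Fin N => Finset.range d).map Finsupp.equivFunOnFinite.symm.toEmbedding
def boxS (N d : ℕ) : Submodule ℝ (MvPolynomial (Fin N) ℝ) := Submodule.span ℝ ((fun a => monomial a 1) '' (boxF N d))
lemma mem_boxF {a : Fin N →₀ ℕ} : a ∈ boxF N d ↔ ∀ i, a i < d := by
  simp only [boxF, Finset.mem_map_equiv, Fintype.mem_piFinset, Finset.mem_range]; rfl
lemma card_boxF : (boxF N d).card = d ^ N := by simp [boxF]
lemma sum_monF {m : ℕ} {g : MvPolynomial (Fin N) ℝ} (hg : g.totalDegree ≤ m) : g = ∑ a : monF N m, coeff a.1 g • monomial a.1 1 := by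
  conv_lhs => rw [g.as_sum]
  rw [Finset.sum_coe_sort (monF N m) fun a => coeff a g • monomial a (1 : ℝ)]
  have : ∀ a, coeff a g • monomial a (1 : ℝ) = monomial a (coeff a g) := fun a => by rw [smul_monomial]; simp
  simp_rw [this]
  refine Finset.sum_subset (fun a ha => mem_monF.2 (le_trans ?_ hg)) (fun a _ ha => by rw [notMem_support_iff.1 ha]; simp)
  exact le_totalDegree ha
lemma mono_split {e : Fin N →₀ ℕ} {i : Fin N} (h : d ≤ e i) :
    (monomial e 1 : MvPolynomial (Fin N) ℝ) = monomial (e - Finsupp.single i d) 1 * X i ^ d := by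
  rw [X_pow_eq_monomial, monomial_mul, tsub_add_cancel_of_le (Finsupp.single_le_iff.2 h)]; simp
lemma deg_split {e : Fin N →₀ ℕ} {i : Fin N} (h : d ≤ e i) : (e - Finsupp.single i d).degree + d = e.degree := by
  conv_rhs => rw [← tsub_add_cancel_of_le (Finsupp.single_le_iff.2 h)]
  rw [map_add]; simp
lemma deg_mf {a : Fin N →₀ ℕ} {g : MvPolynomial (Fin N) ℝ} {s m : ℕ} (hg : g.totalDegree ≤ s) (h : a.degree + s ≤ m) :
    (monomial a 1 * g).totalDegree ≤ m := by
  refine (totalDegree_mul _ _).trans ?_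
  have : (monomial a (1 : ℝ)).totalDegree ≤ a.degree := by
    rw [totalDegree_monomial _ one_ne_zero]; exact le_rfl
  omega
variable {f}
lemma span_bad (hf : ∀ i, (f i).totalDegree ≤ d) (m : ℕ) : {u : ℝ | ¬ restrictTotalDegree (Fin N) ℝ (m + d) ≤ boxS N d ⊔ ImS f d u m}.Countable := by
  classical
  have : ∀ e : monF N (m + d), ∃ q : monF N (m + d) → ℝ, ∀ u : ℝ,
      (monomial e.1 1 : MvPolynomial (Fin N) ℝ) - u • ∑ e', q e' • monomial e'.1 1 ∈ boxS N d ⊔ ImS f d u m := by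
    intro e
    by_cases h : ∃ i, d ≤ e.1 i
    · obtain ⟨i, hi⟩ := h
      have h1 := mem_monF.1 e.2
      have h2 := deg_split hi
      refine ⟨fun e' => coeff e'.1 (-(monomial (e.1 - Finsupp.single i d) 1 * f i)), fun u => ?_⟩
      rw [← sum_monF (by rw [totalDegree_neg]; exact deg_mf (hf i) (by omega)), mono_split hi]
      refine Submodule.mem_sup_right (Submodule.subset_span ⟨(e.1 - Finsupp.single i d, i), ?_, ?_⟩)
      · simp only [Finset.coe_product, Set.mem_prod, Finset.mem_coe, Finset.mem_univ, and_true]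
        exact mem_monF.2 (by omega)
      · simp only [Gu, smul_eq_C_mul]; ring
    · push Not at h
      refine ⟨0, fun u => Submodule.mem_sup_left ?_⟩
      have : (monomial e.1 1 : MvPolynomial (Fin N) ℝ) ∈ boxS N d := Submodule.subset_span ⟨e.1, mem_boxF.2 h, rfl⟩
      simpa using this
  choose Q hQ using this
  refine Set.Countable.mono ?_ (nak (V := MvPolynomial (Fin N) ℝ) (Matrix.of Q))
  intro u hu
  simp only [mem_ofPred_eq] at hu ⊢
  intro hn
  refine hu fun g hg => ?_
  rw [sum_monF ((mem_restrictTotalDegree _ _ _).1 hg)]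
  exact Submodule.sum_mem _ fun e _ => Submodule.smul_mem _ _ (hn _ _ (fun e => hQ e u) e)
lemma mul_mem_Im {u : ℝ} {m : ℕ} {g : MvPolynomial (Fin N) ℝ} (hg : g.totalDegree ≤ m) (i : Fin N) : g * Gu f d u i ∈ ImS f d u m := by
  rw [sum_monF hg, Finset.sum_mul]
  refine Submodule.sum_mem _ fun a _ => ?_
  rw [smul_mul_assoc]
  refine Submodule.smul_mem _ _ (Submodule.subset_span ⟨(a.1, i), by simp, rfl⟩)
lemma gens_bad (hf : ∀ i, (f i).totalDegree ≤ d) (m : ℕ) : {u : ℝ | ¬ ImS f d u m ≤ Nm f d u m}.Countable := by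
  classical
  have : ∀ e : monF N m × Fin N, ∃ q : monF N m × Fin N → ℝ, ∀ u : ℝ,
      (monomial e.1.1 1 * Gu f d u e.2) - u • ∑ e', q e' • (monomial e'.1.1 1 * Gu f d u e'.2) ∈ Nm f d u m := by
    rintro ⟨⟨μ, hμ⟩, i⟩
    have h1 := mem_monF.1 hμ
    by_cases h : ∃ j, j < i ∧ d ≤ μ j
    · obtain ⟨j, ⟨hji, hj⟩, hmin⟩ := WellFounded.has_min (wellFounded_lt (α := Fin N)) {j | j < i ∧ d ≤ μ j} h
      have h2 := deg_split hj
      set a := μ - Finsupp.single j d with ha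
      refine ⟨fun e' => (if e'.2 = j then coeff e'.1.1 (monomial a 1 * f i) else 0) - (if e'.2 = i then coeff e'.1.1 (monomial a 1 * f j) else 0), fun u => ?_⟩
      have h3 : ∀ (g : MvPolynomial (Fin N) ℝ) (l : Fin N), g.totalDegree ≤ m →
          ∑ e' : monF N m × Fin N, (if e'.2 = l then coeff e'.1.1 g else 0) • (monomial e'.1.1 1 * Gu f d u e'.2) = g * Gu f d u l := by
        intro g l hg
        rw [Fintype.sum_prod_type]
        simp only [ite_smul, zero_smul, Finset.sum_ite_eq', Finset.mem_univ, if_true]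
        conv_rhs => rw [sum_monF hg, Finset.sum_mul]
        simp
      simp only [sub_smul, Finset.sum_sub_distrib]
      rw [h3 _ _ (deg_mf (hf i) (by omega)), h3 _ _ (deg_mf (hf j) (by omega)), mono_split hj]
      refine Submodule.subset_span ⟨(a + Finsupp.single i d, j), ?_, ?_⟩
      · simp only [norF, Finset.coe_filter, Finset.mem_product, Finset.mem_univ, and_true, Set.mem_ofPred_eq]
        refine ⟨mem_monF.2 (by rw [map_add]; simp; omega), fun l hl => ?_⟩
        have h4 := hmin l
        have hli : l ≠ i := (hl.trans hji).ne
        have hlj : l ≠ j := hl.ne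
        simp only [ha, Finsupp.add_apply, Finsupp.tsub_apply, Finsupp.single_apply, hli.symm, hlj.symm, if_false]
        by_contra hc
        exact h4 ⟨hl.trans hji, by omega⟩ hl
      · have : (monomial (a + Finsupp.single i d) 1 : MvPolynomial (Fin N) ℝ) = monomial a 1 * X i ^ d := by
          rw [X_pow_eq_monomial, monomial_mul]; simp
        simp only [this, Gu, smul_eq_C_mul]; ring
    · push Not at h
      refine ⟨0, fun u => ?_⟩
      simp only [Pi.zero_apply, zero_smul, Finset.sum_const_zero, smul_zero, sub_zero]
      exact Submodule.subset_span ⟨(μ, i), by simp [norF, hμ]; exact h, rfl⟩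
  choose Q hQ using this
  refine Set.Countable.mono ?_ (nak (V := MvPolynomial (Fin N) ℝ) (Matrix.of Q))
  intro u hu
  simp only [mem_ofPred_eq] at hu ⊢
  intro hn
  refine hu ?_
  refine Submodule.span_le.2 ?_
  rintro _ ⟨⟨a, i⟩, h, rfl⟩
  simp only [Finset.coe_product, Set.mem_prod, Finset.mem_coe, Finset.mem_univ, and_true] at h
  exact hn (Nm f d u m) (fun e => monomial e.1.1 1 * Gu f d u e.2) (fun e => hQ e u) (⟨a, h⟩, i)
lemma box_inf {u : ℝ} {m : ℕ} (hm : N * d ≤ m) (h1 : restrictTotalDegree (Fin N) ℝ (m + d) ≤ boxS N d ⊔ ImS f d u m) (h2 : ImS f d u m ≤ Nm f d u m) :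
    boxS N d ⊓ ImS f d u m = ⊥ := by
  classical
  have i1 : FiniteDimensional ℝ (boxS N d) := FiniteDimensional.span_of_finite ℝ ((Finset.finite_toSet _).image _)
  have i2 : FiniteDimensional ℝ (ImS f d u m) := FiniteDimensional.span_of_finite ℝ ((Finset.finite_toSet _).image _)
  have i3 : FiniteDimensional ℝ (Nm f d u m) := FiniteDimensional.span_of_finite ℝ ((Finset.finite_toSet _).image _)
  have h3 := Submodule.finrank_mono h1
  rw [finrank_rtd, ← card_monF] at h3
  have h4 := Submodule.finrank_sup_add_finrank_inf_eq (boxS N d) (ImS f d u m)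
  have h5 : Module.finrank ℝ (boxS N d) ≤ (boxF N d).card := by
    rw [boxS, ← Finset.coe_image]; exact (finrank_span_finset_le_card _).trans Finset.card_image_le
  have h6 : Module.finrank ℝ (Nm f d u m) ≤ (norF N d m).card := by
    rw [Nm, ← Finset.coe_image]; exact (finrank_span_finset_le_card _).trans Finset.card_image_le
  have h7 := Submodule.finrank_mono h2
  have h8 : (norF N d m).card ≤ ((monF N (m + d)).filter fun a => ¬ ∀ i, a i < d).card := by
    refine Finset.card_le_card_of_injOn (fun z => z.1 + Finsupp.single z.2 d) ?_ ?_
    · rintro ⟨a, i⟩ h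
      simp only [norF, Finset.coe_filter, Finset.mem_product, Finset.mem_univ, and_true, Set.mem_ofPred_eq, mem_monF] at h ⊢
      refine ⟨by rw [map_add]; simp; omega, fun h' => ?_⟩
      have := h' i
      simp at this
    · have key : ∀ (a b : Fin N →₀ ℕ) (i j : Fin N), a + Finsupp.single i d = b + Finsupp.single j d → (∀ l < i, a l < d) → ¬ j < i := by
        intro a b i j h h' hji
        have h9 := h' j hji
        have := DFunLike.congr_fun h j
        simp only [Finsupp.add_apply, Finsupp.single_apply, hji.ne', if_false, if_true] at this
        omega
      rintro ⟨a, i⟩ h ⟨b, j⟩ h' heq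
      simp only [norF, Finset.coe_filter, Finset.mem_product, Finset.mem_univ, and_true, Set.mem_ofPred_eq] at h h' heq
      have e1 := key a b i j heq h.2
      have e2 := key b a j i heq.symm h'.2
      have : i = j := le_antisymm (not_lt.1 e1) (not_lt.1 e2)
      subst this
      rw [add_right_cancel heq]
  have h9 : (boxF N d) = (monF N (m + d)).filter fun a => ∀ i, a i < d := by
    ext a
    rw [mem_boxF, Finset.mem_filter, mem_monF]
    refine ⟨fun h => ⟨?_, h⟩, fun h => h.2⟩
    have : a.degree ≤ N * d := by
      rw [Finsupp.degree_eq_sum]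
      exact (Finset.sum_le_card_nsmul _ _ d fun i _ => (h i).le).trans (by simp)
    omega
  have h10 := Finset.card_filter_add_card_filter_not (s := monF N (m + d)) (fun a => ∀ i, a i < d)
  rw [← h9] at h10
  exact Submodule.finrank_eq_zero.1 (by omega)
theorem gen_zero (hd : Odd d) (hf : ∀ i, (f i).totalDegree ≤ d) (K : ℝ) : ∃ u > K, ∃ c : Fin N → ℝ, ∀ i, c i ^ d + u * eval c (f i) = 0 := by
  classical
  have hbad : (⋃ m, ({u : ℝ | ¬ restrictTotalDegree (Fin N) ℝ (m + d) ≤ boxS N d ⊔ ImS f d u m} ∪ {u : ℝ | ¬ ImS f d u m ≤ Nm f d u m})).Countable :=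
    countable_iUnion fun m => (span_bad hf m).union (gens_bad hf m)
  obtain ⟨u, huK, hu⟩ := (hbad.dense_compl ℝ).exists_mem_open isOpen_Ioi (⟨K + 1, by simp⟩ : (Ioi K).Nonempty)
  simp only [mem_compl_iff, mem_iUnion, mem_union, mem_ofPred_eq, not_exists, not_or, not_not] at huK
  refine ⟨u, hu, ?_⟩
  set I : Ideal (MvPolynomial (Fin N) ℝ) := Ideal.span (Set.range (Gu f d u)) with hI
  have hle : ∀ m, ImS f d u m ≤ I.restrictScalars ℝ := by
    intro m
    refine Submodule.span_le.2 ?_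
    rintro _ ⟨⟨a, i⟩, -, rfl⟩
    exact I.mul_mem_left _ (Ideal.subset_span ⟨i, rfl⟩)
  have hc : IsCompl (I.restrictScalars ℝ) (boxS N d) := by
    refine IsCompl.symm ⟨?_, ?_⟩
    · rw [disjoint_iff, eq_bot_iff]
      rintro x ⟨hx, hxI⟩
      obtain ⟨c, rfl⟩ := Ideal.mem_span_range_iff_exists_fun.1 hxI
      set m := N * d + ∑ i, (c i).totalDegree
      rw [← box_inf (u := u) (f := f) (show N * d ≤ m by omega) (huK m).1 (huK m).2]
      refine ⟨hx, Submodule.sum_mem _ fun i _ => mul_mem_Im ?_ i⟩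
      have := Finset.single_le_sum (f := fun i => (c i).totalDegree) (fun _ _ => Nat.zero_le _) (Finset.mem_univ i)
      omega
    · rw [codisjoint_iff, eq_top_iff]
      intro x _
      exact (sup_le_sup_left (hle x.totalDegree) _) ((huK x.totalDegree).1 ((mem_restrictTotalDegree _ _ _).2 (by omega)))
  have hfr : Module.finrank ℝ (boxS N d) = d ^ N := by
    have hli : LinearIndependent ℝ (fun a : boxF N d => (monomial a.1 1 : MvPolynomial (Fin N) ℝ)) := by
      have := (basisMonomials (Fin N) ℝ).linearIndependent
      rw [coe_basisMonomials] at this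
      exact this.comp _ Subtype.val_injective
    have := finrank_span_eq_card hli
    rw [Fintype.card_coe, card_boxF] at this
    have hset : ((fun a => monomial a 1) '' (boxF N d : Set (Fin N →₀ ℕ)) : Set (MvPolynomial (Fin N) ℝ)) = Set.range fun a : boxF N d => monomial a.1 1 := by
      ext x; constructor
      · rintro ⟨a, h, rfl⟩; exact ⟨⟨a, h⟩, rfl⟩
      · rintro ⟨a, rfl⟩; exact ⟨a.1, a.2, rfl⟩
    rw [boxS, hset, this]
  have i1 : FiniteDimensional ℝ (boxS N d) := FiniteDimensional.span_of_finite ℝ ((Finset.finite_toSet _).image _)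
  let eq1 : (MvPolynomial (Fin N) ℝ ⧸ I) ≃ₗ[ℝ] boxS N d := Submodule.quotientEquivOfIsCompl (I.restrictScalars ℝ) _ hc
  have i2 : FiniteDimensional ℝ (MvPolynomial (Fin N) ℝ ⧸ I) := FiniteDimensional.of_injective eq1.toLinearMap eq1.injective
  have hfr2 : Module.finrank ℝ (MvPolynomial (Fin N) ℝ ⧸ I) = d ^ N := by rw [eq1.finrank_eq, hfr]
  obtain ⟨c, hc⟩ := alg_point2 (Ideal.Quotient.mkₐ ℝ I) (Ideal.Quotient.mkₐ_surjective ℝ I) (by rw [hfr2]; exact hd.pow)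
  refine ⟨c, fun i => ?_⟩
  have := hc (Gu f d u i) (Ideal.Quotient.eq_zero_iff_mem.2 (Ideal.subset_span ⟨i, rfl⟩))
  simpa using this
end Gen

section Ham
open Filter Topology
lemma homog_eval {N d : ℕ} {P : MvPolynomial (Fin N) ℝ} (hP : P.IsHomogeneous d) (r : ℝ) (x : Fin N → ℝ) : eval (r • x) P = r ^ d * eval x P := by
  rw [eval_eq, eval_eq, Finset.mul_sum]
  refine Finset.sum_congr rfl fun a ha => ?_
  have h1 := hP.degree_eq_sum_deg_support ha
  have h2 : ∏ i ∈ a.support, (r • x) i ^ a i = r ^ d * ∏ i ∈ a.support, x i ^ a i := by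
    simp only [Pi.smul_apply, smul_eq_mul, mul_pow, Finset.prod_mul_distrib, Finset.prod_pow_eq_pow_sum]
    rw [← h1]
  rw [h2]; ring
lemma sphere_compact (N : ℕ) : IsCompact {z : Fin N → ℝ | ∑ l, z l ^ 2 = 1} := by
  refine (isCompact_ball 1).of_isClosed_subset (isClosed_eq (by fun_prop) continuous_const) fun z hz => ?_
  exact le_of_eq hz
lemma sphere_le {N : ℕ} {z : Fin N → ℝ} (h : ∑ l, z l ^ 2 = 1) (l : Fin N) : |z l| ≤ 1 := by
  have := Finset.single_le_sum (f := fun l => z l ^ 2) (fun _ _ => sq_nonneg _) (Finset.mem_univ l)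
  rw [abs_le_one_iff_mul_self_le_one]; nlinarith
theorem odd_forms {N d : ℕ} (hd : Odd d) (P : Fin N → MvPolynomial (Fin (N + 1)) ℝ) (hP : ∀ i, (P i).IsHomogeneous d) :
    ∃ z : Fin (N + 1) → ℝ, ∑ l, z l ^ 2 = 1 ∧ ∀ i, eval z (P i) = 0 := by
  have h1 : ∀ M : ℕ, ∃ z : Fin (N + 1) → ℝ, ∑ l, z l ^ 2 = 1 ∧ ∀ i, |eval z (P i)| ≤ 1 / ((M : ℝ) + 1) := by
    intro M
    obtain ⟨u, hu, c, hc⟩ := gen_zero (f := fun i => aeval (Fin.cons 1 X : Fin (N + 1) → MvPolynomial (Fin N) ℝ) (P i)) hd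
      (fun i => (totalDegree_aeval_le _ (fun l => by refine Fin.cases ?_ (fun l => ?_) l <;> simp) _).trans (hP i).totalDegree_le) ((M : ℝ) + 1)
    set w : Fin (N + 1) → ℝ := Fin.cons 1 c with hw
    have he : ∀ i, eval c (aeval (Fin.cons 1 X : Fin (N + 1) → MvPolynomial (Fin N) ℝ) (P i)) = eval w (P i) := by
      intro i
      rw [← coe_aeval_eq_eval, ← coe_aeval_eq_eval, RingHom.coe_coe, RingHom.coe_coe, ← AlgHom.comp_apply, comp_aeval]
      congr 2
      ext l; refine Fin.cases ?_ (fun l => ?_) l <;> simp [hw]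
    set s := ∑ l, w l ^ 2 with hs
    have hs0 : 0 < s := by
      rw [hs, Fin.sum_univ_succ]
      have : 0 ≤ ∑ i : Fin N, w i.succ ^ 2 := Finset.sum_nonneg fun _ _ => sq_nonneg _
      simp only [hw, Fin.cons_zero] at *
      linarith
    set r := (Real.sqrt s)⁻¹ with hr
    have hr2 : r ^ 2 * s = 1 := by rw [hr, inv_pow, Real.sq_sqrt hs0.le, inv_mul_cancel₀ hs0.ne']
    have hsp : ∑ l, (r • w) l ^ 2 = 1 := by
      rw [← hr2, hs, Finset.mul_sum]
      refine Finset.sum_congr rfl fun l _ => by simp [mul_pow]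
    refine ⟨r • w, hsp, fun i => ?_⟩
    have h2 := hc i
    rw [he] at h2
    have hu0 : 0 < u := lt_trans (by positivity) hu
    have h3 : u * eval (r • w) (P i) = - ((r • w) i.succ) ^ d := by
      rw [homog_eval (hP i)]
      simp only [Pi.smul_apply, smul_eq_mul, hw, Fin.cons_succ, mul_pow]
      linear_combination r ^ d * h2
    have h4 := pow_le_one₀ (n := d) (abs_nonneg _) (sphere_le hsp i.succ)
    have h5 : u * |eval (r • w) (P i)| ≤ 1 := by
      have := congrArg abs h3
      rw [abs_mul, abs_of_pos hu0, abs_neg, abs_pow] at this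
      rw [this]; exact h4
    rw [le_div_iff₀ (by positivity)]
    nlinarith [abs_nonneg (eval (r • w) (P i)), show (M : ℝ) + 1 < u from hu]
  choose z hz1 hz2 using h1
  obtain ⟨y, hy, φ, hφ, hlim⟩ := (sphere_compact (N + 1)).tendsto_subseq (fun M => hz1 M)
  refine ⟨y, hy, fun i => ?_⟩
  have t1 : Tendsto (fun k => |eval (z (φ k)) (P i)|) atTop (𝓝 |eval y (P i)|) :=
    (((continuous_eval' (P i)).abs.tendsto y).comp hlim)
  have t2 : Tendsto (fun k => 1 / ((φ k : ℝ) + 1)) atTop (𝓝 0) := tendsto_one_div_add_atTop_nhds_zero_nat.comp hφ.tendsto_atTop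
  exact abs_nonpos_iff.1 (le_of_tendsto_of_tendsto' t1 t2 fun k => hz2 (φ k) i)
def hh (t : ℝ) : ℝ := (3 * t - t ^ 3) / 2
lemma hh_neg (M : ℕ) (t : ℝ) : hh^[M] (-t) = - hh^[M] t := by
  induction M generalizing t with
  | zero => rfl
  | succ M ih => rw [Function.iterate_succ_apply, Function.iterate_succ_apply, ← ih]; congr 1; simp only [hh]; ring
lemma hh_pos (M : ℕ) {t ε : ℝ} (hε : 0 < ε) (h1 : ε ≤ t) (h2 : t ≤ 1) : ε ≤ hh^[M] t ∧ hh^[M] t ≤ 1 ∧ 1 - hh^[M] t ≤ (1 - ε / 2) ^ M := by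
  induction M with
  | zero => simp; exact ⟨h1, h2, by linarith⟩
  | succ M ih =>
    rw [Function.iterate_succ_apply']
    set s := hh^[M] t
    obtain ⟨i1, i2, i3⟩ := ih
    have e1 : hh s - s = s * ((1 - s) * (1 + s)) / 2 := by simp only [hh]; ring
    have e2 : 1 - hh s = (1 - s) * (1 - (s + s ^ 2) / 2) := by simp only [hh]; ring
    have p1 : 0 ≤ s * ((1 - s) * (1 + s)) := mul_nonneg (by linarith) (mul_nonneg (by linarith) (by linarith))
    have p2 : 0 ≤ (1 - s) * (1 - (s + s ^ 2) / 2) := mul_nonneg (by linarith) (by nlinarith)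
    refine ⟨by linarith, by linarith, ?_⟩
    rw [e2, pow_succ]
    refine mul_le_mul i3 (by nlinarith) (by nlinarith) ((sub_nonneg.2 i2).trans i3)
lemma hh_abs (M : ℕ) {t : ℝ} (h : |t| ≤ 1) : |hh^[M] t| ≤ 1 := by
  obtain ⟨h1, h2⟩ := abs_le.1 h
  rcases lt_trichotomy t 0 with h0 | h0 | h0
  · have := hh_pos M (neg_pos.2 h0) le_rfl (by linarith)
    rw [hh_neg] at this
    exact abs_le.2 ⟨by linarith [this.2.1], by linarith [this.1]⟩
  · subst h0
    have := hh_neg M 0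
    rw [neg_zero] at this
    rw [show hh^[M] 0 = 0 by linarith]; simp
  · have := hh_pos M h0 le_rfl h2
    exact abs_le.2 ⟨by linarith [this.1], this.2.1⟩
def HM {N : ℕ} (L : MvPolynomial (Fin N) ℝ) : ℕ → MvPolynomial (Fin N) ℝ
  | 0 => L
  | M + 1 => C (1 / 2) * (C 3 * (HM L M * (∑ l, X l ^ 2) ^ (3 ^ M)) - HM L M ^ 3)
lemma HM_homog {N : ℕ} {L : MvPolynomial (Fin N) ℝ} (hL : L.IsHomogeneous 1) (M : ℕ) : (HM L M).IsHomogeneous (3 ^ M) := by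
  induction M with
  | zero => exact hL
  | succ M ih =>
    refine IsHomogeneous.C_mul (IsHomogeneous.sub (IsHomogeneous.C_mul ?_ _) ?_) _
    · have h : (∑ l : Fin N, X l ^ 2 : MvPolynomial (Fin N) ℝ).IsHomogeneous 2 := IsHomogeneous.sum _ _ _ fun l _ => isHomogeneous_X_pow l 2
      have := ih.mul (h.pow (3 ^ M))
      rwa [show 3 ^ M + 2 * 3 ^ M = 3 ^ (M + 1) by ring] at this
    · rw [pow_succ]; exact ih.pow 3
lemma HM_eval {N : ℕ} {L : MvPolynomial (Fin N) ℝ} {z : Fin N → ℝ} (hz : ∑ l, z l ^ 2 = 1) (M : ℕ) : eval z (HM L M) = hh^[M] (eval z L) := by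
  induction M with
  | zero => rfl
  | succ M ih =>
    rw [Function.iterate_succ_apply', ← ih, HM]
    simp [hz, hh]; ring
theorem ham0 {N : ℕ} {α : Type} (v : α → Fin (N + 1) → ℝ) (hv : ∀ x, ∑ l, |v x l| ≤ 1) (S : Fin N → Finset α) :
    ∃ z : Fin (N + 1) → ℝ, z ≠ 0 ∧ ∀ i, 2 * ((S i).filter fun x => 0 < ∑ l, z l * v x l).card ≤ (S i).card ∧
      2 * ((S i).filter fun x => ∑ l, z l * v x l < 0).card ≤ (S i).card := by
  classical
  let L : α → MvPolynomial (Fin (N + 1)) ℝ := fun x => ∑ l, C (v x l) * X l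
  have hL : ∀ x, (L x).IsHomogeneous 1 := fun x => IsHomogeneous.sum _ _ _ fun l _ => isHomogeneous_C_mul_X _ _
  have hLe : ∀ x z, eval z (L x) = ∑ l, z l * v x l := fun x z => by simp [L, mul_comm]
  have hL1 : ∀ (x : α) (z : Fin (N + 1) → ℝ), ∑ l, z l ^ 2 = 1 → |∑ l, z l * v x l| ≤ 1 := by
    intro x z hz
    refine (Finset.abs_sum_le_sum_abs _ _).trans (le_trans (Finset.sum_le_sum fun l _ => ?_) (hv x))
    rw [abs_mul]; exact mul_le_of_le_one_left (abs_nonneg _) (sphere_le hz l)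
  have h1 := fun M : ℕ => odd_forms (d := 3 ^ M) (Odd.pow (by decide)) (fun i => ∑ x ∈ S i, HM (L x) M) (fun i => IsHomogeneous.sum _ _ _ fun x _ => HM_homog (hL x) M)
  choose z hz1 hz2 using h1
  have hz3 : ∀ M i, ∑ x ∈ S i, hh^[M] (∑ l, z M l * v x l) = 0 := by
    intro M i
    rw [← hz2 M i, map_sum]
    exact Finset.sum_congr rfl fun x _ => by rw [HM_eval (hz1 M), hLe]
  obtain ⟨y, hy, φ, hφ, hlim⟩ := (sphere_compact (N + 1)).tendsto_subseq (fun M => hz1 M)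
  have key : ∀ (w : ℕ → Fin (N + 1) → ℝ) (y : Fin (N + 1) → ℝ) (i : Fin N), (∀ k, ∑ l, w k l ^ 2 = 1) → Tendsto w atTop (𝓝 y) →
      (∀ k, ∑ x ∈ S i, hh^[φ k] (∑ l, w k l * v x l) = 0) → 2 * ((S i).filter fun x => 0 < ∑ l, y l * v x l).card ≤ (S i).card := by
    intro w y i hw hwy h0
    have hcard := Finset.card_filter_add_card_filter_not (s := S i) (fun x => 0 < ∑ l, y l * v x l)
    have hlim : Tendsto (fun k => ∑ x ∈ (S i).filter (fun x => 0 < ∑ l, y l * v x l), hh^[φ k] (∑ l, w k l * v x l)) atTop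
        (𝓝 (∑ x ∈ (S i).filter (fun x => 0 < ∑ l, y l * v x l), (1 : ℝ))) := by
      refine tendsto_finsetSum _ fun x hx => ?_
      have hx0 := (Finset.mem_filter.1 hx).2
      have t1 : Tendsto (fun k => ∑ l, w k l * v x l) atTop (𝓝 (∑ l, y l * v x l)) :=
        ((by fun_prop : Continuous fun y : Fin (N + 1) → ℝ => ∑ l, y l * v x l).tendsto y).comp hwy
      set ε := (∑ l, y l * v x l) / 2 with hε
      have hε0 : 0 < ε := by positivity
      have ev := t1.eventually (lt_mem_nhds (show ε < ∑ l, y l * v x l by linarith))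
      have hε1 : ε ≤ 1 := by
        obtain ⟨k, hk⟩ := ev.exists
        exact hk.le.trans ((le_abs_self _).trans (hL1 x _ (hw k)))
      have t2 : Tendsto (fun k => 1 - (1 - ε / 2) ^ φ k) atTop (𝓝 1) := by
        have := (tendsto_pow_atTop_nhds_zero_of_lt_one (show 0 ≤ 1 - ε / 2 by linarith) (by linarith)).comp hφ.tendsto_atTop
        simpa using this.const_sub 1
      refine tendsto_of_tendsto_of_tendsto_of_le_of_le' t2 tendsto_const_nhds ?_ ?_
      · filter_upwards [ev] with k hk
        linarith [(hh_pos (φ k) hε0 hk.le ((le_abs_self _).trans (hL1 x _ (hw k)))).2.2]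
      · filter_upwards [ev] with k hk
        exact (hh_pos (φ k) hε0 hk.le ((le_abs_self _).trans (hL1 x _ (hw k)))).2.1
    have hle : (∑ x ∈ (S i).filter (fun x => 0 < ∑ l, y l * v x l), (1 : ℝ)) ≤ ((S i).filter (fun x => ¬ 0 < ∑ l, y l * v x l)).card := by
      refine le_of_tendsto' hlim fun k => ?_
      have e1 := h0 k
      rw [← Finset.sum_filter_add_sum_filter_not (S i) (fun x => 0 < ∑ l, y l * v x l)] at e1
      have e2 : -((((S i).filter (fun x => ¬ 0 < ∑ l, y l * v x l)).card : ℝ)) ≤ ∑ x ∈ (S i).filter (fun x => ¬ 0 < ∑ l, y l * v x l), hh^[φ k] (∑ l, w k l * v x l) := by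
        have := Finset.card_nsmul_le_sum ((S i).filter (fun x => ¬ 0 < ∑ l, y l * v x l)) (fun x => hh^[φ k] (∑ l, w k l * v x l)) (-1)
          (fun x _ => (abs_le.1 (hh_abs _ (hL1 x _ (hw k)))).1)
        simpa using this
      linarith
    rw [Finset.sum_const, nsmul_eq_mul, mul_one] at hle
    have := Nat.cast_le.1 hle
    omega
  refine ⟨y, ?_, fun i => ⟨key _ y i (fun k => hz1 (φ k)) hlim (fun k => hz3 (φ k) i), ?_⟩⟩
  · rintro rfl
    have : ∑ l : Fin (N + 1), (0 : Fin (N + 1) → ℝ) l ^ 2 = 1 := hy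
    simp at this
  · have := key (fun k => -(z (φ k))) (-y) i (fun k => by simpa using hz1 (φ k)) hlim.neg (fun k => by
      have := hz3 (φ k) i
      simp only [Pi.neg_apply, neg_mul, Finset.sum_neg_distrib, hh_neg, this, neg_zero])
    simpa using this
theorem ham {N : ℕ} {α : Type} (v : α → Fin (N + 1) → ℝ) (S : Fin N → Finset α) :
    ∃ z : Fin (N + 1) → ℝ, z ≠ 0 ∧ ∀ i, 2 * ((S i).filter fun x => 0 < ∑ l, z l * v x l).card ≤ (S i).card ∧
      2 * ((S i).filter fun x => ∑ l, z l * v x l < 0).card ≤ (S i).card := by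
  set r : α → ℝ := fun x => (1 + ∑ l, |v x l|)⁻¹ with hr
  have h0 : ∀ x, 0 ≤ ∑ l, |v x l| := fun x => Finset.sum_nonneg fun _ _ => abs_nonneg _
  have hrp : ∀ x, 0 < r x := fun x => inv_pos.2 (by linarith [h0 x])
  obtain ⟨z, hz, h⟩ := ham0 (fun x l => r x * v x l) (fun x => by
    simp only [abs_mul, abs_of_pos (hrp x), ← Finset.mul_sum]
    rw [hr]; simp only
    rw [inv_mul_le_iff₀ (by linarith [h0 x])]; linarith) S
  refine ⟨z, hz, fun i => ?_⟩
  have e : ∀ x, ∑ l, z l * (r x * v x l) = r x * ∑ l, z l * v x l := fun x => by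
    rw [Finset.mul_sum]; exact Finset.sum_congr rfl fun l _ => by ring
  have e2 : ∀ (x : α) (a : ℝ), r x * a < 0 ↔ a < 0 := fun x a => by
    rw [mul_neg_iff]; have := hrp x; grind
  have := h i
  simp only [e, mul_pos_iff_of_pos_left (hrp _), e2] at this
  exact this
end Ham

section Part
open Classical
lemma kst_nat {α β : Type*} {R : α → β → Prop} {S : Finset α} {T : Finset β} {k b : ℕ} (h : KBFree R S T k b) :
    ∑ t ∈ T, ((S.filter fun x => R x t).card - k) ^ k ≤ b * S.card ^ k := by
  have h1 : ∑ t ∈ T, ((S.filter fun x => R x t).card).choose k ≤ b * S.card.choose k := by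
    have e1 : ∀ t ∈ T, ((S.filter fun x => R x t).card).choose k = ∑ P ∈ S.powersetCard k, if ∀ x ∈ P, R x t then 1 else 0 := by
      intro t _
      rw [← Finset.card_powersetCard, ← Finset.card_filter]
      congr 1
      ext P
      simp only [Finset.mem_powersetCard, Finset.mem_filter, Finset.subset_iff]
      grind
    rw [Finset.sum_congr rfl e1, Finset.sum_comm, ← Finset.card_powersetCard k S, mul_comm, ← smul_eq_mul]
    refine Finset.sum_le_card_nsmul _ _ _ fun P hP => ?_
    rw [← Finset.card_filter]
    by_contra! hc
    obtain ⟨B, hB, hBc⟩ := Finset.exists_subset_card_eq hc.le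
    obtain ⟨hP1, hP2⟩ := Finset.mem_powersetCard.1 hP
    exact h ⟨P, B, hP1, hB.trans (Finset.filter_subset _ _), hP2, hBc, fun s hs t ht => (Finset.mem_filter.1 (hB ht)).2 s hs⟩
  calc _ ≤ ∑ t ∈ T, k.factorial * ((S.filter fun x => R x t).card).choose k := by
        refine Finset.sum_le_sum fun t _ => ?_
        rw [← Nat.descFactorial_eq_factorial_mul_choose]
        exact (Nat.pow_le_pow_left (by omega) k).trans (Nat.pow_sub_le_descFactorial _ _)
    _ ≤ k.factorial * (b * S.card.choose k) := by rw [← Finset.mul_sum]; exact Nat.mul_le_mul_left _ h1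
    _ = b * S.card.descFactorial k := by rw [Nat.descFactorial_eq_factorial_mul_choose]; ring
    _ ≤ _ := Nat.mul_le_mul_left _ (Nat.descFactorial_le_pow _ _)
lemma kst {α β : Type*} {R : α → β → Prop} {S : Finset α} {T : Finset β} {k b : ℕ} (hk : 1 ≤ k) (h : KBFree R S T k b)
    {θ X : ℝ} (hθ : 0 < θ) (hX : b ≤ θ ^ k * X) :
    ((∑ t ∈ T, (S.filter fun x => R x t).card : ℕ) : ℝ) ≤ θ * S.card * (X + T.card) + k * T.card := by
  have h1 := kst_nat h
  obtain ⟨j, rfl⟩ : ∃ j, k = j + 1 := ⟨k - 1, by omega⟩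
  rcases S.eq_empty_or_nonempty with rfl | hS
  · simp; positivity
  have hs : (0 : ℝ) < S.card := by exact_mod_cast hS.card_pos
  set Y := θ * S.card with hY
  have hY0 : 0 < Y := by positivity
  set a : β → ℝ := fun t => (((S.filter fun x => R x t).card - (j + 1) : ℕ) : ℝ) with ha
  have h2 : ∀ t ∈ T, ((S.filter fun x => R x t).card : ℝ) ≤ (j + 1 : ℕ) + (Y + a t ^ (j + 1) / Y ^ j) := by
    intro t _
    have e1 : ((S.filter fun x => R x t).card : ℝ) ≤ (j + 1 : ℕ) + a t := by
      simp only [ha]; norm_cast; omega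
    have e2 : a t ≤ Y + a t ^ (j + 1) / Y ^ j := by
      have ha0 : 0 ≤ a t := by simp [ha]
      rcases le_total (a t) Y with h | h
      · have : 0 ≤ a t ^ (j + 1) / Y ^ j := by positivity
        linarith
      · have : a t ≤ a t ^ (j + 1) / Y ^ j := by
          rw [le_div_iff₀ (by positivity), pow_succ']
          exact mul_le_mul_of_nonneg_left (pow_le_pow_left₀ hY0.le h j) ha0
        linarith
    linarith
  have h3 : ∑ t ∈ T, a t ^ (j + 1) ≤ b * (S.card : ℝ) ^ (j + 1) := by simp only [ha]; exact_mod_cast h1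
  have h4 : b * (S.card : ℝ) ^ (j + 1) / Y ^ j ≤ Y * X := by
    rw [div_le_iff₀ (by positivity), hY, mul_pow]
    calc _ ≤ θ ^ (j + 1) * X * (S.card : ℝ) ^ (j + 1) := by gcongr
      _ = _ := by ring
  push_cast
  calc _ ≤ ∑ t ∈ T, (((j + 1 : ℕ) : ℝ) + (Y + a t ^ (j + 1) / Y ^ j)) := Finset.sum_le_sum h2
    _ = T.card * (j + 1 : ℕ) + (T.card * Y + (∑ t ∈ T, a t ^ (j + 1)) / Y ^ j) := by
      rw [Finset.sum_add_distrib, Finset.sum_add_distrib, Finset.sum_div]; simp; ring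
    _ ≤ T.card * (j + 1 : ℕ) + (T.card * Y + Y * X) := by
      gcongr
      exact (div_le_div_of_nonneg_right h3 (by positivity)).trans h4
    _ = _ := by push_cast; ring
variable {n : ℕ}
lemma exists_indep {k : Type*} [Field k] (p : Ideal (MvPolynomial (Fin n) k)) {m N : ℕ} (h : N ≤ hf p m) :
    ∃ w : Fin N → MvPolynomial (Fin n) k, (∀ i, (w i).totalDegree ≤ m) ∧ ∀ c : Fin N → k, ∑ i, c i • w i ∈ p → c = 0 := by
  obtain ⟨f, hf1⟩ := exists_linearIndependent_of_le_finrank h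
  choose w hw hwf using fun i => mem_Vm.1 (f i).2
  refine ⟨w, hw, fun c hc => ?_⟩
  rw [Fintype.linearIndependent_iff] at hf1
  refine funext fun i => hf1 c ?_ i
  apply Subtype.ext
  rw [← Ideal.Quotient.eq_zero_iff_mem] at hc
  rw [← Submodule.subtype_apply, map_sum]
  simp only [map_smul, Submodule.subtype_apply, ← hwf]
  rw [map_sum] at hc
  exact hc
lemma ham_poly (p : Ideal (MvPolynomial (Fin n) ℝ)) {m : ℕ} {ι : Type} [Fintype ι] (h : Fintype.card ι < hf p m) (S : ι → Finset (Fin n → ℝ)) :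
    ∃ P : MvPolynomial (Fin n) ℝ, P ∉ p ∧ P.totalDegree ≤ m ∧ ∀ i, 2 * ((S i).filter fun x => 0 < eval x P).card ≤ (S i).card ∧
      2 * ((S i).filter fun x => eval x P < 0).card ≤ (S i).card := by
  obtain ⟨w, hw, hi⟩ := exists_indep p (N := Fintype.card ι + 1) h
  obtain ⟨z, hz, H⟩ := ham (fun x l => eval x (w l)) (fun i => S ((Fintype.equivFin ι).symm i))
  refine ⟨∑ l, z l • w l, fun hc => hz (hi z hc), ?_, fun i => ?_⟩
  · exact td_sum_le _ _ fun i _ => (totalDegree_smul_le _ _).trans (hw i)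
  · have := H (Fintype.equivFin ι i)
    simpa [smul_eval] using this
def cellc (σ : Bool) (r : ℝ) : Prop := if σ then 0 < r else r < 0
def cell {I : ℕ} (P : Fin I → MvPolynomial (Fin n) ℝ) (S : Finset (Fin n → ℝ)) (σ : Fin I → Bool) : Finset (Fin n → ℝ) :=
  S.filter fun x => ∀ i, cellc (σ i) (eval x (P i))
lemma hf_pos (p : Ideal (MvPolynomial (Fin n) ℝ)) [hp : p.IsPrime] (m : ℕ) : 1 ≤ hf p m := by
  have := card_le_hf (q := p) (ι := Unit) (fun _ => 1) (m := m) (by simp) (by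
    intro c hc
    by_contra h0
    have h1 : c () ≠ 0 := fun h => h0 (funext fun _ => h)
    simp only [Finset.univ_unique, Finset.sum_singleton] at hc
    have := p.mul_mem_left (C (c ())⁻¹) hc
    rw [smul_eq_C_mul, ← mul_assoc, ← C_mul, PUnit.default_eq_unit, inv_mul_cancel₀ h1, C_1, mul_one] at this
    exact hp.ne_top ((Ideal.eq_top_iff_one p).2 this))
  simpa using this
theorem part_iter (p : Ideal (MvPolynomial (Fin n) ℝ)) (S : Finset (Fin n → ℝ)) (δ : ℕ → ℕ) (I : ℕ) (hδ : ∀ i < I, 2 ^ i < hf p (δ i)) :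
    ∃ P : Fin I → MvPolynomial (Fin n) ℝ, (∀ i, P i ∉ p) ∧ (∀ i, (P i).totalDegree ≤ δ i) ∧ ∀ σ, (cell P S σ).card * 2 ^ I ≤ S.card := by
  induction I with
  | zero => exact ⟨Fin.elim0, fun i => i.elim0, fun i => i.elim0, fun σ => by rw [pow_zero, mul_one]; exact Finset.card_filter_le _ _⟩
  | succ I ih =>
    obtain ⟨P, h1, h2, h3⟩ := ih fun i hi => hδ i (by omega)
    obtain ⟨Q, q1, q2, q3⟩ := ham_poly p (m := δ I) (ι := Fin I → Bool) (by simpa using hδ I (by omega)) (fun σ => cell P S σ)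
    refine ⟨Fin.snoc P Q, fun i => ?_, fun i => ?_, fun σ => ?_⟩
    · refine Fin.lastCases ?_ (fun i => ?_) i
      · simpa using q1
      · simpa using h1 i
    · refine Fin.lastCases ?_ (fun i => ?_) i
      · simpa using q2
      · simpa using h2 i
    · have e : cell (Fin.snoc P Q) S σ = (cell P S fun i => σ i.castSucc).filter fun x => cellc (σ (Fin.last I)) (eval x Q) := by
        ext x
        simp only [cell, Finset.mem_filter, Fin.forall_fin_succ', Fin.snoc_castSucc, Fin.snoc_last, and_assoc]
      have e2 : 2 * (cell (Fin.snoc P Q) S σ).card ≤ (cell P S fun i => σ i.castSucc).card := by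
        rw [e]
        cases hb : σ (Fin.last I)
        · simpa [cellc] using (q3 (fun i => σ i.castSucc)).2
        · simpa [cellc] using (q3 (fun i => σ i.castSucc)).1
      calc _ = 2 * (cell (Fin.snoc P Q) S σ).card * 2 ^ I := by ring
        _ ≤ _ := (Nat.mul_le_mul_right _ e2).trans (h3 _)
lemma geo_sum (n : ℕ) (hn : 1 ≤ n) : ∃ C : ℕ, ∀ (I A : ℕ) (δ : ℕ → ℕ), (∀ i < I, δ i ^ n * 2 ^ (I - i) ≤ A ^ n) → ∑ i ∈ Finset.range I, δ i ≤ C * A := by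
  set r : ℝ := (2 : ℝ) ^ (1 / (n : ℝ)) with hr
  have hr1 : 1 < r := Real.one_lt_rpow (by norm_num) (by positivity)
  have hrn : r ^ n = 2 := by rw [hr, ← Real.rpow_natCast, ← Real.rpow_mul (by norm_num)]; rw [one_div, inv_mul_cancel₀ (by positivity), Real.rpow_one]
  obtain ⟨C, hC⟩ := exists_nat_ge (1 / (r - 1))
  refine ⟨C, fun I A δ h => ?_⟩
  have h1 : ∀ J ≤ I, ∑ i ∈ Finset.range J, (δ i : ℝ) ≤ A * (1 / (r - 1)) * r ^ J / r ^ I := by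
    intro J
    induction J with
    | zero => intro _; simp; exact div_nonneg (mul_nonneg (by positivity) (inv_nonneg.2 (by linarith))) (by positivity)
    | succ J ih =>
      intro hJ
      rw [Finset.sum_range_succ]
      have e1 : (δ J : ℝ) ≤ A * r ^ J / r ^ I := by
        rw [le_div_iff₀ (by positivity)]
        have e0 : r ^ I = r ^ J * r ^ (I - J) := by rw [← pow_add]; congr 1; omega
        rw [e0, mul_comm (r ^ J), ← mul_assoc]
        refine mul_le_mul_of_nonneg_right ?_ (by positivity)
        refine le_of_pow_le_pow_left₀ (by omega : n ≠ 0) (by positivity) ?_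
        rw [mul_pow, ← pow_mul, mul_comm (I - J), pow_mul, hrn]
        exact_mod_cast h J (by omega)
      have e2 := ih (by omega)
      calc _ ≤ A * (1 / (r - 1)) * r ^ J / r ^ I + A * r ^ J / r ^ I := add_le_add e2 e1
        _ = _ := by
          have : r - 1 ≠ 0 := by linarith
          have : r ^ I ≠ 0 := by positivity
          field_simp; ring
  have h2 := h1 I le_rfl
  rw [mul_div_assoc, div_self (by positivity), mul_one] at h2
  have : (∑ i ∈ Finset.range I, (δ i : ℝ)) ≤ C * A := by nlinarith [show (0 : ℝ) ≤ A by positivity]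
  exact_mod_cast this
theorem partition (n : ℕ) (hn : 1 ≤ n) : ∃ C : ℕ, ∀ (p : Ideal (MvPolynomial (Fin n) ℝ)) [p.IsPrime] (D : ℕ) (S : Finset (Fin n → ℝ)),
    ∃ (I : ℕ) (P : Fin I → MvPolynomial (Fin n) ℝ), 2 ^ I ≤ hf p D ∧ hf p D ≤ 2 * 2 ^ I ∧ (∀ i, P i ∉ p) ∧
      (∏ i, P i).totalDegree ≤ C * (D + 1) ∧ ∀ σ, (cell P S σ).card * 2 ^ I ≤ S.card := by
  obtain ⟨C, hC⟩ := geo_sum n hn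
  refine ⟨C * cB n, fun p _ D S => ?_⟩
  set I := Nat.log 2 (hf p D) with hI
  have hI1 : 2 ^ I ≤ hf p D := Nat.pow_log_le_self 2 (by have := hf_pos p D; omega)
  have hI2 : hf p D < 2 ^ (I + 1) := Nat.lt_pow_succ_log_self (by norm_num) _
  have hex : ∀ i, ∃ m, i < I → 2 ^ i < hf p m := fun i => ⟨D, fun h => lt_of_lt_of_le (Nat.pow_lt_pow_right (by norm_num) h) hI1⟩
  set δ : ℕ → ℕ := fun i => Nat.find (hex i) with hδ
  obtain ⟨P, h1, h2, h3⟩ := part_iter p S δ I (fun i hi => Nat.find_spec (hex i) hi)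
  refine ⟨I, P, hI1, by rw [pow_succ] at hI2; omega, h1, ?_, h3⟩
  refine (totalDegree_finsetProd _ _).trans ((Finset.sum_le_sum fun i _ => h2 i).trans ?_)
  rw [Fin.sum_univ_eq_sum_range δ I, mul_assoc]
  refine hC I _ δ fun i hi => ?_
  rcases Nat.eq_zero_or_pos (δ i) with h0 | h0
  · rw [h0, zero_pow (by omega)]; simp
  have hle : δ i ≤ D := Nat.find_min' (hex i) fun h => lt_of_lt_of_le (Nat.pow_lt_pow_right (by norm_num) h) hI1
  have hm : hf p (δ i - 1) ≤ 2 ^ i := by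
    have := Nat.find_min (hex i) (show δ i - 1 < Nat.find (hex i) from by change δ i - 1 < δ i; omega)
    push Not at this
    exact this.2
  have hd := hf_doubling p (show δ i - 1 ≤ D by omega)
  rw [Nat.sub_add_cancel h0] at hd
  have h4 : 2 ^ I * δ i ^ n ≤ cB n * (D + 1) ^ n * 2 ^ i :=
    (Nat.mul_le_mul_right _ hI1).trans (hd.trans (Nat.mul_le_mul_left _ hm))
  have e0 : 2 ^ I = 2 ^ (I - i) * 2 ^ i := by rw [← pow_add]; congr 1; omega
  rw [e0, mul_right_comm] at h4
  have h5 := Nat.le_of_mul_le_mul_right h4 (by positivity)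
  rw [mul_comm]
  refine h5.trans ?_
  rw [mul_pow]
  exact Nat.mul_le_mul_right _ (Nat.le_self_pow (by omega) _)
end Part

section Inc
open Classical
variable {n : ℕ}
lemma pts0 {q : Ideal (MvPolynomial (Fin n) ℝ)} {N : ℕ} (hq : IsHF q 0 N) {S : Finset (Fin n → ℝ)} (hS : ∀ x ∈ S, x ∈ ZR q) : S.card ≤ N := by
  let f : S → MvPolynomial (Fin n) ℝ := fun x => ∏ y ∈ S.erase x, ∑ i, (X i - C (y i)) ^ 2
  have hfe : ∀ (x : S) (z : S), eval z.1 (f x) = ∏ y ∈ S.erase x, ∑ i, (z.1 i - y i) ^ 2 := by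
    intro x z; simp [f]
  have h := card_le_hf (q := q) f (m := ∑ x, (f x).totalDegree) (fun i => Finset.single_le_sum (f := fun x => (f x).totalDegree) (fun _ _ => Nat.zero_le _) (Finset.mem_univ i)) (by
    intro c hc
    funext z
    have h1 := hS z.1 z.2 _ hc
    rw [map_sum, Finset.sum_eq_single z] at h1
    · rw [smul_eval, hfe] at h1
      refine (mul_eq_zero.1 h1).resolve_right (Finset.prod_ne_zero_iff.2 fun y hy h0 => (Finset.mem_erase.1 hy).1 ?_)
      funext i
      have := (Finset.sum_eq_zero_iff_of_nonneg fun i _ => sq_nonneg _).1 h0 i (Finset.mem_univ i)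
      have := pow_eq_zero_iff (two_ne_zero) |>.1 this
      linarith
    · intro x _ hx
      rw [smul_eval, hfe]
      rw [Finset.prod_eq_zero (Finset.mem_erase.2 ⟨fun h => hx (Subtype.ext h.symm), z.2⟩)]; · simp
      simp
    · simp)
  have := hq.upper (∑ x, (f x).totalDegree)
  simp at this
  simpa using h.trans this
lemma card_cover {ι α : Type*} [Fintype ι] {S : Finset α} {R : ι → α → Prop} (h : ∀ x ∈ S, ∃ i, R i x) : S.card ≤ ∑ i, (S.filter (R i)).card := by
  refine le_trans (Finset.card_le_card ?_) Finset.card_biUnion_le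
  intro x hx
  obtain ⟨i, hi⟩ := h x hx
  simp only [Finset.mem_biUnion, Finset.mem_filter]
  exact ⟨i, Finset.mem_univ _, hx, hi⟩
lemma comps_pt {p : Ideal (MvPolynomial (Fin n) ℝ)} [p.IsPrime] {e N : ℕ} (hp : IsHF p e N)
    {g : MvPolynomial (Fin n) ℝ} (hg : g ∉ p) {δ : ℕ} (hδ : g.totalDegree ≤ δ) :
    ∃ (ι : Type) (_ : Fintype ι) (q : ι → Ideal (MvPolynomial (Fin n) ℝ)) (N' : ι → ℕ),
      (∀ i, (q i).IsPrime) ∧ (∀ i, IsHF (q i) (e - 1) (N' i)) ∧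
      (∀ _ : ι, 1 ≤ e) ∧ ∑ i, N' i ≤ δ * N ∧
      (∀ x ∈ ZR p, eval x g = 0 → ∃ i, x ∈ ZR (q i)) := by
  obtain ⟨ι, h0, q, N', h1, -, -, h2, h3, h4, h5⟩ := comps hp hg hδ
  exact ⟨ι, h0, q, N', h1, h2, h3, h4, fun x hx hxg => h5 _ (ker_eval_prime x) (mem_ZR_iff.1 hx) hxg⟩
lemma cellc_mul {σ : Bool} {a b : ℝ} (h1 : cellc σ a) : cellc σ b ↔ 0 < a * b := by
  cases σ
  · simp only [cellc, Bool.false_eq_true, if_false] at *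
    rw [mul_pos_iff]; grind
  · simp only [cellc, if_true] at *
    rw [mul_pos_iff]; grind
lemma cellc_ne {σ : Bool} {a : ℝ} (h1 : cellc σ a) : a ≠ 0 := by
  cases σ <;> simp only [cellc, Bool.false_eq_true, if_false, if_true] at h1 <;> grind
lemma cellc_inj {σ σ' : Bool} {a : ℝ} (h1 : cellc σ a) (h2 : cellc σ' a) : σ = σ' := by
  cases σ <;> cases σ' <;> simp [cellc] at * <;> linarith
lemma crossT (n C1 : ℕ) : ∃ K : ℕ, ∀ (p : Ideal (MvPolynomial (Fin n) ℝ)) [p.IsPrime] (D I w : ℕ) (P : Fin I → MvPolynomial (Fin n) ℝ)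
    (S : Finset (Fin n → ℝ)) (g : MvPolynomial (Fin n) ℝ), (∏ i, P i).totalDegree ≤ C1 * (D + 1) → (∀ x ∈ S, x ∈ ZR p) → g ∉ p → g.totalDegree ≤ w →
    (D + 1) * (Finset.univ.filter fun σ => ∃ x ∈ cell P S σ, eval x g = 0).card ≤ K * (w * hf p D) := by
  obtain ⟨C2, -, hC2⟩ := cross n
  refine ⟨C2 * (C1 + 1) ^ n * cB n, fun p _ D I w P S g hP hS hg hw => ?_⟩
  set A := Finset.univ.filter fun σ => ∃ x ∈ cell P S σ, eval x g = 0 with hA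
  choose! r hr1 hr2 using fun σ (h : σ ∈ A) => (Finset.mem_filter.1 h).2
  have hcell : ∀ σ ∈ A, r σ ∈ S ∧ ∀ i, cellc (σ i) (eval (r σ) (P i)) := fun σ hσ => Finset.mem_filter.1 (hr1 σ hσ)
  have hinj : Set.InjOn r A := by
    intro σ hσ σ' hσ' h
    funext i
    have h1 := (hcell σ' hσ').2 i
    rw [← h] at h1
    exact cellc_inj ((hcell σ hσ).2 i) h1
  have hcard := Finset.card_image_of_injOn hinj
  have hsep : Sep P (A.image r) := by
    refine ⟨fun x hx j => ?_, fun x hx y hy hxy => ?_⟩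
    · obtain ⟨σ, hσ, rfl⟩ := Finset.mem_image.1 hx
      exact cellc_ne ((hcell σ hσ).2 j)
    · obtain ⟨σ, hσ, rfl⟩ := Finset.mem_image.1 hx
      obtain ⟨σ', hσ', rfl⟩ := Finset.mem_image.1 hy
      congr 1
      funext i
      exact cellc_inj ((cellc_mul ((hcell σ hσ).2 i)).2 (hxy i)) ((hcell σ' hσ').2 i)
  obtain ⟨q, e, N, hq⟩ := exists_Apx p D
  have := hq.prime
  obtain ⟨ι, _, Q, N', h1, h2, h3, h4, h5⟩ := comps_pt hq.isHF (fun h => hg (hq.le h)) hw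
  have hcov : ∀ x ∈ A.image r, ∃ i, x ∈ ZR (Q i) := by
    intro x hx
    obtain ⟨σ, hσ, rfl⟩ := Finset.mem_image.1 hx
    refine h5 _ (fun f hf => hS _ (hcell σ hσ).1 f (hq.le hf)) (hr2 σ hσ)
  rcases A.eq_empty_or_nonempty with h0 | ⟨σ0, hσ0⟩
  · rw [h0]; simp
  obtain ⟨i0, -⟩ := hcov _ (Finset.mem_image_of_mem r hσ0)
  have he := h3 i0
  have hen := hq.isHF.le_n
  rw [hq.hf_eq' le_rfl, ← hcard]
  have hb : C1 * (D + 1) + 1 ≤ (C1 + 1) * (D + 1) := by nlinarith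
  calc _ ≤ (D + 1) * ∑ i, C2 * (N' i * ((C1 + 1) * (D + 1)) ^ (e - 1)) := by
        refine Nat.mul_le_mul_left _ ((card_cover hcov).trans (Finset.sum_le_sum fun i _ => ?_))
        have := h1 i
        refine (hC2 (e - 1) (Q i) (N' i) I _ P _ (h2 i) hP (fun x hx => (Finset.mem_filter.1 hx).2) (hsep.mono (Finset.filter_subset _ _))).trans ?_
        gcongr
    _ = C2 * (C1 + 1) ^ (e - 1) * ((∑ i, N' i) * ((D + 1) ^ (e - 1) * (D + 1))) := by
        rw [← Finset.mul_sum, ← Finset.sum_mul, mul_pow]; ring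
    _ ≤ C2 * (C1 + 1) ^ n * (w * N * (D + 1) ^ e) := by
        rw [← pow_succ, Nat.sub_add_cancel he]
        gcongr
        · omega
        · omega
    _ = C2 * (C1 + 1) ^ n * w * (N * (D + 1) ^ e) := by ring
    _ ≤ C2 * (C1 + 1) ^ n * w * (cB n * hf q D) := Nat.mul_le_mul_left _ hq.good
    _ = _ := by ring
lemma KBFree.mono {α β : Type*} {R : α → β → Prop} {S S' : Finset α} {T T' : Finset β} {k b : ℕ} (h : KBFree R S T k b) (hS : S' ⊆ S) (hT : T' ⊆ T) :
    KBFree R S' T' k b := fun ⟨P, B, h1, h2, h3⟩ => h ⟨P, B, h1.trans hS, h2.trans hT, h3⟩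
def inc {τ : Type} (S : Finset (Fin n → ℝ)) (T : Finset τ) (g : τ → MvPolynomial (Fin n) ℝ) : ℕ :=
  ∑ t ∈ T, (S.filter fun x => eval x (g t) = 0).card
def IncB' (n e C : ℕ) (Q : Prop) : Prop := ∀ (p : Ideal (MvPolynomial (Fin n) ℝ)) [p.IsPrime] (N : ℕ) (S : Finset (Fin n → ℝ)) (τ : Type) (T : Finset τ)
  (g : τ → MvPolynomial (Fin n) ℝ) (w : τ → ℕ) (k b D W : ℕ) (θ : ℝ), (Q → ∀ t ∈ T, g t ∉ p) → IsHF p (e + 1) N → (∀ x ∈ S, x ∈ ZR p) →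
  (∀ t ∈ T, 1 ≤ w t ∧ (g t).totalDegree ≤ w t) → ∑ t ∈ T, w t ≤ W → 1 ≤ k → 1 ≤ b → 1 ≤ D → 0 < θ → (b * D : ℝ) ≤ θ ^ k * W →
  KBFree (fun x t => eval x (g t) = 0) S T k b →
  (inc S T g : ℝ) ≤ C * (k * W * N * D ^ e + θ * S.card * W / D) + (b - 1) * S.card
lemma peel {e C : ℕ} (hC : 1 ≤ C) (h : IncB' n e C True) : IncB' n e C False := by
  intro p _ N S τ T g w k b D W θ _ hp hS hw hW hk hb hD hθ hX hfree
  set T1 := T.filter fun t => g t ∈ p with hT1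
  set T2 := T.filter fun t => ¬ g t ∈ p with hT2
  have hsplit : inc S T g = inc S T1 g + inc S T2 g := (Finset.sum_filter_add_sum_filter_not T _ _).symm
  have hTc : T.card ≤ W := by
    refine le_trans ?_ hW
    rw [Finset.card_eq_sum_ones]; exact Finset.sum_le_sum fun t ht => (hw t ht).1
  have hD' : (1 : ℝ) ≤ D := by exact_mod_cast hD
  have hb' : (1 : ℝ) ≤ b := by exact_mod_cast hb
  have hz : ∀ t ∈ T1, ∀ x ∈ S, eval x (g t) = 0 := fun t ht x hx => hS x hx _ (Finset.mem_filter.1 ht).2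
  rcases le_or_gt b T1.card with hj | hj
  · have hSk : S.card ≤ k := by
      by_contra! hc
      obtain ⟨P, hP, hPc⟩ := Finset.exists_subset_card_eq hc.le
      obtain ⟨B, hB, hBc⟩ := Finset.exists_subset_card_eq hj
      exact hfree ⟨P, B, hP, hB.trans (Finset.filter_subset _ _), hPc, hBc, fun s hs t ht => hz t (hB ht) s (hP hs)⟩
    have h1 : inc S T g ≤ k * W := by
      refine (Finset.sum_le_card_nsmul _ _ k fun t _ => (Finset.card_filter_le _ _).trans hSk).trans ?_
      rw [smul_eq_mul, mul_comm]; exact Nat.mul_le_mul_left _ hTc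
    have h2 : (inc S T g : ℝ) ≤ k * W := by exact_mod_cast h1
    have h3 : (k * W : ℝ) ≤ k * W * N * D ^ e := by
      have : (1 : ℝ) ≤ N := by exact_mod_cast hp.pos
      have h5 : (1 : ℝ) ≤ N * D ^ e := one_le_mul_of_one_le_of_one_le this (one_le_pow₀ hD')
      rw [mul_assoc (k * W : ℝ)]; exact le_mul_of_one_le_right (by positivity) h5
    have h4 : 0 ≤ θ * S.card * W / D := by positivity
    have hC' : (1 : ℝ) ≤ C := by exact_mod_cast hC
    have h6 : 0 ≤ ((b : ℝ) - 1) * S.card := mul_nonneg (by linarith) (by positivity)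
    have h7 := le_mul_of_one_le_left (show 0 ≤ k * W * N * D ^ e + θ * S.card * W / D by positivity) hC'
    linarith
  · have h1 : inc S T1 g ≤ T1.card * S.card := Finset.sum_le_card_nsmul _ _ _ fun t _ => Finset.card_filter_le _ _
    have h2 := h p N S τ T2 g w k (b - T1.card) D W θ (fun _ t ht => (Finset.mem_filter.1 ht).2) hp hS (fun t ht => hw t (Finset.mem_filter.1 ht).1)
      ((Finset.sum_le_sum_of_subset (Finset.filter_subset _ _)).trans hW) hk (by omega) hD hθ
      (le_trans (by gcongr; omega) hX) (by
        rintro ⟨P, B, b1, b2, b3, b4, b5⟩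
        have hdis : Disjoint B T1 := Finset.disjoint_left.2 fun t ht ht' => (Finset.mem_filter.1 (b2 ht)).2 (Finset.mem_filter.1 ht').2
        refine hfree ⟨P, B ∪ T1, b1, Finset.union_subset (b2.trans (Finset.filter_subset _ _)) (Finset.filter_subset _ _), b3, ?_, fun s hs t ht => ?_⟩
        · rw [Finset.card_union_of_disjoint hdis, b4]; omega
        · rcases Finset.mem_union.1 ht with ht | ht
          · exact b5 s hs t ht
          · exact hz t ht s (b1 hs))
    have h1' : (inc S T1 g : ℝ) ≤ T1.card * S.card := by exact_mod_cast h1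
    rw [Nat.cast_sub hj.le] at h2
    rw [hsplit]; push_cast
    linarith
lemma inc_base : IncB' n 0 1 True := by
  intro p _ N S τ T g w k b D W θ hg hp hS hw hW hk hb hD hθ hX hfree
  have h1 : inc S T g ≤ W * N := by
    refine le_trans ?_ (Nat.mul_le_mul_right N hW)
    rw [Finset.sum_mul]
    refine Finset.sum_le_sum fun t ht => ?_
    obtain ⟨ι, _, Q, N', h1, h2, h3, h4, h5⟩ := comps_pt hp (hg trivial t ht) (hw t ht).2
    refine (card_cover (R := fun i x => x ∈ ZR (Q i)) fun x hx => ?_).trans ((Finset.sum_le_sum fun i _ => ?_).trans h4)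
    · exact h5 x (hS x (Finset.mem_filter.1 hx).1) (Finset.mem_filter.1 hx).2
    · exact pts0 (h2 i) fun x hx => (Finset.mem_filter.1 hx).2
  have h2 : (inc S T g : ℝ) ≤ W * N := by exact_mod_cast h1
  have hb' : (1 : ℝ) ≤ b := by exact_mod_cast hb
  have hk' : (1 : ℝ) ≤ k := by exact_mod_cast hk
  have h6 : 0 ≤ ((b : ℝ) - 1) * S.card := mul_nonneg (by linarith) (by positivity)
  have h4 : 0 ≤ θ * S.card * W / D := by positivity
  have h7 := le_mul_of_one_le_left (show (0 : ℝ) ≤ W * N by positivity) hk'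
  simp only [Nat.cast_one, pow_zero]
  nlinarith
end Inc

section Inc2
open Classical
variable {n : ℕ}
lemma inc_cells (n C1 e : ℕ) : ∃ K : ℕ, ∀ (p : Ideal (MvPolynomial (Fin n) ℝ)) [p.IsPrime] (N I : ℕ) (P : Fin I → MvPolynomial (Fin n) ℝ) (S S1 : Finset (Fin n → ℝ)) (τ : Type) (T : Finset τ)
    (g : τ → MvPolynomial (Fin n) ℝ) (w : τ → ℕ) (k b D W : ℕ) (θ : ℝ), (∀ t ∈ T, g t ∉ p) → IsHF p (e + 1) N → (∀ x ∈ S, x ∈ ZR p) →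
    (∀ t ∈ T, 1 ≤ w t ∧ (g t).totalDegree ≤ w t) → ∑ t ∈ T, w t ≤ W → 1 ≤ k → 1 ≤ b → 1 ≤ D → 0 < θ → (b * D : ℝ) ≤ θ ^ k * W →
    KBFree (fun x t => eval x (g t) = 0) S T k b → hf p D ≤ 2 * 2 ^ I → (∏ i, P i).totalDegree ≤ C1 * (D + 1) → (∀ σ, (cell P S σ).card * 2 ^ I ≤ S.card) →
    S1 ⊆ S → (∀ x ∈ S1, ∀ i, eval x (P i) ≠ 0) →
    (inc S1 T g : ℝ) ≤ K * (k * W * N * D ^ e + θ * S.card * W / D) := by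
  obtain ⟨K, hK⟩ := crossT n C1
  refine ⟨1 + 2 * K + K * 2 ^ e, fun p _ N I P S S1 τ T g w k b D W θ hg hp hS hw hW hk hb hD hθ hX hfree hI hP hc hS1 hne => ?_⟩
  set TT : (Fin I → Bool) → Finset τ := fun σ => T.filter fun t => ∃ x ∈ cell P S σ, eval x (g t) = 0 with hTT
  have hD' : (1 : ℝ) ≤ D := by exact_mod_cast hD
  have hcr : (D + 1) * ∑ σ, (TT σ).card ≤ K * (W * hf p D) := by
    have e1 : ∑ σ, (TT σ).card = ∑ t ∈ T, (Finset.univ.filter fun σ => ∃ x ∈ cell P S σ, eval x (g t) = 0).card := by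
      simp only [hTT, Finset.card_filter]
      rw [Finset.sum_comm]
    rw [e1, Finset.mul_sum]
    refine (Finset.sum_le_sum fun t ht => hK p D I (w t) P S (g t) hP hS (hg t ht) (hw t ht).2).trans ?_
    rw [← Finset.mul_sum, ← Finset.sum_mul]
    gcongr
  obtain ⟨A, hA⟩ : ∃ A : ℝ, A = ((∑ σ, (TT σ).card : ℕ) : ℝ) := ⟨_, rfl⟩
  have hcr' : ((D : ℝ) + 1) * A ≤ K * (W * hf p D) := by rw [hA]; exact_mod_cast hcr
  have hA0 : 0 ≤ A := hA ▸ Nat.cast_nonneg _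
  have hA1 : D * A ≤ 2 * K * W * 2 ^ I := by
    have : (hf p D : ℝ) ≤ 2 * 2 ^ I := by exact_mod_cast hI
    calc _ ≤ ((D : ℝ) + 1) * A := by nlinarith
      _ ≤ K * (W * hf p D) := hcr'
      _ ≤ K * (W * (2 * 2 ^ I)) := by gcongr
      _ = _ := by ring
  have hA2 : A ≤ K * 2 ^ e * (W * N * D ^ e) := by
    have h1 : (hf p D : ℝ) ≤ N * ((D : ℝ) + 1) ^ (e + 1) := by
      exact_mod_cast (hp.upper D).trans (Nat.mul_le_mul_left _ (choose_le_pow1 D (e + 1)))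
    have h2 : ((D : ℝ) + 1) * A ≤ ((D : ℝ) + 1) * (K * (W * (N * ((D : ℝ) + 1) ^ e))) := by
      refine hcr'.trans ?_
      calc _ ≤ K * (W * (N * ((D : ℝ) + 1) ^ (e + 1))) := by gcongr
        _ = _ := by rw [pow_succ]; ring
    have h3 := le_of_mul_le_mul_left h2 (by linarith)
    refine h3.trans ?_
    have h4 : ((D : ℝ) + 1) ^ e ≤ 2 ^ e * D ^ e := by rw [← mul_pow]; exact pow_le_pow_left₀ (by linarith) (by linarith) e
    calc _ ≤ K * (W * (N * (2 ^ e * (D : ℝ) ^ e))) := by gcongr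
      _ = _ := by ring
  have hmemcell : ∀ x ∈ S1, ∃ σ, x ∈ cell P S σ := by
    intro x hx
    refine ⟨fun i => decide (0 < eval x (P i)), Finset.mem_filter.2 ⟨hS1 hx, fun i => ?_⟩⟩
    rcases lt_or_gt_of_ne (hne x hx i) with h | h
    · simp [cellc, h, h.le]
    · simp [cellc, h]
  have hsp : inc S1 T g ≤ ∑ σ, inc (cell P S σ) (TT σ) g := by
    have e1 : ∀ σ, inc (cell P S σ) (TT σ) g = ∑ t ∈ T, ((cell P S σ).filter fun x => eval x (g t) = 0).card := by
      intro σ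
      refine Finset.sum_subset (Finset.filter_subset _ _) fun t ht ht' => ?_
      rw [Finset.card_eq_zero, Finset.filter_eq_empty_iff]
      intro x hx h0
      exact ht' (Finset.mem_filter.2 ⟨ht, x, hx, h0⟩)
    rw [Finset.sum_congr rfl fun σ _ => e1 σ, Finset.sum_comm]
    refine Finset.sum_le_sum fun t _ => (card_cover (R := fun σ x => x ∈ cell P S σ) fun x hx => hmemcell x (Finset.mem_filter.1 hx).1).trans
      (Finset.sum_le_sum fun σ _ => Finset.card_le_card fun x hx => ?_)
    simp only [Finset.mem_filter] at hx ⊢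
    exact ⟨hx.2, hx.1.2⟩
  have hcells : ∑ σ, (cell P S σ).card ≤ S.card := by
    rw [← Finset.card_biUnion]
    · exact Finset.card_le_card (Finset.biUnion_subset.2 fun σ _ => Finset.filter_subset _ _)
    · intro σ _ σ' _ hne
      refine Finset.disjoint_left.2 fun x hx hx' => hne (funext fun i => ?_)
      exact cellc_inj ((Finset.mem_filter.1 hx).2 i) ((Finset.mem_filter.1 hx').2 i)
  have hk1 : ∀ σ, (inc (cell P S σ) (TT σ) g : ℝ) ≤ θ * (W / D) * (cell P S σ).card + (θ * (S.card / 2 ^ I) + k) * (TT σ).card := by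
    intro σ
    have h1 := kst (S := cell P S σ) (T := TT σ) hk (hfree.mono (Finset.filter_subset _ _ : cell P S σ ⊆ S) (Finset.filter_subset _ _ : TT σ ⊆ T)) hθ (X := W / D) (by
      rw [← mul_div_assoc, le_div_iff₀ (by linarith)]; exact hX)
    have h2 : ((cell P S σ).card : ℝ) ≤ S.card / 2 ^ I := by
      rw [le_div_iff₀ (by positivity)]; exact_mod_cast hc σ
    have h3 : θ * (cell P S σ).card * (TT σ).card ≤ θ * (S.card / 2 ^ I) * (TT σ).card := by gcongr
    refine h1.trans ?_
    linarith
  have hfin : (inc S1 T g : ℝ) ≤ θ * (W / D) * S.card + (θ * (S.card / 2 ^ I) + k) * A := by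
    have h1 : (inc S1 T g : ℝ) ≤ ∑ σ, (inc (cell P S σ) (TT σ) g : ℝ) := by exact_mod_cast hsp
    refine h1.trans ((Finset.sum_le_sum fun σ _ => hk1 σ).trans ?_)
    rw [Finset.sum_add_distrib, ← Finset.mul_sum, ← Finset.mul_sum]
    have h2 : ∑ σ, ((cell P S σ).card : ℝ) ≤ S.card := by exact_mod_cast hcells
    rw [hA]; push_cast
    gcongr
  have h5 : θ * (S.card / 2 ^ I) * A ≤ 2 * K * (θ * S.card * W / D) := by
    have : θ * (S.card / 2 ^ I) * A = θ * S.card * (D * A) / (2 ^ I * D) := by field_simp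
    rw [this, div_le_iff₀ (by positivity)]
    calc _ ≤ θ * S.card * (2 * K * W * 2 ^ I) := by gcongr
      _ = _ := by field_simp
  have h6 : k * A ≤ K * 2 ^ e * (k * W * N * D ^ e) := by
    calc (k : ℝ) * A ≤ k * (K * 2 ^ e * (W * N * D ^ e)) := by gcongr
      _ = _ := by ring
  have h7 : θ * (W / D) * S.card = θ * S.card * W / D := by ring
  have h8 : 0 ≤ θ * S.card * W / D := by positivity
  have h9 : (0 : ℝ) ≤ k * W * N * D ^ e := by positivity
  set U := θ * S.card * W / D
  set Z := (k * W * N * D ^ e : ℝ)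
  push_cast
  have : (0 : ℝ) ≤ K := by positivity
  have : (0 : ℝ) ≤ K * 2 ^ e := by positivity
  have : (0 : ℝ) ≤ K * Z := by positivity
  have : (0 : ℝ) ≤ K * 2 ^ e * U := by positivity
  calc _ ≤ U + (2 * K * U + K * 2 ^ e * Z) := by rw [add_mul] at hfin; linarith
    _ ≤ _ := by linarith
theorem inc_step {e C : ℕ} (hC : 1 ≤ C) (ih : IncB' n e C False) : ∃ C' : ℕ, 1 ≤ C' ∧ IncB' n (e + 1) C' True := by
  by_cases hn : 1 ≤ n
  swap
  · exact ⟨1, le_rfl, fun p _ N S τ T g w k b D W θ hg hp => absurd hp.le_n (by omega)⟩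
  obtain ⟨C1, hC1⟩ := partition n hn
  obtain ⟨K, hK⟩ := inc_cells n C1 (e + 1)
  refine ⟨C * (2 * C1 + 1) + K, by nlinarith, fun p _ N S τ T g w k b D W θ hg hp hS hw hW hk hb hD hθ hX hfree => ?_⟩
  obtain ⟨I, P, hI1, hI2, hPp, hPd, hPc⟩ := hC1 p D S
  set G := ∏ i, P i with hG
  have hD' : (1 : ℝ) ≤ D := by exact_mod_cast hD
  have hGp : G ∉ p := by rw [hG, Ideal.IsPrime.prod_mem_iff]; push Not; exact fun i _ => hPp i
  set S0 := S.filter fun x => eval x G = 0 with hS0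
  set S1 := S.filter fun x => ¬ eval x G = 0 with hS1
  have hsplit : inc S T g = inc S0 T g + inc S1 T g := by
    unfold inc
    rw [← Finset.sum_add_distrib]
    refine Finset.sum_congr rfl fun t _ => ?_
    rw [← Finset.card_filter_add_card_filter_not (s := S.filter fun x => eval x (g t) = 0) (fun x => eval x G = 0)]
    congr 2 <;> (ext x; simp only [hS0, hS1, Finset.mem_filter]; tauto)
  have h1 := hK p N I P S S1 τ T g w k b D W θ (hg trivial) hp hS hw hW hk hb hD hθ hX hfree hI2 hPd hPc (Finset.filter_subset _ _) (by
    intro x hx i h0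
    refine (Finset.mem_filter.1 hx).2 ?_
    rw [hG, map_prod]; exact Finset.prod_eq_zero (Finset.mem_univ i) h0)
  obtain ⟨ι, _, Q, N', q1, q2, q3, q4, q5⟩ := comps_pt hp hGp hPd
  have h2 : (inc S0 T g : ℝ) ≤ C * (k * W * (C1 * (D + 1) * N) * D ^ e + θ * S.card * W / D) + (b - 1) * S.card := by
    by_cases hι : Nonempty ι
    swap
    · have : S0 = ∅ := Finset.eq_empty_of_forall_notMem fun x hx => by
        obtain ⟨i, _⟩ := q5 x (hS x (Finset.mem_filter.1 hx).1) (Finset.mem_filter.1 hx).2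
        exact hι ⟨i⟩
      have hb' : (1 : ℝ) ≤ b := by exact_mod_cast hb
      have h6 : 0 ≤ ((b : ℝ) - 1) * S.card := mul_nonneg (by linarith) (by positivity)
      rw [this]; simp [inc]; positivity
    have hch : ∀ x ∈ S0, ∃ i, x ∈ ZR (Q i) := fun x hx => q5 x (hS x (Finset.mem_filter.1 hx).1) (Finset.mem_filter.1 hx).2
    choose! j hj using hch
    set F : ι → Finset (Fin n → ℝ) := fun i => S0.filter fun x => j x = i with hF
    have e1 : inc S0 T g ≤ ∑ i, inc (F i) T g := by
      unfold inc
      rw [Finset.sum_comm]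
      refine Finset.sum_le_sum fun t _ => (card_cover (R := fun i x => j x = i) fun x hx => ⟨_, rfl⟩).trans (le_of_eq (Finset.sum_congr rfl fun i _ => ?_))
      rw [Finset.filter_comm]
    have e2 : ∀ i, (inc (F i) T g : ℝ) ≤ C * (k * W * D ^ e * N' i + θ * W / D * (F i).card) + (b - 1) * (F i).card := by
      intro i
      have := q1 i
      have := ih (Q i) (N' i) (F i) τ T g w k b D W θ (fun h => h.elim) (q2 i) (fun x hx => by
        obtain ⟨h1, rfl⟩ := Finset.mem_filter.1 hx; exact hj x h1) hw hW hk hb hD hθ hX (hfree.mono ((Finset.filter_subset _ _).trans (Finset.filter_subset _ _)) le_rfl)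
      refine this.trans (le_of_eq ?_); ring
    have e3 : ∑ i, ((F i).card : ℝ) ≤ S.card := by
      have : ∑ i, (F i).card = S0.card := (Finset.card_eq_sum_card_fiberwise fun x _ => Finset.mem_coe.2 (Finset.mem_univ (j x))).symm
      have h3 : S0.card ≤ S.card := Finset.card_filter_le _ _
      rw [← this] at h3; exact_mod_cast h3
    have e4 : ∑ i, (N' i : ℝ) ≤ C1 * (D + 1) * N := by exact_mod_cast q4
    have hb' : (0 : ℝ) ≤ b - 1 := by have : (1 : ℝ) ≤ b := by exact_mod_cast hb
                                     linarith
    calc (inc S0 T g : ℝ) ≤ ∑ i, (inc (F i) T g : ℝ) := by exact_mod_cast e1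
      _ ≤ _ := Finset.sum_le_sum fun i _ => e2 i
      _ = C * (k * W * D ^ e * (∑ i, (N' i : ℝ)) + θ * W / D * (∑ i, ((F i).card : ℝ))) + (b - 1) * (∑ i, ((F i).card : ℝ)) := by
        rw [Finset.sum_add_distrib, ← Finset.mul_sum, ← Finset.mul_sum, Finset.sum_add_distrib, ← Finset.mul_sum, ← Finset.mul_sum]
      _ ≤ C * (k * W * D ^ e * (C1 * (D + 1) * N) + θ * W / D * S.card) + (b - 1) * S.card := by gcongr
      _ = _ := by ring
  have h3 : (k * W * (C1 * (D + 1) * N) * D ^ e : ℝ) ≤ 2 * C1 * (k * W * N * D ^ (e + 1)) := by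
    calc (k * W * (C1 * (D + 1) * N) * D ^ e : ℝ) ≤ k * W * (C1 * (2 * D) * N) * D ^ e := by gcongr; linarith
      _ = _ := by ring
  set U := θ * S.card * W / D with hU
  set Z := (k * W * N * D ^ (e + 1) : ℝ) with hZ
  have : 0 ≤ U := by positivity
  have : 0 ≤ Z := by positivity
  have h4 : (C * (k * W * (C1 * (D + 1) * N) * D ^ e + U) : ℝ) ≤ C * (2 * C1 * Z + U) := by gcongr
  have h5 : (0 : ℝ) ≤ C * C1 * U := by positivity
  have h6 : (0 : ℝ) ≤ C * Z := by positivity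
  rw [hsplit]; push_cast
  linarith
theorem inc_main (n : ℕ) : ∃ C : ℕ, 1 ≤ C ∧ ∀ e ≤ n, IncB' n e C False := by
  have h : ∀ e, ∃ C : ℕ, 1 ≤ C ∧ IncB' n e C False := by
    intro e
    induction e with
    | zero => exact ⟨1, le_rfl, peel le_rfl inc_base⟩
    | succ e ih =>
      obtain ⟨C, h1, h2⟩ := ih
      obtain ⟨C', h3, h4⟩ := inc_step h1 h2
      exact ⟨C', h3, peel h3 h4⟩
  choose C h1 h2 using h
  refine ⟨1 + ∑ e ∈ Finset.range (n + 1), C e, by omega, fun e he p _ N S τ T g w k b D W θ a1 a2 a3 a4 a5 a6 a7 a8 a9 a10 a11 => ?_⟩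
  refine (h2 e p N S τ T g w k b D W θ a1 a2 a3 a4 a5 a6 a7 a8 a9 a10 a11).trans ?_
  have := Finset.single_le_sum (f := C) (fun _ _ => Nat.zero_le _) (Finset.mem_range.2 (by omega : e < n + 1))
  gcongr
  omega
end Inc2

section Opt
open Classical
variable {n : ℕ}
lemma main_eq {k b e : ℕ} (hk : 2 ≤ k) (hb : 1 ≤ b) {s W N L : ℝ} (hs : 0 < s) (hW : 0 < W) (hN : 0 < N)
    (hL : ((e : ℝ) + 1 - 1 / k) * L = (Real.log b - Real.log W) / k + Real.log s - Real.log k - Real.log N) :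
    tauC (e + 1) b k * s ^ alpha k (e + 1) * W ^ beta k (e + 1) * N ^ (1 - alpha k (e + 1)) =
      Real.exp (Real.log k + Real.log W + Real.log N + e * L) := by
  have hk' : (2 : ℝ) ≤ k := by exact_mod_cast hk
  have hb' : (0 : ℝ) < b := by exact_mod_cast hb
  have hk0 : (0 : ℝ) < k := by linarith
  have hden : ((e : ℝ) + 1) * k - 1 > 0 := by nlinarith [show (0 : ℝ) ≤ e by positivity]
  have h1 : ¬ (k = 1 ∧ e + 1 = 1) := by omega
  rw [tauC, Real.rpow_def_of_pos hb', Real.rpow_def_of_pos hk0, Real.rpow_def_of_pos hs, Real.rpow_def_of_pos hW, Real.rpow_def_of_pos hN, ← Real.exp_add, ← Real.exp_add, ← Real.exp_add, ← Real.exp_add]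
  congr 1
  have hα : alpha k (e + 1) = k * e / ((e + 1) * k - 1) := by rw [alpha, if_neg h1]; push_cast; ring
  have hβ : beta k (e + 1) = 1 - alpha k (e + 1) / k := by
    rw [beta, if_neg h1, hα]; push_cast; field_simp; ring
  have hαe : alpha k (e + 1) * ((e : ℝ) + 1 - 1 / k) = e := by
    have hd2 : (k : ℝ) * (e + 1) - 1 ≠ 0 := by linarith
    rw [hα]; field_simp
  rw [hβ]
  generalize alpha k (e + 1) = α at *
  have : e * L = α * ((Real.log b - Real.log W) / k + Real.log s - Real.log k - Real.log N) := by rw [← hL, ← mul_assoc, hαe]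
  rw [this]; ring
theorem inc_final (n : ℕ) : ∃ C : ℝ, 0 < C ∧ ∀ (p : Ideal (MvPolynomial (Fin n) ℝ)) [p.IsPrime] (e N : ℕ) (S : Finset (Fin n → ℝ)) (τ : Type) (T : Finset τ)
    (g : τ → MvPolynomial (Fin n) ℝ) (w : τ → ℕ) (k b W : ℕ), IsHF p (e + 1) N → (∀ x ∈ S, x ∈ ZR p) →
    (∀ t ∈ T, 1 ≤ w t ∧ (g t).totalDegree ≤ w t) → ∑ t ∈ T, w t = W → 2 ≤ k → 1 ≤ b →
    KBFree (fun x t => eval x (g t) = 0) S T k b →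
    (inc S T g : ℝ) ≤ C * (tauC (e + 1) b k * (S.card : ℝ) ^ alpha k (e + 1) * (W : ℝ) ^ beta k (e + 1) * (N : ℝ) ^ (1 - alpha k (e + 1))) + k * T.card + (b - 1) * S.card := by
  obtain ⟨C0, hC0, hC⟩ := inc_main n
  have hC0' : (1 : ℝ) ≤ C0 := by exact_mod_cast hC0
  refine ⟨3 * C0, by positivity, fun p _ e N S τ T g w k b W hp hS hw hW hk hb hfree => ?_⟩
  have hb' : (1 : ℝ) ≤ b := by exact_mod_cast hb
  have h6 : 0 ≤ ((b : ℝ) - 1) * S.card := mul_nonneg (by linarith) (by positivity)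
  have hτ : 0 ≤ tauC (e + 1) b k := by unfold tauC; positivity
  rcases S.eq_empty_or_nonempty with rfl | hS0
  · have : inc (∅ : Finset (Fin n → ℝ)) T g = 0 := by simp [inc]
    rw [this]; simp only [Nat.cast_zero]; positivity
  rcases T.eq_empty_or_nonempty with rfl | hT0
  · have : inc S (∅ : Finset τ) g = 0 := by simp [inc]
    rw [this]; simp only [Nat.cast_zero]; positivity
  have hTW : T.card ≤ W := by
    rw [← hW, Finset.card_eq_sum_ones]; exact Finset.sum_le_sum fun t ht => (hw t ht).1
  have hs : (0 : ℝ) < S.card := by exact_mod_cast hS0.card_pos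
  have hW0 : (0 : ℝ) < W := by exact_mod_cast lt_of_lt_of_le hT0.card_pos hTW
  have hN0 : (0 : ℝ) < N := by exact_mod_cast hp.pos
  have hk' : (2 : ℝ) ≤ k := by exact_mod_cast hk
  have hk0 : (0 : ℝ) < k := by linarith
  have hkn : k ≠ 0 := by omega
  have hik : 1 / (k : ℝ) ≤ 1 := by rw [div_le_one hk0]; linarith
  have he0 : (0 : ℝ) ≤ e := by positivity
  have hik2 : 1 / (k : ℝ) ≤ 1 / 2 := one_div_le_one_div_of_le (by norm_num) hk'
  have hγ : 0 < (e : ℝ) + 1 - 1 / k := by linarith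
  set R := (Real.log b - Real.log W) / k + Real.log S.card - Real.log k - Real.log N with hR
  set L := R / ((e : ℝ) + 1 - 1 / k) with hLd
  have hL : ((e : ℝ) + 1 - 1 / k) * L = R := mul_div_cancel₀ _ hγ.ne'
  rw [main_eq hk hb hs hW0 hN0 hL]
  have hMM : Real.exp (Real.log k + Real.log W + Real.log N + e * L) = k * W * N * Real.exp L ^ e := by
    rw [Real.exp_add, Real.exp_add, Real.exp_add, Real.exp_log hk0, Real.exp_log hW0, Real.exp_log hN0, ← Real.exp_nat_mul]
  set M := Real.exp (Real.log k + Real.log W + Real.log N + e * L) with hM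
  have hM0 : 0 < M := Real.exp_pos _
  have hexpk : ∀ y : ℝ, Real.exp (y / k) ^ k = Real.exp y := fun y => by
    rw [← Real.exp_nat_mul]; congr 1; field_simp
  rcases lt_or_ge L 0 with hL0 | hL0
  · set θ := Real.exp ((Real.log b - Real.log W) / k) with hθ
    have h1 := kst (T := T) (θ := θ) (X := W) (by omega) hfree (Real.exp_pos _) (by
      rw [hθ, hexpk, Real.exp_sub, Real.exp_log (by linarith), Real.exp_log hW0, div_mul_cancel₀ _ hW0.ne'])
    have h2 : θ * S.card * W ≤ M := by
      have : θ * S.card * W = Real.exp ((Real.log b - Real.log W) / k + Real.log S.card + Real.log W) := by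
        rw [Real.exp_add, Real.exp_add, Real.exp_log hs, Real.exp_log hW0]
      rw [this, hM, Real.exp_le_exp]
      have : ((e : ℝ) + 1 - 1 / k) * L ≤ e * L := by nlinarith
      linarith
    have h3 : (T.card : ℝ) ≤ W := by exact_mod_cast hTW
    have h4 : θ * S.card * T.card ≤ θ * S.card * W := by gcongr
    have h5 : M ≤ C0 * M := le_mul_of_one_le_left hM0.le hC0'
    unfold inc
    nlinarith
  · set θ := Real.exp ((Real.log b + L - Real.log W) / k) with hθ
    have hD0 : 1 ≤ Real.exp L := Real.one_le_exp hL0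
    set D := ⌊Real.exp L⌋₊ with hD
    have hD1 : 1 ≤ D := Nat.le_floor (by simpa using hD0)
    have hD2 : (D : ℝ) ≤ Real.exp L := Nat.floor_le (by positivity)
    have hD3 : Real.exp L ≤ 2 * D := by
      have := Nat.lt_floor_add_one (Real.exp L)
      have : (1 : ℝ) ≤ D := by exact_mod_cast hD1
      linarith
    have hDp : (0 : ℝ) < D := by exact_mod_cast hD1
    have h1 := hC e (by have := hp.le_n; omega) p N S τ T g w k b D W θ (fun h => h.elim) hp hS hw hW.le (by omega) hb hD1 (Real.exp_pos _) (by
      rw [hθ, hexpk, Real.exp_sub, Real.exp_add, Real.exp_log (by linarith), Real.exp_log hW0, div_mul_cancel₀ _ hW0.ne']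
      gcongr) hfree
    have h2 : k * W * N * (D : ℝ) ^ e ≤ M := by
      rw [hMM]; gcongr
    have h3 : θ * S.card * W / D ≤ 2 * M := by
      have : θ * S.card * W = M * Real.exp L := by
        rw [hM, hθ, ← Real.exp_log hs, ← Real.exp_log hW0, ← Real.exp_add, ← Real.exp_add, ← Real.exp_add]
        congr 1
        have e1 : (Real.log b + L - Real.log W) / k = (Real.log b - Real.log W) / k + L / k := by ring
        have e2 : ((e : ℝ) + 1 - 1 / k) * L = e * L + L - L / k := by ring
        rw [Real.log_exp, e1]; linarith
      rw [this, div_le_iff₀ hDp]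
      nlinarith
    have h4 : (0 : ℝ) ≤ k * T.card := by positivity
    have h5 : (C0 : ℝ) * (k * W * N * D ^ e + θ * S.card * W / D) ≤ C0 * (3 * M) := by gcongr; linarith
    linarith
end Opt

section Fib
open scoped IntermediateField
attribute [local instance] FractionRing.liftAlgebra
variable {e : ℕ} {A : Type*} [CommRing A] [IsDomain A] [Algebra (Bp ℂ e) A] [FaithfulSMul (Bp ℂ e) A] [Module.Finite (Bp ℂ e) A]
lemma exists_prim [Module.Finite (Kp ℂ e) (FractionRing A)] : ∃ θ : A,
    (Kp ℂ e)⟮algebraMap A (FractionRing A) θ⟯ = ⊤ := by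
  obtain ⟨α, hα⟩ := Field.exists_primitive_element (Kp ℂ e) (FractionRing A)
  obtain ⟨a, s, hs, rfl⟩ := IsFractionRing.div_surjective A α
  obtain ⟨r, hr, c, hc⟩ := (Algebra.IsAlgebraic.isAlgebraic (R := Bp ℂ e) s).exists_nonzero_dvd hs
  have := FractionRing.isScalarTower_liftAlgebra (Bp ℂ e) (FractionRing A)
  refine ⟨a * c, ?_⟩
  rw [eq_top_iff, ← hα, IntermediateField.adjoin_simple_le_iff]
  have hs0 : algebraMap A (FractionRing A) s ≠ 0 := by simpa using nonZeroDivisors.ne_zero hs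
  have h0 : algebraMap (Kp ℂ e) (FractionRing A) (algebraMap _ _ r) = algebraMap A _ s * algebraMap A _ c := by
    rw [← IsScalarTower.algebraMap_apply, ← map_mul, ← hc, ← IsScalarTower.algebraMap_apply]
  have h1 : algebraMap (Kp ℂ e) (FractionRing A) (algebraMap _ _ r) ≠ 0 := by simpa using hr
  have h2 : algebraMap A (FractionRing A) a / algebraMap A _ s =
      algebraMap A _ (a * c) * (algebraMap (Kp ℂ e) (FractionRing A) (algebraMap _ _ r))⁻¹ := by
    rw [map_mul]
    field_simp
    rw [h0]; ring
  rw [h2]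
  exact mul_mem (IntermediateField.mem_adjoin_simple_self _ _) (inv_mem (algebraMap_mem _ _))
theorem fib [Module.Finite (Kp ℂ e) (FractionRing A)] : ∃ (y : Fin e → ℂ) (θ : A) (Z : Finset ℂ),
    Z.card = Module.finrank (Kp ℂ e) (FractionRing A) ∧ ∀ c ∈ Z, ∃ Q : Ideal A, Q.IsMaximal ∧
      (∀ i, algebraMap (Bp ℂ e) A (X i - C (y i)) ∈ Q) ∧ θ - algebraMap (Bp ℂ e) A (C c) ∈ Q := by
  classical
  obtain ⟨θ, hθ⟩ := exists_prim (e := e) (A := A)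
  have := FractionRing.isScalarTower_liftAlgebra (Bp ℂ e) (FractionRing A)
  have hi : IsIntegral (Bp ℂ e) θ := Algebra.IsIntegral.isIntegral θ
  have hmin := minpoly.isIntegrallyClosed_eq_field_fractions (Kp ℂ e) (FractionRing A) hi
  have hdeg := (Field.primitive_element_iff_minpoly_natDegree_eq (Kp ℂ e) _).1 hθ
  have hsep : (minpoly (Kp ℂ e) (algebraMap A (FractionRing A) θ)).Separable :=
    Algebra.IsSeparable.isSeparable _ _
  have hm := minpoly.monic hi
  have hdvd : ∀ G : Polynomial (Bp ℂ e), Polynomial.aeval θ G = 0 → minpoly (Bp ℂ e) θ ∣ G :=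
    fun G hG => minpoly.isIntegrallyClosed_dvd hi hG
  have h0 := minpoly.aeval (Bp ℂ e) θ
  generalize minpoly (Bp ℂ e) θ = F at *
  rw [hmin] at hdeg hsep
  have hd : ∀ (L : Type) [Field L] [CharZero L] (φ : Bp ℂ e →+* L), (F.map φ).Separable ↔
      φ (F.resultant F.derivative) ≠ 0 := by
    intro L _ _ φ
    rw [Polynomial.Separable, ← Polynomial.isUnit_resultant_iff_isCoprime (hm.map φ), Polynomial.derivative_map,
      isUnit_iff_ne_zero, ← Polynomial.resultant_map_map, hm.natDegree_map, ← Polynomial.derivative_map, Polynomial.natDegree_derivative,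
      Polynomial.natDegree_derivative, hm.natDegree_map]
  have hr : F.resultant F.derivative ≠ 0 := fun h => (hd _ _).1 hsep (by rw [h, map_zero])
  obtain ⟨y, hy⟩ : ∃ y, eval y (F.resultant F.derivative) ≠ 0 := by
    by_contra! h
    exact hr (MvPolynomial.funext fun y => by simpa using h y)
  have hs := (hd ℂ (eval y)).2 hy
  refine ⟨y, θ, (F.map (eval y)).roots.toFinset, ?_, fun c hc => ?_⟩
  · rw [Multiset.toFinset_card_of_nodup (Polynomial.nodup_roots hs), ← hdeg, hm.natDegree_map, ← hm.natDegree_map (eval y)]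
    exact (IsAlgClosed.splits _).natDegree_eq_card_roots.symm
  · rw [Multiset.mem_toFinset, Polynomial.mem_roots', Polynomial.IsRoot, Polynomial.eval_map] at hc
    let alg : Algebra (Polynomial (Bp ℂ e)) A := (Polynomial.aeval θ).toRingHom.toAlgebra
    have hal : ∀ G, algebraMap (Polynomial (Bp ℂ e)) A G = Polynomial.aeval θ G := fun G => rfl
    have : IsScalarTower (Bp ℂ e) (Polynomial (Bp ℂ e)) A := IsScalarTower.of_algebraMap_eq fun x => by
      rw [hal]; simp
    have : Algebra.IsIntegral (Polynomial (Bp ℂ e)) A := Algebra.IsIntegral.tower_top (Bp ℂ e)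
    let ψ := Polynomial.eval₂RingHom (eval y) c
    have hmax : (RingHom.ker ψ).IsMaximal := RingHom.ker_isMaximal_of_surjective ψ fun z =>
      ⟨Polynomial.C (C z), by simp [ψ]⟩
    obtain ⟨Q, -, hQ, hQP⟩ := Ideal.exists_ideal_over_prime_of_isIntegral (RingHom.ker ψ) (⊥ : Ideal A) (by
      intro G hG
      obtain ⟨H, rfl⟩ := hdvd G hG
      rw [RingHom.mem_ker, map_mul]
      simp [ψ, hc.2])
    have hmem : ∀ G, ψ G = 0 → Polynomial.aeval θ G ∈ Q := fun G hG => by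
      have : G ∈ Q.comap (algebraMap (Polynomial (Bp ℂ e)) A) := by rw [hQP]; exact hG
      exact this
    refine ⟨Q, Ideal.isMaximal_of_isIntegral_of_isMaximal_comap (R := Polynomial (Bp ℂ e)) Q (hQP ▸ hmax), fun i => ?_, ?_⟩
    · have := hmem (Polynomial.C (X i - C (y i))) (by simp [ψ])
      rwa [Polynomial.aeval_C] at this
    · have := hmem (Polynomial.X - Polynomial.C (C c)) (by simp [ψ])
      rwa [map_sub, Polynomial.aeval_X, Polynomial.aeval_C] at this
end Fib

section Geo
variable {n : ℕ}
lemma le_ker {P : Ideal (MvPolynomial (Fin n) ℂ)} {x : Fin n → ℂ} : x ∈ zeroLocus n P ↔ P ≤ RingHom.ker (eval x) := Iff.rfl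
lemma nsz (P : Ideal (MvPolynomial (Fin n) ℂ)) [h : P.IsPrime] : vanishingIdeal n (zeroLocus n P) = P := by
  have := MvPolynomial.IsPrime.vanishingIdeal_zeroLocus (K := ℂ) P
  refine Eq.trans ?_ this; ext f
  simp [vanishingIdeal, zeroLocus, MvPolynomial.mem_vanishingIdeal_iff, MvPolynomial.zeroLocus]
lemma zl_vi {V : Set (Fin n → ℂ)} (h : IsAlgebraicSet n V) : zeroLocus n (vanishingIdeal n V) = V := by
  obtain ⟨J, rfl⟩ := h
  exact Set.Subset.antisymm (fun x hx f hf => hx f fun y hy => hy f hf) fun x hx f hf => hf x hx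
lemma vi_anti {V W : Set (Fin n → ℂ)} (h : V ⊆ W) : vanishingIdeal n W ≤ vanishingIdeal n V :=
  fun _ hf x hx => hf x (h hx)
lemma zl_anti {P Q : Ideal (MvPolynomial (Fin n) ℂ)} (h : P ≤ Q) : zeroLocus n Q ⊆ zeroLocus n P := fun _ hx f hf => hx f (h hf)
lemma zl_lt {P Q : Ideal (MvPolynomial (Fin n) ℂ)} [P.IsPrime] [Q.IsPrime] (h : P < Q) : zeroLocus n Q ⊂ zeroLocus n P := by
  refine ⟨zl_anti h.le, fun h2 => h.not_ge ?_⟩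
  rw [← nsz P, ← nsz Q]; exact vi_anti h2
lemma vi_prime {V : Set (Fin n → ℂ)} (h : IsIrredVariety n V) : (vanishingIdeal n V).IsPrime := by
  obtain ⟨ha, ⟨x, hx⟩, hV⟩ := h
  refine ⟨fun h => ?_, fun {f g} hfg => ?_⟩
  · have : (1 : MvPolynomial (Fin n) ℂ) ∈ vanishingIdeal n V := h ▸ trivial
    simpa using this x hx
  · refine (hV _ _ ⟨{f}, rfl⟩ ⟨{g}, rfl⟩ fun y hy => ?_).imp (fun h y hy => h hy f rfl) (fun h y hy => h hy g rfl)
    have := hfg y hy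
    rw [map_mul, mul_eq_zero] at this
    exact this.imp (fun h f' hf => by rw [hf]; exact h) (fun h f' hf => by rw [hf]; exact h)
lemma zl_irr (P : Ideal (MvPolynomial (Fin n) ℂ)) [hP : P.IsPrime] : IsIrredVariety n (zeroLocus n P) := by
  refine ⟨⟨_, rfl⟩, ?_, ?_⟩
  · by_contra h
    rw [Set.not_nonempty_iff_eq_empty] at h
    apply hP.ne_top
    rw [← nsz P, h, Ideal.eq_top_iff_one]
    intro x hx; simp at hx
  · rintro _ _ ⟨J₁, rfl⟩ ⟨J₂, rfl⟩ h
    by_contra! hc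
    obtain ⟨⟨x, hx, hx1⟩, y, hy, hy2⟩ := hc.imp Set.not_subset.1 Set.not_subset.1
    simp only [zeroLocus, mem_ofPred_eq, not_forall] at hx1 hy2
    obtain ⟨f, hf, hf0⟩ := hx1
    obtain ⟨g, hg, hg0⟩ := hy2
    have : f * g ∈ vanishingIdeal n (zeroLocus n P) := fun z hz => by
      rw [map_mul]
      rcases h hz with h | h
      · rw [h f hf, zero_mul]
      · rw [h g hg, mul_zero]
    rw [nsz] at this
    rcases hP.mem_or_mem this with h | h
    · exact hf0 (hx f h)
    · exact hg0 (hy g h)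
lemma chain_le {P : Ideal (MvPolynomial (Fin n) ℂ)} [P.IsPrime] {e N d : ℕ} (hP : IsHF P e N) (h : HasChain n (zeroLocus n P) d) : d ≤ e := by
  obtain ⟨W, hW, hlt, hl⟩ := h
  have hp := fun i => vi_prime (hW i)
  choose e' N' hN using fun i => exists_HF (vanishingIdeal n (W i))
  have hm : StrictMono e' := fun i j hij => (hN j).lt_of_lt (hN i) ((vi_anti (hlt i j hij).1).lt_of_ne fun he =>
    (hlt i j hij).ne (by rw [← zl_vi (hW i).1, ← zl_vi (hW j).1, he]))
  have h1 := (hP.le_of_le (hN (Fin.last d)) (by rw [← nsz P]; exact vi_anti hl))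
  have h2 : ∀ i : Fin (d + 1), (i : ℕ) ≤ e' i := by
    intro i
    induction i using Fin.induction with
    | zero => simp
    | succ i ih => have := hm (Fin.castSucc_lt_succ (i := i)); simp at *; omega
  have := h2 (Fin.last d)
  simp at this; omega
lemma down {P : Ideal (MvPolynomial (Fin n) ℂ)} [P.IsPrime] {e N : ℕ} (hP : IsHF P (e + 1) N) : ∃ (Q : Ideal (MvPolynomial (Fin n) ℂ)) (N' : ℕ), Q.IsPrime ∧ P < Q ∧ IsHF Q e N' := by
  obtain ⟨x, hx⟩ := (zl_irr P).2.1
  have hk : (RingHom.ker (eval x)).IsPrime := RingHom.ker_isPrime _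
  have hne : P ≠ RingHom.ker (eval x) := by
    rintro rfl
    have h2 : ∀ m, hf (RingHom.ker (eval x)) m ≤ 1 := fun m => by
      refine finrank_le_one (⟨1, one_mem_Vm _ m⟩) fun v => ?_
      obtain ⟨f, h, hv⟩ := mem_Vm.1 v.2
      refine ⟨eval x f, Subtype.ext ?_⟩
      rw [← hv]
      change (eval x f) • Ideal.Quotient.mk (RingHom.ker (eval x)) 1 = _
      rw [← sub_eq_zero, ← Ideal.Quotient.mkₐ_eq_mk ℂ, ← map_smul, ← map_sub, Ideal.Quotient.mkₐ_eq_mk, Ideal.Quotient.eq_zero_iff_mem]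
      simp [RingHom.mem_ker, smul_eval]
    obtain ⟨m0, hm⟩ := hP.lower
    have := growth N 1 0 0 (e + 1) 0 hP.pos fun s => (hm s).trans ((h2 _).trans (by simp))
    simp at this
  obtain ⟨g, hgk, hgP⟩ := SetLike.exists_of_lt (lt_of_le_of_ne (le_ker.1 hx) hne)
  obtain ⟨ι, _, q, N', h1, h2, h3, h4, -, -, h5⟩ := comps hP hgP le_rfl
  obtain ⟨i, -⟩ := h5 _ hk (le_ker.1 hx) hgk
  exact ⟨q i, N' i, h1 i, (h2 i).lt_of_ne fun h => hgP (h ▸ h3 i), h4 i⟩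
lemma chain_ge (e : ℕ) : ∀ (P : Ideal (MvPolynomial (Fin n) ℂ)) [P.IsPrime] (N : ℕ), IsHF P e N → HasChain n (zeroLocus n P) e := by
  induction e with
  | zero =>
    intro P _ N _
    exact ⟨fun _ => _, fun _ => zl_irr P, fun i j h => by omega, le_rfl⟩
  | succ e ih =>
    intro P _ N hP
    obtain ⟨Q, N', hQ, hlt, h⟩ := down hP
    obtain ⟨W, hW, hm, hl⟩ := ih Q N' h
    refine ⟨Fin.snoc W (zeroLocus n P), fun i => ?_, fun i j hij => ?_, by simp⟩
    · induction i using Fin.lastCases with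
      | last => simpa using zl_irr P
      | cast i => simpa using hW i
    · induction j using Fin.lastCases with
      | last =>
        induction i using Fin.lastCases with
        | last => exact absurd hij (lt_irrefl _)
        | cast i =>
          simp only [Fin.snoc_castSucc, Fin.snoc_last]
          have hi : W i ⊆ W (Fin.last e) := by
            rcases (Fin.le_last i).eq_or_lt with h | h
            · rw [h]
            · exact (hm _ _ h).1
          exact (hi.trans hl).trans_ssubset (zl_lt hlt)
      | cast j =>
        induction i using Fin.lastCases with
        | last => exact absurd hij (not_lt.2 (Fin.le_last _))
        | cast i => simpa using hm i j (by simpa using hij)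
lemma dim_zl {P : Ideal (MvPolynomial (Fin n) ℂ)} [P.IsPrime] {e N : ℕ} (hP : IsHF P e N) : dim n (zeroLocus n P) = e :=
  IsGreatest.csSup_eq ⟨chain_ge e P N hP, fun _ => chain_le hP⟩
lemma fin_pt {P : Ideal (MvPolynomial (Fin n) ℂ)} [hp : P.IsPrime] (hf : (zeroLocus n P).Finite) : (zeroLocus n P).ncard ≤ 1 := by
  have h : hf.toFinset.inf (fun x => RingHom.ker (eval x)) ≤ P := by
    intro f hm
    rw [← nsz P]; intro x hx
    exact (Submodule.mem_finsetInf.1 hm) x (by simpa using hx)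
  obtain ⟨x, hx, hxP⟩ := (Ideal.IsPrime.inf_le' hp).1 h
  rw [Set.ncard_le_one hf]
  have : ∀ y ∈ zeroLocus n P, y = x := fun y hy => by
    funext i
    have := hy _ (hxP (show X i - C (x i) ∈ _ by simp [RingHom.mem_ker]))
    simpa [sub_eq_zero] using this
  exact fun a ha b hb => (this a ha).trans (this b hb).symm
lemma sec_le (l : List (MvPolynomial (Fin n) ℂ)) : ∀ (P : Ideal (MvPolynomial (Fin n) ℂ)) [P.IsPrime] (e N : ℕ), IsHF P e N →
    (∀ g ∈ l, g.totalDegree ≤ 1) → (zeroLocus n P ∩ zeroLocus n {g | g ∈ l}).Finite →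
    (zeroLocus n P ∩ zeroLocus n {g | g ∈ l}).ncard ≤ N := by
  induction l with
  | nil =>
    intro P _ e N hP _ hf
    have : zeroLocus n {g : MvPolynomial (Fin n) ℂ | g ∈ []} = univ := by simp [zeroLocus]
    rw [this, inter_univ] at hf ⊢
    exact (fin_pt hf).trans hP.pos
  | cons g l ih =>
    intro P _ e N hP hl hf
    have hc : zeroLocus n {f | f ∈ g :: l} = {x | eval x g = 0} ∩ zeroLocus n {g | g ∈ l} := by
      ext x; simp [zeroLocus]
    rw [hc] at hf ⊢
    have hl' : ∀ g ∈ l, g.totalDegree ≤ 1 := fun f h => hl f (List.mem_cons_of_mem _ h)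
    by_cases hg : g ∈ P
    · have : zeroLocus n P ∩ ({x | eval x g = 0} ∩ zeroLocus n {g | g ∈ l}) = zeroLocus n P ∩ zeroLocus n {g | g ∈ l} := by
        rw [← inter_assoc, inter_eq_left.2 (show zeroLocus n P ⊆ {x | eval x g = 0} from fun x hx => hx g hg)]
      rw [this] at hf ⊢
      exact ih P e N hP hl' hf
    · obtain ⟨ι, _, q, N', h1, h2, h3, h4, -, h6, h5⟩ := comps hP hg (hl g (by simp))
      have hsub : ∀ i, zeroLocus n (q i) ∩ zeroLocus n {g | g ∈ l} ⊆ zeroLocus n P ∩ ({x | eval x g = 0} ∩ zeroLocus n {g | g ∈ l}) :=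
        fun i x hx => ⟨zl_anti (h2 i) hx.1, hx.1 g (h3 i), hx.2⟩
      have hcov : zeroLocus n P ∩ ({x | eval x g = 0} ∩ zeroLocus n {g | g ∈ l}) ⊆ ⋃ i, zeroLocus n (q i) ∩ zeroLocus n {g | g ∈ l} := by
        rintro x ⟨hx, hxg, hxl⟩
        obtain ⟨i, hi⟩ := h5 (RingHom.ker (eval x)) (RingHom.ker_isPrime _) hx hxg
        exact mem_iUnion.2 ⟨i, hi, hxl⟩
      calc _ ≤ (⋃ i, zeroLocus n (q i) ∩ zeroLocus n {g | g ∈ l}).ncard :=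
            ncard_le_ncard hcov (Set.finite_iUnion fun i => hf.subset (hsub i))
        _ ≤ ∑ i, (zeroLocus n (q i) ∩ zeroLocus n {g | g ∈ l}).ncard := by
            simpa using Finset.set_ncard_biUnion_le Finset.univ fun i => zeroLocus n (q i) ∩ zeroLocus n {g | g ∈ l}
        _ ≤ ∑ i, N' i := Finset.sum_le_sum fun i _ => ih (q i) _ _ (h4 i) hl' (hf.subset (hsub i))
        _ ≤ N := by simpa using h6
end Geo

section Deg
variable {n : ℕ}
def linP {m : ℕ} (φ : (Fin m → ℂ) →ₗ[ℂ] ℂ) (c : ℂ) : MvPolynomial (Fin m) ℂ := ∑ j, C (φ (Pi.single j 1)) * X j - C c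
lemma eval_linP {m : ℕ} (φ : (Fin m → ℂ) →ₗ[ℂ] ℂ) (c : ℂ) (x : Fin m → ℂ) : eval x (linP φ c) = φ x - c := by
  have : x = ∑ j, x j • Pi.single j 1 := pi_eq_sum_univ' x
  conv_rhs => rw [this, map_sum]
  simp [linP, mul_comm]
lemma deg_linP {m : ℕ} (φ : (Fin m → ℂ) →ₗ[ℂ] ℂ) (c : ℂ) : (linP φ c).totalDegree ≤ 1 := by
  refine (totalDegree_sub _ _).trans (max_le ((totalDegree_finsetSum _ _).trans (Finset.sup_le fun j _ => ?_)) (by simp))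
  exact (totalDegree_mul _ _).trans (by simp)
lemma lin_of_deg {f : MvPolynomial (Fin n) ℂ} (hf : f.totalDegree ≤ 1) :
    ∃ (φ : (Fin n → ℂ) →ₗ[ℂ] ℂ) (c : ℂ), ∀ x, eval x f = φ x + c := by
  rw [f.as_sum]
  refine Finset.sum_induction _ (fun f => ∃ (φ : (Fin n → ℂ) →ₗ[ℂ] ℂ) (c : ℂ), ∀ x, eval x f = φ x + c) ?_ ⟨0, 0, by simp⟩ ?_
  · rintro f g ⟨φ, c, h⟩ ⟨ψ, d, h'⟩
    exact ⟨φ + ψ, c + d, fun x => by simp [h, h']; ring⟩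
  · intro d hd
    have h1 : d.degree ≤ 1 := (le_totalDegree hd).trans hf
    rcases Nat.le_one_iff_eq_zero_or_eq_one.1 h1 with h | h
    · rw [Finsupp.degree_eq_zero_iff] at h
      exact ⟨0, coeff d f, fun x => by simp [h]⟩
    · obtain ⟨j, rfl⟩ := (Finsupp.sum_eq_one_iff d).1 h
      exact ⟨coeff (Finsupp.single j 1) f • LinearMap.proj j, 0, fun x => by simp [eval_monomial]⟩
lemma deg_bdd {P : Ideal (MvPolynomial (Fin n) ℂ)} [P.IsPrime] {e N : ℕ} (hP : IsHF P e N) {L : AffineSubspace ℂ (Fin n → ℂ)}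
    (hf : (zeroLocus n P ∩ L).Finite) : (zeroLocus n P ∩ L).ncard ≤ N := by
  rcases (L : Set (Fin n → ℂ)).eq_empty_or_nonempty with h | ⟨x, hx⟩
  · rw [h]; simp
  obtain ⟨K, hK⟩ := L.direction.exists_isCompl
  let π := Submodule.projection _ _ hK.symm
  have hπ : LinearMap.ker π = L.direction := Submodule.ker_projection hK.symm
  have he : (L : Set (Fin n → ℂ)) = zeroLocus n {g | g ∈ List.ofFn fun i => linP (LinearMap.proj i ∘ₗ π) (π x i)} := by
    ext y
    rw [SetLike.mem_coe, ← AffineSubspace.vsub_right_mem_direction_iff_mem hx, ← hπ, LinearMap.mem_ker, vsub_eq_sub, map_sub, sub_eq_zero, _root_.funext_iff]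
    simp [zeroLocus, eval_linP, sub_eq_zero]
  rw [he] at hf ⊢
  refine sec_le _ P e N hP (fun g hg => ?_) hf
  obtain ⟨i, rfl⟩ := (List.mem_ofFn' _ _).1 hg
  exact deg_linP _ _
theorem deg_ge {P : Ideal (MvPolynomial (Fin n) ℂ)} [hp : P.IsPrime] {e N : ℕ} (hP : IsHF P e N) : N ≤ degree n (zeroLocus n P) := by
  classical
  obtain ⟨e', alg, N', h⟩ := exists_Noe P
  have hH := h.isHF
  have := h.faith
  have := h.tower
  let _ := FractionRing.liftAlgebra (Bp ℂ e') (FractionRing (MvPolynomial (Fin n) ℂ ⧸ P))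
  obtain ⟨rfl, hN⟩ := hP.unique hH
  let _ : Module (Bp ℂ e') (MvPolynomial (Fin n) ℂ ⧸ P) := alg.toModule
  have hfin := finite_of_red' (Module.Finite.iff_fg.1 (Vm_fin P 1)) (one_mem_Vm P 1) (Vm_gen P) h.red
  have : Module.Finite (Kp ℂ e') (FractionRing (MvPolynomial (Fin n) ℂ ⧸ P)) := Module.finite_of_finrank_pos hH.pos
  obtain ⟨y, θ, Z, hZ, hQ⟩ := fib (e := e') (A := MvPolynomial (Fin n) ℂ ⧸ P)
  rw [hN] at hZ
  choose ℓ hℓ hℓy using fun i => mem_Vm.1 (h.memV i)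
  choose φ c hφ using fun i => lin_of_deg (hℓ i)
  have hC : ∀ z, algebraMap (Bp ℂ e') (MvPolynomial (Fin n) ℂ ⧸ P) (C z) = Ideal.Quotient.mk P (C z) := fun z =>
    (IsScalarTower.algebraMap_apply ℂ (Bp ℂ e') _ z).symm
  have hX : ∀ i, algebraMap (Bp ℂ e') (MvPolynomial (Fin n) ℂ ⧸ P) (X i) = Ideal.Quotient.mk P (ℓ i) := fun i => (hℓy i).symm
  obtain ⟨t, rfl⟩ := Ideal.Quotient.mk_surjective θ
  have hpt : ∀ c ∈ Z, ∃ x ∈ zeroLocus n P, (∀ i, eval x (ℓ i) = y i) ∧ eval x t = c := by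
    intro c hc
    obtain ⟨Q, hm, h1, h2⟩ := hQ c hc
    have := Ideal.comap_isMaximal_of_surjective (Ideal.Quotient.mk P) Ideal.Quotient.mk_surjective (K := Q)
    obtain ⟨x, hx⟩ := MvPolynomial.isMaximal_iff_eq_vanishingIdeal_singleton.1 this
    have hx' : ∀ f, Ideal.Quotient.mk P f ∈ Q → eval x f = 0 := fun f hf => by
      have : f ∈ Q.comap (Ideal.Quotient.mk P) := hf
      rw [hx, MvPolynomial.mem_vanishingIdeal_singleton_iff] at this
      simpa using this
    refine ⟨x, fun f hf => hx' f (by rw [Ideal.Quotient.eq_zero_iff_mem.2 hf]; exact zero_mem _), fun i => ?_, ?_⟩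
    · have := h1 i
      rw [map_sub, hC, hX, ← map_sub] at this
      simpa [sub_eq_zero] using hx' _ this
    · rw [hC, ← map_sub] at h2
      simpa [sub_eq_zero] using hx' _ h2
  choose! x hxP hxy hxt using hpt
  obtain ⟨z0, hz0⟩ := Finset.card_pos.1 (hZ ▸ hP.pos)
  let Φ : (Fin n → ℂ) →ₗ[ℂ] (Fin e' → ℂ) := LinearMap.pi φ
  have hsurj : LinearMap.range Φ = ⊤ := by
    by_contra hne
    obtain ⟨f, hf0, hf⟩ := Submodule.exists_le_ker_of_lt_top _ (lt_top_iff_ne_top.2 hne)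
    have hfx : ∀ v, f (Φ v) = 0 := fun v => hf ⟨v, rfl⟩
    have hz : algebraMap (Bp ℂ e') (MvPolynomial (Fin n) ℂ ⧸ P) (linP f (f c)) = 0 := by
      have : algebraMap (Bp ℂ e') (MvPolynomial (Fin n) ℂ ⧸ P) (linP f (f c)) =
          Ideal.Quotient.mk P (∑ j, C (f (Pi.single j 1)) * ℓ j - C (f c)) := by
        simp only [linP, map_sub, map_sum, map_mul, hC, hX]
      rw [this]
      refine (congrArg _ (MvPolynomial.funext fun v => ?_)).trans (RingHom.map_zero _)
      have h2 := eval_linP f (f c) (fun j => eval v (ℓ j))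
      have h3 : (fun j => eval v (ℓ j)) = Φ v + c := by ext j; simp [hφ, Φ]
      rw [h3, map_add, hfx, zero_add, sub_self] at h2
      rw [map_zero, ← h2, ← h3]
      simp [linP]
    have h0 := (map_eq_zero_iff _ (FaithfulSMul.algebraMap_injective (Bp ℂ e') (MvPolynomial (Fin n) ℂ ⧸ P))).1 hz
    have h1 : ∀ v, f v = f c := fun v => by
      have := eval_linP f (f c) v
      rw [h0, map_zero] at this
      exact (sub_eq_zero.1 this.symm)
    exact hf0 (LinearMap.ext fun v => by rw [h1 v, ← h1 0]; simp)
  let L := AffineSubspace.mk' (x z0) (LinearMap.ker Φ)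
  have hmem : ∀ v, v ∈ L ↔ ∀ i, eval v (ℓ i) = y i := fun v => by
    rw [AffineSubspace.mem_mk', LinearMap.mem_ker, vsub_eq_sub, map_sub, sub_eq_zero, _root_.funext_iff]
    refine forall_congr' fun i => ?_
    rw [← hxy z0 hz0 i, hφ, hφ]; simp [Φ]
  have hF : (zeroLocus n P ∩ L).Finite := by
    choose G hGm hG using fun j => Algebra.IsIntegral.isIntegral (R := Bp ℂ e') (Ideal.Quotient.mk P (X j))
    refine (Set.Finite.pi' fun j => (((G j).map (eval y)).roots.toFinset.finite_toSet)).subset fun v hv j => ?_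
    let ev : MvPolynomial (Fin n) ℂ ⧸ P →+* ℂ := Ideal.Quotient.lift P (eval v) hv.1
    have hm : ∀ f, ev (Ideal.Quotient.mk P f) = eval v f := fun f => rfl
    have hev : ev.comp (algebraMap (Bp ℂ e') (MvPolynomial (Fin n) ℂ ⧸ P)) = eval y := by
      refine MvPolynomial.ringHom_ext (fun z => ?_) fun i => ?_
      · rw [RingHom.comp_apply, hC, hm]; simp
      · rw [RingHom.comp_apply, hX, hm]; simpa using (hmem v).1 hv.2 i
    have h2 := congrArg ev (hG j)
    rw [Polynomial.hom_eval₂, hev, hm, map_zero] at h2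
    simp only [Finset.mem_coe, Multiset.mem_toFinset, Polynomial.mem_roots ((hGm j).map (eval y)).ne_zero, Polynomial.IsRoot, Polynomial.eval_map]
    simpa using h2
  have hle : N ≤ (zeroLocus n P ∩ L).ncard := by
    rw [← hZ, ← Set.ncard_coe_finset]
    exact Set.ncard_le_ncard_of_injOn x (fun c hc => ⟨hxP c hc, (hmem _).2 (hxy c hc)⟩)
      (fun a ha b hb hab => by rw [← hxt a ha, ← hxt b hb, hab]) hF
  refine hle.trans (le_csSup ⟨N, ?_⟩ ⟨L, ?_, hF, rfl⟩)
  · rintro _ ⟨L, -, hf, rfl⟩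
    exact deg_bdd hP hf
  · have := Φ.finrank_range_add_finrank_ker
    rw [hsurj, finrank_top] at this
    simp at this
    rw [AffineSubspace.direction_mk', dim_zl hP]; omega
end Deg

section Hyp
variable {n : ℕ}
lemma real_HF {P : Ideal (MvPolynomial (Fin n) ℂ)} [hp : P.IsPrime] {e N : ℕ} (hP : IsHF P e N) :
    ∃ N' ≤ 2 * N, IsHF (P.comap (map (algebraMap ℝ ℂ))) e N' := by
  obtain ⟨p, hp'⟩ : ∃ p, p = P.comap (map (algebraMap ℝ ℂ)) := ⟨_, rfl⟩
  have hpr : p.IsPrime := by rw [hp']; infer_instance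
  rw [← hp']
  let φ : (MvPolynomial (Fin n) ℝ ⧸ p) →+* (MvPolynomial (Fin n) ℂ ⧸ P) := Ideal.quotientMap P (map (algebraMap ℝ ℂ)) hp'.le
  have hφ : Function.Injective φ := Ideal.quotientMap_injective' hp'.ge
  have hφm : ∀ f, φ (Ideal.Quotient.mk p f) = Ideal.Quotient.mk P (map (algebraMap ℝ ℂ) f) := fun f => rfl
  have hdm : ∀ f : MvPolynomial (Fin n) ℝ, (map (algebraMap ℝ ℂ) f).totalDegree ≤ f.totalDegree := fun f => Finset.sup_mono (support_map_subset _ _)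
  have hsm : ∀ (r : ℝ) a, φ (r • a) = r • φ a := fun r a => by
    obtain ⟨f, rfl⟩ := Ideal.Quotient.mk_surjective a
    change φ (Ideal.Quotient.mk p (r • f)) = Ideal.Quotient.mk P (r • map (algebraMap ℝ ℂ) f)
    rw [hφm, smul_eq_C_mul, map_mul, map_C]
    congr 1
    rw [← algebraMap_smul ℂ r, smul_eq_C_mul]
  let φl : (MvPolynomial (Fin n) ℝ ⧸ p) →ₗ[ℝ] (MvPolynomial (Fin n) ℂ ⧸ P) := { φ with map_smul' := hsm }
  have h1 : ∀ m, hf p m ≤ 2 * hf P m := fun m => by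
    rw [hf, hf, ← finrank_real_of_complex]
    have hm : ∀ a ∈ Vm p m, φl a ∈ (Vm P m).restrictScalars ℝ := fun a ha => by
      obtain ⟨f, hf, rfl⟩ := mem_Vm.1 ha
      exact mem_Vm.2 ⟨_, (hdm f).trans hf, rfl⟩
    have : Module.Finite ℝ ((Vm P m).restrictScalars ℝ) := Module.Finite.trans (R := ℝ) ℂ (Vm P m)
    exact LinearMap.finrank_le_finrank_of_injective (f := φl.restrict hm)
      fun a b hab => Subtype.ext (hφ (congrArg Subtype.val hab))
  have h2 : ∀ m, hf P m ≤ hf p m := fun m => by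
    have hfr : Module.Free ℝ (Vm p m) := Module.Free.of_divisionRing ℝ _
    let b := Module.finBasis ℝ (Vm p m)
    have hle : Vm P m ≤ Submodule.span ℂ (range fun i => φ (b i)) := by
      intro a ha
      obtain ⟨f, hf, rfl⟩ := mem_Vm.1 ha
      rw [f.as_sum, map_sum]
      refine sum_mem fun d hd => ?_
      have h3 : Ideal.Quotient.mk p (monomial d (1:ℝ)) ∈ Vm p m :=
        mem_Vm.2 ⟨_, (totalDegree_monomial_le _ _).trans ((le_totalDegree hd).trans hf), rfl⟩
      have h4 := congrArg (fun v : Vm p m => φl v) (b.sum_repr ⟨_, h3⟩)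
      have h5 : Ideal.Quotient.mk P (monomial d (coeff d f)) = coeff d f • φ (Ideal.Quotient.mk p (monomial d 1)) := by
        rw [hφm, map_monomial, ← Ideal.Quotient.mkₐ_eq_mk ℂ, ← map_smul, smul_monomial]; simp
      rw [h5]
      refine Submodule.smul_mem _ _ ?_
      refine (congrArg (· ∈ Submodule.span ℂ (range fun i => φ (b i))) h4).mp ?_
      beta_reduce
      rw [Submodule.coe_sum, map_sum]
      refine sum_mem fun i _ => ?_
      rw [Submodule.coe_smul, map_smul, ← algebraMap_smul ℂ]
      exact Submodule.smul_mem _ _ (Submodule.subset_span ⟨i, rfl⟩)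
    have : Module.Finite ℂ (Submodule.span ℂ (range fun i => φ (b i))) := Module.Finite.span_of_finite _ (finite_range _)
    refine (Submodule.finrank_mono hle).trans ((finrank_range_le_card _).trans (by simp [hf]))
  obtain ⟨e', N', h⟩ := exists_HF p
  obtain ⟨m0, hm⟩ := h.lower
  obtain ⟨m1, hm1⟩ := hP.lower
  have g1 := growth N' (2 * N) 1 m0 e' e h.pos fun s => (hm s).trans ((h1 _).trans (by
    have := hP.upper (m0 + s); rw [one_mul, mul_assoc, add_comm s m0]; omega))
  have g2 := growth N N' 1 m1 e e' hP.pos fun s => (hm1 s).trans ((h2 _).trans (by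
    have := h.upper (m1 + s); rwa [one_mul, add_comm s m1]))
  obtain rfl : e' = e := by omega
  exact ⟨N', by simpa using g1, h⟩
lemma hyp {W : Set (Fin n → ℂ)} (hn : 1 ≤ n) (hW : IsIrredVariety n W) (hd : dim n W = n - 1) :
    ∃ f : MvPolynomial (Fin n) ℂ, f.totalDegree ≤ n * degree n W ∧ ∀ x, x ∈ W ↔ eval x f = 0 := by
  classical
  obtain ⟨n, rfl⟩ : ∃ m, n = m + 1 := ⟨n - 1, by omega⟩
  have hp := vi_prime hW
  rw [← zl_vi hW.1] at hd ⊢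
  generalize vanishingIdeal (n + 1) W = P at *
  obtain ⟨e, N, hP⟩ := exists_HF P
  rw [dim_zl hP] at hd
  obtain rfl : e = n := by omega
  have hex : ∃ f ∈ P, f ≠ 0 ∧ f.totalDegree ≤ (e + 1) * N := by
    by_contra! h
    have h1 := hf_add P ((e + 1) * N)
    have h2 := hP.upper ((e + 1) * N)
    have h3 : Im P ((e + 1) * N) = ⊥ := by
      rw [eq_bot_iff]; intro f hm
      by_contra h0
      have := mem_Im.1 hm
      exact absurd this.2 (not_le.2 (h f this.1 h0))
    rw [h3, finrank_bot, add_zero] at h1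
    have h4 := Nat.add_one_mul_choose_eq ((e + 1) * N + e) e
    have h5 : 0 < ((e + 1) * N + e).choose e := Nat.choose_pos (by omega)
    rw [h1, ← add_assoc] at h2
    nlinarith
  obtain ⟨f0, h0P, h00, h0d⟩ := hex
  obtain ⟨f, ⟨hfP, hf0⟩, hmin⟩ := WellFounded.has_min (measure (totalDegree (R := ℂ) (σ := Fin (e + 1)))).wf {f | f ∈ P ∧ f ≠ 0} ⟨f0, h0P, h00⟩
  have hm : ∀ g ∈ P, g ≠ 0 → f.totalDegree ≤ g.totalDegree := fun g h1 h2 => not_lt.1 (hmin g ⟨h1, h2⟩)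
  have hkey : ∀ a b, f = a * b → a ∈ P → IsUnit b := fun a b hab ha => by
    have hb : b ≠ 0 := by rintro rfl; exact hf0 (by rw [hab, mul_zero])
    have ha0 : a ≠ 0 := by rintro rfl; exact hf0 (by rw [hab, zero_mul])
    have := hm a ha ha0
    rw [hab, totalDegree_mul_of_isDomain ha0 hb] at this
    have h0 : b.totalDegree = 0 := by omega
    rw [totalDegree_eq_zero_iff_eq_C] at h0
    rw [h0]; refine IsUnit.map C (IsUnit.mk0 _ fun h => hb (by rw [h0, h, map_zero]))
  have hirr : Irreducible f := ⟨fun h => hp.ne_top (Ideal.eq_top_of_isUnit_mem _ hfP h), fun a b hab =>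
    (hp.mem_or_mem (hab ▸ hfP)).elim (fun h => Or.inr (hkey a b hab h)) fun h => Or.inl (hkey b a (by rw [hab, mul_comm]) h)⟩
  have hspr : (Ideal.span {f}).IsPrime := (Ideal.span_singleton_prime hf0).2 hirr.prime
  have heq : Ideal.span {f} = P := by
    by_contra hne
    obtain ⟨e', N', h'⟩ := exists_HF (Ideal.span {f})
    have h1 := h'.lt_of_lt hP (lt_of_le_of_ne ((Ideal.span_singleton_le_iff_mem _).2 hfP) hne)
    have hb := Ideal.isPrime_bot (α := MvPolynomial (Fin (e + 1)) ℂ)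
    have h2 := bot_isHF.lt_of_lt h' (bot_lt_iff_ne_bot.2 (by simpa using hf0))
    omega
  refine ⟨f, (hm f0 h0P h00).trans (h0d.trans (Nat.mul_le_mul_left _ (deg_ge hP))), fun x => ⟨fun h => h f hfP, fun h => ?_⟩⟩
  rw [le_ker, ← heq, Ideal.span_singleton_le_iff_mem]; exact h
lemma comp_min {t W : Set (Fin n → ℂ)} (ht : IsAlgebraicSet n t) (h : IsIrredComponent n W t) :
    vanishingIdeal n W ∈ (vanishingIdeal n t).minimalPrimes := by
  refine ⟨⟨vi_prime h.1, vi_anti h.2.1⟩, fun Q ⟨hQ, hQt⟩ hQW => ?_⟩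
  have := h.2.2 _ (zl_irr Q) (by rw [← zl_vi h.1.1]; exact zl_anti hQW) (by rw [← zl_vi ht]; exact zl_anti hQt)
  rw [← this, nsz]
lemma comp_fin {t : Set (Fin n → ℂ)} (ht : IsAlgebraicSet n t) : {W | IsIrredComponent n W t}.Finite :=
  Set.Finite.of_finite_image ((Ideal.finite_minimalPrimes_of_isNoetherianRing _ (vanishingIdeal n t)).subset
    (Set.image_subset_iff.2 fun _ h => comp_min ht h))
    fun V hV W hW h => by rw [← zl_vi hV.1.1, ← zl_vi hW.1.1, h]
lemma comp_cov {t : Set (Fin n → ℂ)} (ht : IsAlgebraicSet n t) {x : Fin n → ℂ} (hx : x ∈ t) : ∃ W, IsIrredComponent n W t ∧ x ∈ W := by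
  have hk : (RingHom.ker (eval x)).IsPrime := RingHom.ker_isPrime _
  obtain ⟨Q, hQ, hQx⟩ := Ideal.exists_minimalPrimes_le (I := vanishingIdeal n t) (J := RingHom.ker (eval x)) fun f hf => hf x hx
  have := hQ.1.1
  refine ⟨zeroLocus n Q, ⟨zl_irr Q, ?_, fun W hW h1 h2 => ?_⟩, hQx⟩
  · rw [← zl_vi ht]; exact zl_anti hQ.1.2
  · have h3 : vanishingIdeal n W ≤ Q := by rw [← nsz Q]; exact vi_anti h1
    have h4 := hQ.2 ⟨vi_prime hW, vi_anti h2⟩ h3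
    rw [le_antisymm h4 h3, zl_vi hW.1]
lemma deg_pos {V : Set (Fin n → ℂ)} (h : IsIrredVariety n V) : 1 ≤ degree n V := by
  have := vi_prime h
  obtain ⟨e, N, hP⟩ := exists_HF (vanishingIdeal n V)
  have h2 := deg_ge hP
  rw [zl_vi h.1] at h2
  exact hP.pos.trans h2
lemma degSum_eq {t : Set (Fin n → ℂ)} (ht : IsAlgebraicSet n t) : degreeSum n t = ∑ W ∈ (comp_fin ht).toFinset, degree n W :=
  finsum_mem_eq_finite_toFinset_sum _ _
lemma degSum_pos {t : Set (Fin n → ℂ)} (ht : IsAlgebraicSet n t) (hne : t.Nonempty) : 1 ≤ degreeSum n t := by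
  obtain ⟨x, hx⟩ := hne
  obtain ⟨W, hW, -⟩ := comp_cov ht hx
  rw [degSum_eq ht]
  exact (deg_pos hW.1).trans (Finset.single_le_sum (f := degree n) (fun _ _ => Nat.zero_le _) (by simpa using hW))
def rp (L : ℂ →ₗ[ℝ] ℝ) (F : MvPolynomial (Fin n) ℂ) : MvPolynomial (Fin n) ℝ := ∑ d ∈ F.support, monomial d (L (coeff d F))
lemma eval_rp (L : ℂ →ₗ[ℝ] ℝ) (F : MvPolynomial (Fin n) ℂ) (x : Fin n → ℝ) : eval x (rp L F) = L (eval (toC n x) F) := by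
  rw [rp, map_sum, eval_eq, map_sum]
  refine Finset.sum_congr rfl fun d _ => ?_
  have : coeff d F * ∏ i ∈ d.support, toC n x i ^ d i = (∏ i ∈ d.support, x i ^ d i) • coeff d F := by
    rw [Complex.real_smul, mul_comm]; simp [toC]
  rw [this, map_smul, eval_monomial, smul_eq_mul, mul_comm, Finsupp.prod]
lemma deg_rp (L : ℂ →ₗ[ℝ] ℝ) (F : MvPolynomial (Fin n) ℂ) : (rp L F).totalDegree ≤ F.totalDegree :=
  (totalDegree_finsetSum _ _).trans (Finset.sup_le fun _ hd => (totalDegree_monomial_le _ _).trans (le_totalDegree hd))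
lemma hyp_real (hn : 1 ≤ n) {t : Set (Fin n → ℂ)} (ht : IsAlgSetOfDim n t (n - 1)) :
    ∃ g : MvPolynomial (Fin n) ℝ, g.totalDegree ≤ 2 * n * degreeSum n t ∧ ∀ x, toC n x ∈ t ↔ eval x g = 0 := by
  obtain ⟨ha, -, hc⟩ := ht
  choose! f hfd hf using fun (W) (h : IsIrredComponent n W t) => hyp hn h.1 (hc W h)
  let F := ∏ W ∈ (comp_fin ha).toFinset, f W
  have hd : F.totalDegree ≤ n * degreeSum n t := by
    rw [degSum_eq ha, Finset.mul_sum]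
    exact (totalDegree_finsetProd _ _).trans (Finset.sum_le_sum fun W hW => hfd W (by simpa using hW))
  have hF : ∀ x, x ∈ t ↔ eval x F = 0 := fun x => by
    rw [map_prod, Finset.prod_eq_zero_iff]
    constructor
    · intro hx
      obtain ⟨W, hW, hxW⟩ := comp_cov ha hx
      exact ⟨W, by simpa using hW, (hf W hW x).1 hxW⟩
    · rintro ⟨W, hW, h⟩
      have hW' : IsIrredComponent n W t := by simpa using hW
      exact hW'.2.1 ((hf W hW' x).2 h)
  refine ⟨rp Complex.reLm F ^ 2 + rp Complex.imLm F ^ 2, (totalDegree_add _ _).trans (max_le ?_ ?_), fun x => ?_⟩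
  · refine (totalDegree_pow _ _).trans ?_
    have := deg_rp Complex.reLm F; rw [mul_assoc]; omega
  · refine (totalDegree_pow _ _).trans ?_
    have := deg_rp Complex.imLm F; rw [mul_assoc]; omega
  · rw [hF, map_add, map_pow, map_pow, eval_rp, eval_rp, Complex.ext_iff]
    simp only [Complex.reLm_coe, Complex.imLm_coe, Complex.zero_re, Complex.zero_im]
    constructor
    · rintro ⟨h1, h2⟩; rw [h1, h2]; simp
    · intro h; constructor <;> nlinarith [sq_nonneg (eval (toC n x) F).re, sq_nonneg (eval (toC n x) F).im]
end Hyp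

section Fin
variable {n : ℕ}
lemma one_pt {V : Set (Fin n → ℂ)} {N : ℕ} (hV : IsIrredVariety n V) (hP : IsHF (vanishingIdeal n V) 0 N)
    {x y : Fin n → ℂ} (hx : x ∈ V) (hy : y ∈ V) : x = y := by
  have hp := vi_prime hV
  have key : ∀ z ∈ V, vanishingIdeal n V = RingHom.ker (eval z) := fun z hz => by
    by_contra hne
    have hk : (RingHom.ker (eval z)).IsPrime := RingHom.ker_isPrime _
    obtain ⟨e', N', h'⟩ := exists_HF (RingHom.ker (eval z))
    have := hP.lt_of_lt h' (lt_of_le_of_ne (fun f hf => hf z hz) hne)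
    omega
  funext i
  have h1 : X i - C (x i) ∈ RingHom.ker (eval y) := by
    rw [← key y hy, key x hx]; simp [RingHom.mem_ker]
  rw [RingHom.mem_ker] at h1
  simp only [map_sub, eval_X, eval_C, sub_eq_zero] at h1
  exact h1.symm
lemma toC_inj {x y : Fin n → ℝ} (h : toC n x = toC n y) : x = y := by
  funext i; exact Complex.ofReal_injective (congrFun h i)
lemma eval_toC (x : Fin n → ℝ) (f : MvPolynomial (Fin n) ℝ) : eval (toC n x) (map (algebraMap ℝ ℂ) f) = ((eval x f : ℝ) : ℂ) := by
  rw [eval_map]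
  exact (eval₂_comp (algebraMap ℝ ℂ) x f).symm
lemma card_le_deg {T : Finset (Set (Fin n → ℂ))} (hT : ∀ t ∈ T, IsAlgSetOfDim n t (n - 1)) : T.card ≤ degFamily n T := by
  rw [degFamily, Finset.card_eq_sum_ones]
  exact Finset.sum_le_sum fun t ht => degSum_pos (hT t ht).1 (hT t ht).2.1
open Classical in
lemma inc_one {S : Finset (Fin n → ℝ)} {T : Finset (Set (Fin n → ℂ))} {b : ℕ} (hb : 1 ≤ b)
    (h : KBFree (fun s t => toC n s ∈ t) S T 1 b) : incCount n S T ≤ (b - 1) * S.card := by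
  have h1 : incCount n S T = ∑ t ∈ T, ∑ x ∈ S, if toC n x ∈ t then 1 else 0 := by
    refine Finset.sum_congr rfl fun t _ => ?_
    rw [← Finset.card_filter, ← Set.ncard_coe_finset]
    congr 1; ext x; simp
  rw [h1, Finset.sum_comm, mul_comm, ← smul_eq_mul]
  refine Finset.sum_le_card_nsmul _ _ _ fun x hx => ?_
  rw [← Finset.card_filter]
  by_contra hc
  obtain ⟨B, hB, hBc⟩ := Finset.exists_subset_card_eq (s := T.filter fun t => toC n x ∈ t) (n := b) (by omega)
  refine h ⟨{x}, B, by simpa using hx, hB.trans (Finset.filter_subset _ _), by simp, hBc, fun s hs t ht => ?_⟩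
  rw [Finset.mem_singleton.1 hs]
  exact (Finset.mem_filter.1 (hB ht)).2
lemma exps {k e : ℕ} (hk : 2 ≤ k) : 0 ≤ beta k (e + 1) ∧ beta k (e + 1) ≤ 1 ∧ 0 ≤ 1 - alpha k (e + 1) ∧ 1 - alpha k (e + 1) ≤ 1 := by
  have h1 : (2 : ℝ) ≤ k := by exact_mod_cast hk
  have h0 : (0 : ℝ) ≤ e := Nat.cast_nonneg e
  have hne : ¬ (k = 1 ∧ e + 1 = 1) := by omega
  have hpos : 0 < ((e + 1 : ℕ) : ℝ) * k - 1 := by push_cast; nlinarith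
  rw [alpha, beta, if_neg hne, if_neg hne]
  refine ⟨div_nonneg ?_ hpos.le, (div_le_one hpos).2 ?_, sub_nonneg.2 ((div_le_one hpos).2 ?_), sub_le_self _ (div_nonneg ?_ hpos.le)⟩ <;> push_cast <;> nlinarith
lemma rpow_mul_le {a x s : ℝ} (ha : 1 ≤ a) (hx : 0 ≤ x) (h1 : s ≤ 1) : (a * x) ^ s ≤ a * x ^ s := by
  rw [Real.mul_rpow (by linarith) hx]
  gcongr
  calc a ^ s ≤ a ^ (1 : ℝ) := Real.rpow_le_rpow_of_exponent_le ha h1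
    _ = a := Real.rpow_one a
end Fin
theorem statement5 (n : ℕ) :
    ∃ C : ℝ, 0 < C ∧
      ∀ (V : Set (Fin n → ℂ)) (d : ℕ), IsIrredVariety n V → dim n V = d →
        ∀ T : Finset (Set (Fin n → ℂ)), (∀ t ∈ T, IsAlgSetOfDim n t (n - 1)) →
          ∀ S : Finset (Fin n → ℝ), (∀ x ∈ S, toC n x ∈ V) →
            ∀ k b : ℕ, 1 ≤ k → 1 ≤ b →
              KBFree (fun s t => toC n s ∈ t) S T k b →
              ∃ c1 : ℝ, c1 ≤ C * tauC d b k ∧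
                (incCount n S T : ℝ) ≤
                  c1 * (S.card : ℝ) ^ alpha k d * (degFamily n T : ℝ) ^ beta k d *
                      (degree n V : ℝ) ^ (1 - alpha k d)
                    + (k : ℝ) * (degFamily n T : ℝ) * (degree n V : ℝ)
                    + ((b : ℝ) - 1) * (S.card : ℝ) := by
  obtain ⟨C, hC, hmain⟩ := inc_final n
  refine ⟨C * ((2 * n + 1) * 2), by positivity, ?_⟩
  intro V d hV hd T hT S hS k b hk hb hfree
  have hpr := vi_prime hV
  obtain ⟨e, N, hP⟩ := exists_HF (vanishingIdeal n V)
  have hed := dim_zl hP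
  have hN := deg_ge hP
  rw [zl_vi hV.1] at hed hN
  obtain rfl : e = d := by omega
  have htau : 0 ≤ tauC e b k := by rw [tauC]; positivity
  have hcd := card_le_deg hT
  have hV1 : 1 ≤ degree n V := deg_pos hV
  have hb1 : (0 : ℝ) ≤ (b : ℝ) - 1 := by
    have : (1 : ℝ) ≤ b := by exact_mod_cast hb
    linarith
  have hcd' : (T.card : ℝ) ≤ (degFamily n T : ℝ) * degree n V := by
    exact_mod_cast hcd.trans (Nat.le_mul_of_pos_right _ hV1)
  by_cases h0 : e = 0
  · subst h0
    refine ⟨0, by positivity, ?_⟩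
    have h1 : incCount n S T ≤ T.card := by
      rw [incCount, Finset.card_eq_sum_ones]
      refine Finset.sum_le_sum fun t _ => Set.ncard_le_one_iff (S.finite_toSet.inter_of_left _) |>.2 ?_
      intro x y hx hy
      exact toC_inj (one_pt hV hP (hS x hx.1) (hS y hy.1))
    have h2 : (incCount n S T : ℝ) ≤ T.card := by exact_mod_cast h1
    have h3 : (1 : ℝ) ≤ k := by exact_mod_cast hk
    have h4 : 0 ≤ ((b : ℝ) - 1) * S.card := by positivity
    have h5 : (0 : ℝ) ≤ (degFamily n T : ℝ) * degree n V := by positivity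
    rw [zero_mul, zero_mul, zero_mul, mul_assoc]
    nlinarith
  by_cases hk1 : k = 1
  · subst hk1
    refine ⟨0, by positivity, ?_⟩
    have h1 : ((incCount n S T : ℕ) : ℝ) ≤ (((b - 1) * S.card : ℕ) : ℝ) := by exact_mod_cast inc_one hb hfree
    rw [Nat.cast_mul, Nat.cast_sub hb, Nat.cast_one] at h1
    have h5 : (0 : ℝ) ≤ (degFamily n T : ℝ) * degree n V := by positivity
    rw [zero_mul, zero_mul, zero_mul, Nat.cast_one]
    linarith
  obtain ⟨e, rfl⟩ : ∃ m, e = m + 1 := ⟨e - 1, by omega⟩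
  have hk2 : 2 ≤ k := by omega
  have hn : 1 ≤ n := by have := hP.le_n; omega
  choose! g hgd hg using fun t (ht : t ∈ T) => hyp_real hn (hT t ht)
  obtain ⟨N', hN', hp⟩ := real_HF hP
  have hpr' : ((vanishingIdeal n V).comap (map (algebraMap ℝ ℂ))).IsPrime := inferInstance
  have hinc : incCount n S T = inc S T g := by
    classical
    refine Finset.sum_congr rfl fun t ht => ?_
    rw [← Set.ncard_coe_finset]
    congr 1; ext x; simp [hg t ht]
  have hfree' : KBFree (fun x t => eval x (g t) = 0) S T k b := by
    rintro ⟨P, B, h1, h2, h3, h4, h5⟩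
    exact hfree ⟨P, B, h1, h2, h3, h4, fun s hs t ht => (hg t (h2 ht) s).2 (h5 s hs t ht)⟩
  have H := hmain ((vanishingIdeal n V).comap (map (algebraMap ℝ ℂ))) e N' S _ T g (fun t => 2 * n * degreeSum n t) k b
    (2 * n * degFamily n T) hp (fun x hx f hf => by
      have : eval (toC n x) (map (algebraMap ℝ ℂ) f) = 0 := hf _ (hS x hx)
      rw [eval_toC] at this; exact_mod_cast this)
    (fun t ht => ⟨by
      have := degSum_pos (hT t ht).1 (hT t ht).2.1
      have h2 : 0 < 2 * n := by omega
      exact Nat.mul_pos h2 this, hgd t ht⟩) (by rw [degFamily, Finset.mul_sum]) hk2 hb hfree'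
  refine ⟨C * ((2 * n + 1) * 2) * tauC (e + 1) b k, le_rfl, ?_⟩
  obtain ⟨b0, b1, a0, a1⟩ := exps (e := e) hk2
  rw [hinc]
  refine H.trans ?_
  gcongr ?_ + ?_ + _
  · have q1 : (((2 * n * degFamily n T : ℕ) : ℝ)) ^ beta k (e + 1) ≤ (2 * n + 1) * (degFamily n T : ℝ) ^ beta k (e + 1) := by
      refine le_trans ?_ (rpow_mul_le (a := 2 * n + 1) (by have : (0:ℝ) ≤ n := Nat.cast_nonneg n; linarith) (Nat.cast_nonneg _) b1)
      refine Real.rpow_le_rpow (Nat.cast_nonneg _) ?_ b0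
      push_cast; gcongr; linarith
    have q2 : (N' : ℝ) ^ (1 - alpha k (e + 1)) ≤ 2 * (degree n V : ℝ) ^ (1 - alpha k (e + 1)) := by
      refine le_trans ?_ (rpow_mul_le (by norm_num) (Nat.cast_nonneg _) a1)
      refine Real.rpow_le_rpow (Nat.cast_nonneg _) ?_ a0
      exact_mod_cast hN'.trans (Nat.mul_le_mul_left 2 hN)
    calc _ ≤ C * (tauC (e + 1) b k * (S.card : ℝ) ^ alpha k (e + 1) * ((2 * n + 1) * (degFamily n T : ℝ) ^ beta k (e + 1)) *
          (2 * (degree n V : ℝ) ^ (1 - alpha k (e + 1)))) := by gcongr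
      _ = _ := by ring
  · rw [mul_assoc]; gcongr

end Paper
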